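/- Let η(t) = e^{−t²/2}. Let x ≥ 1, δ ∈ ℝ, and let χ be a primitive Dirichlet character mod q, q ≥ 1. Assume all nontrivial zeros ρ of L(s,χ) with |Im(ρ)| ≤ T₀ lie on the critical line, where T₀ ≥ max(4π²|δ|, 100). Then ∑_{n=1}^∞ Λ(n) χ(n) e(δn/x) η(n/x) equals η̂(−δ)x + O*(err)·x if q = 1, and O*(err)·x if q > 1, where err = log(qT₀/2π)·(4.329 e^{−0.1598 T₀} + 0.802 |δ| e^{−0.1065(T₀/(π|δ|))²}) + (2.337 √T₀ log(qT₀) + 21.817 √T₀ + 2.85 log q + 74.38) x^{−1/2} + (3 log q + 14|δ| + 17) x^{−1} + (log q + 6)(1 + 5|δ|) x^{−3/2}. -/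

import Mathlib

open MeasureTheory Set

/-- `e(t) = e^{2πit}`. -/
noncomputable def e2pi (t : ℝ) : ℂ := Complex.exp (2 * Real.pi * Complex.I * t)

local notation "bPq" => (by positivity)
local notation "Ip" => Ioi (0:ℝ)
local notation "DC" => DirichletCharacter ℂ
local notation "RR" => ℝ
local notation "CC" => ℂ
local notation "bN" => (by norm_num)
local notation "bL" => (by linarith)
local notation "bS" => (by simp)
local notation "bR" => (by ring)
local notation "EX" => Real.exp
local notation "LG" => Real.log
local notation "PI" => Real.pi
local notation "SN" => Real.sin
local notation "CS" => Real.cos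
local notation "mLL" => mul_le_mul_of_nonneg_left
local notation "mLR" => mul_le_mul_of_nonneg_right
local notation "mI" => measurableSet_Ioi
local notation "vM" => ArithmeticFunction.vonMangoldt
local notation "rN" => Real.norm_of_nonneg
local notation "eP" => Real.exp_pos
local notation "cN" => Complex.norm_real
local notation "cR" => Complex.norm_cpow_eq_rpow_re_of_pos
local notation "dI" => div_le_iff₀
local notation "lI" => le_div_iff₀
local notation "dD" => div_le_div_iff₀
local notation "iC" => integral_const_mul
local notation "eA" => Real.exp_add
local notation "rE" => Real.rpow_le_rpow_of_exponent_le
local notation "vN" => ArithmeticFunction.vonMangoldt_nonneg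
local notation "zO" => zero_le_one
local notation "eF" => Filter.Eventually.of_forall
local notation "HD" => HasDerivAt
local notation "sN" => Real.sqrt_nonneg
local notation "lO" => Real.log_le_sub_one_of_pos
local notation "iO" => intervalIntegrable_iff_integrableOn_Ioc_of_le
local notation "mC" => measurableSet_Ioc
local notation "iR" => integrableOn_Ioi_rpow_of_lt
local notation "mO" => mul_le_of_le_one_right

section HadamardA
open Complex Metric Filter Topology

lemma exists_factor (F : CC → CC) (hF : Differentiable CC F) (s0 : CC) (h0 : F s0 ≠ 0)
    (S : Finset CC) : ∃ h : CC → CC, Differentiable CC h ∧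
      (∀ z, F z = (∏ ρ ∈ S, (z - ρ) ^ (analyticOrderNatAt F ρ)) * h z) ∧ ∀ ρ ∈ S, h ρ ≠ 0 := by
  have hA : AnalyticOnNhd CC F univ := fun z _ => hF.analyticAt z
  have hord : ∀ z, analyticOrderAt F z ≠ ⊤ := fun z =>
    hA.analyticOrderAt_ne_top_of_isPreconnected isPreconnected_univ (mem_univ s0) (mem_univ z)
      (by rw [(hF.analyticAt s0).analyticOrderAt_eq_zero.2 h0]; simp)
  classical
  induction S using Finset.induction_on with
  | empty => exact ⟨F, hF, by simp, by simp⟩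
  | insert ρ S hρ ih =>
    obtain ⟨h, hd, he, hn⟩ := ih
    set n := analyticOrderNatAt F ρ with hn'
    have hP : Differentiable CC (fun z => ∏ r ∈ S, (z - r) ^ (analyticOrderNatAt F r)) := by fun_prop
    have hFe : F = (fun z => ∏ r ∈ S, (z - r) ^ (analyticOrderNatAt F r)) * h := funext he
    have hPρ : (∏ r ∈ S, (ρ - r) ^ (analyticOrderNatAt F r)) ≠ 0 :=
      Finset.prod_ne_zero_iff.2 fun r hr => pow_ne_zero _ (sub_ne_zero.2 (by rintro rfl; exact hρ hr))
    have ho : analyticOrderAt h ρ = n := by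
      have h1 : analyticOrderAt F ρ = n := (Nat.cast_analyticOrderNatAt (hord ρ)).symm
      rw [hFe, analyticOrderAt_mul (hP.analyticAt ρ) (hd.analyticAt ρ),
        (hP.analyticAt ρ).analyticOrderAt_eq_zero.2 hPρ, zero_add] at h1
      exact h1
    obtain ⟨g, hg, hgn, hge⟩ := (hd.analyticAt ρ).analyticOrderAt_eq_natCast.1 ho
    let k : CC → CC := fun z => if z = ρ then g ρ else h z / (z - ρ) ^ n
    have hk : ∀ z, h z = (z - ρ) ^ n * k z := by
      intro z
      by_cases hz : z = ρ
      · subst hz; simp only [k, if_true]; have := hge.self_of_nhds; simpa using this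
      · simp only [k, hz, if_false]; rw [mul_div_cancel₀]; exact pow_ne_zero _ (sub_ne_zero.2 hz)
    have hkg : k =ᶠ[𝓝 ρ] g := by
      filter_upwards [hge] with z hz
      by_cases hz' : z = ρ
      · subst hz'; simp [k]
      · simp only [k, hz', if_false]; rw [hz, smul_eq_mul, mul_div_cancel_left₀]
        exact pow_ne_zero _ (sub_ne_zero.2 hz')
    refine ⟨k, ?_, ?_, ?_⟩
    · intro z
      by_cases hz : z = ρ
      · subst hz; exact hg.differentiableAt.congr_of_eventuallyEq hkg
      · have : k =ᶠ[𝓝 z] fun z => h z / (z - ρ) ^ n := by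
          filter_upwards [isOpen_ne.mem_nhds hz] with w hw
          simp only [k, show w ≠ ρ from hw, if_false]
        refine DifferentiableAt.congr_of_eventuallyEq ?_ this
        exact (hd z).div (by fun_prop) (pow_ne_zero _ (sub_ne_zero.2 hz))
    · intro z
      rw [Finset.prod_insert hρ, he z, hk z]; ring
    · intro r hr hr0
      rcases Finset.mem_insert.1 hr with rfl | hr'
      · rw [hkg.self_of_nhds] at hr0; exact hgn hr0
      · apply hn r hr'; rw [hk, hr0, mul_zero]

lemma finite_zeros (F : CC → CC) (hF : Differentiable CC F) (s0 : CC) (h0 : F s0 ≠ 0) (R : RR) :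
    {z | z ∈ closedBall s0 R ∧ F z = 0}.Finite := by
  by_contra hinf
  obtain ⟨z, hz, hacc⟩ := Set.Infinite.exists_accPt_of_subset_isCompact hinf
    (isCompact_closedBall s0 R) (fun z hz => hz.1)
  have hA : AnalyticOnNhd CC F univ := fun z _ => hF.analyticAt z
  have := hA.eqOn_zero_of_preconnected_of_frequently_eq_zero isPreconnected_univ (mem_univ z)
    ((accPt_iff_frequently_nhdsNE.1 hacc).mono fun y hy => hy.2)
  exact h0 (this (mem_univ s0))

lemma logDeriv_sub_bound (h : CC → CC) (hd : Differentiable CC h) (s0 : CC) (R M : RR) (hR : 0 < R)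
    (hM : 0 < M) (hn : ∀ z ∈ ball s0 R, h z ≠ 0)
    (hb : ∀ z ∈ ball s0 R, ‖h z‖ ≤ ‖h s0‖ * EX M) (z : CC) (hz : ‖z - s0‖ < R / 4) :
    ‖logDeriv h z - logDeriv h s0‖ ≤ 128 * M / R ^ 2 * ‖z - s0‖ := by
  have hs0 : s0 ∈ ball s0 R := mem_ball_self hR
  have hl : DifferentiableOn CC (logDeriv h) (ball s0 R) := by
    intro w hw
    have : DifferentiableAt CC (fun w => deriv h w / h w) w :=
      (hd.contDiff (n := 2) |>.differentiable_deriv_two w).div (hd w) (hn w hw)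
    exact this.differentiableWithinAt
  obtain ⟨L, hL0, hL⟩ := hl.isExactOn_ball.with_val_at s0 0
  have hLd : DifferentiableOn CC L (ball s0 R) := fun w hw => (hL w hw).differentiableAt.differentiableWithinAt
  have hconst : ∀ w ∈ ball s0 R, h w * exp (- L w) = h s0 := by
    intro w hw
    have := (isOpen_ball (x := s0) (ε := R)).is_const_of_deriv_eq_zero
      (isPreconnected_ball) (f := fun w => h w * exp (- L w)) ?_ ?_ hw hs0
    · simpa [hL0] using this
    · exact hd.differentiableOn.mul (hLd.neg.cexp)
    · intro v hv
      have h1 := ((hd v).hasDerivAt).mul ((hL v hv).neg.cexp)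
      have h2 := h1.deriv
      simp only [logDeriv_apply, Pi.neg_apply] at h2
      refine h2.trans ?_
      simp only [Pi.zero_apply]
      field_simp [hn v hv]
      ring
  have hre : ∀ w ∈ ball s0 R, (L w).re ≤ M := by
    intro w hw
    have h1 := hconst w hw
    have h2 : h w = h s0 * exp (L w) := by rw [← h1, mul_assoc, ← exp_add]; simp
    have h3 := hb w hw
    rw [h2, norm_mul, norm_exp] at h3
    have := le_of_mul_le_mul_left h3 (norm_pos_iff.2 (hn s0 hs0))
    exact Real.exp_le_exp.1 this
  have hBC : ∀ w ∈ ball s0 (R / 2), ‖L w‖ ≤ 2 * M := by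
    intro w hw
    have hw' : ‖w - s0‖ < R / 2 := by simpa [dist_eq_norm] using hw
    have := borelCaratheodory_zero (f := fun v => L (s0 + v)) (R := R) (M := M) (z := w - s0) hM ?_ ?_ hR
      (by simp; linarith) (by simpa using hL0)
    · simp only [add_sub_cancel] at this
      refine this.trans ?_
      rw [dI bL]
      nlinarith
    · exact hLd.comp (by fun_prop) (fun v hv => by simpa [dist_eq_norm] using hv)
    · intro v hv
      exact hre _ (by simpa [dist_eq_norm] using hv)
  have hder : ∀ w ∈ ball s0 (R / 4), ‖logDeriv h w‖ ≤ 16 * M / R := by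
    intro w hw
    have hw' : ‖w - s0‖ < R / 4 := by simpa [dist_eq_norm] using hw
    have hsub : closedBall w (R / 8) ⊆ ball s0 (R / 2) := by
      apply closedBall_subset_ball'
      rw [dist_eq_norm]; linarith
    have hwR : w ∈ ball s0 R := by rw [mem_ball, dist_eq_norm]; linarith
    rw [← (hL w hwR).deriv]
    have := norm_deriv_le_of_forall_mem_sphere_norm_le (c := w) (R := R / 8) (C := 2 * M) (f := L)
      bL ?_ ?_
    · refine this.trans (le_of_eq ?_); field_simp; ring
    · apply DifferentiableOn.diffContOnCl
      rw [closure_ball _ bL]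
      exact hLd.mono (hsub.trans (ball_subset_ball bL))
    · intro v hv
      exact hBC v (hsub (sphere_subset_closedBall hv))
  have key := dist_le_div_mul_dist_of_mapsTo_ball (f := logDeriv h) (c := s0) (z := z) (R₁ := R / 4)
    (R₂ := 32 * M / R) (hl.mono (ball_subset_ball bL)) ?_ (by simpa [dist_eq_norm] using hz)
  · rw [dist_eq_norm, dist_eq_norm] at key
    refine key.trans (le_of_eq ?_); field_simp; ring
  · intro w hw
    rw [mem_closedBall, dist_eq_norm]
    refine (norm_sub_le _ _).trans ?_
    have h1 := hder w hw
    have h2 := hder s0 (mem_ball_self bL)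
    calc _ ≤ 16 * M / R + 16 * M / R := add_le_add h1 h2
      _ = 32 * M / R := by ring

/-- Hadamard difference formula -/
lemma hadamard_diff (F : CC → CC) (hF : Differentiable CC F) (s0 : CC) (h0 : F s0 ≠ 0) (C : RR)
    (hg : ∀ z, ‖F z‖ ≤ EX (C * (1 + ‖z - s0‖) ^ (3 / 2 : RR))) (z : CC) (hz : F z ≠ 0) :
    Tendsto (fun R : RR => ∑ ρ ∈ (finite_zeros F hF s0 h0 R).toFinset,
      (analyticOrderNatAt F ρ : CC) * (1 / (z - ρ) - 1 / (s0 - ρ))) atTop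
      (𝓝 (logDeriv F z - logDeriv F s0)) := by
  set M : RR → RR := fun R => |C| * (1 + 2 * R) ^ (3 / 2 : RR) + |LG ‖F s0‖| + 1 with hMdef
  have hbound : ∀ R : RR, 4 * ‖z - s0‖ + 1 < R → ‖(∑ ρ ∈ (finite_zeros F hF s0 h0 R).toFinset,
      (analyticOrderNatAt F ρ : CC) * (1 / (z - ρ) - 1 / (s0 - ρ))) - (logDeriv F z - logDeriv F s0)‖
      ≤ 128 * M R / R ^ 2 * ‖z - s0‖ := by
    intro R hR
    have hRpos : 0 < R := by have := norm_nonneg (z - s0); linarith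
    set S := (finite_zeros F hF s0 h0 R).toFinset with hS
    have hmem : ∀ w, w ∈ S ↔ (w ∈ closedBall s0 R ∧ F w = 0) := fun w => by simp [hS]
    obtain ⟨h, hd, he, hn⟩ := exists_factor F hF s0 h0 S
    set P : CC → CC := fun w => ∏ ρ ∈ S, (w - ρ) ^ (analyticOrderNatAt F ρ) with hP
    have hlog : ∀ w, F w ≠ 0 → logDeriv F w = (∑ ρ ∈ S, (analyticOrderNatAt F ρ : CC) * (1 / (w - ρ)))
        + logDeriv h w := by
      intro w hw
      have hFe : F = fun w => P w * h w := funext he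
      have hPw : P w ≠ 0 := fun h => hw (by rw [he w]; simp only [hP] at h; rw [h, zero_mul])
      have hhw : h w ≠ 0 := fun h => hw (by rw [he w, h, mul_zero])
      have hne : ∀ ρ ∈ S, w - ρ ≠ 0 := fun ρ hρ h => hw (by
        rw [sub_eq_zero] at h; rw [h]; exact ((hmem ρ).1 hρ).2)
      conv_lhs => rw [hFe]
      rw [logDeriv_mul w hPw hhw (by simp only [hP]; fun_prop) (hd w)]
      congr 1
      simp only [hP]
      rw [logDeriv_prod (f := fun ρ w => (w - ρ) ^ (analyticOrderNatAt F ρ))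
        (fun ρ hρ => pow_ne_zero _ (hne ρ hρ)) (fun ρ _ => by fun_prop)]
      refine Finset.sum_congr rfl fun ρ hρ => ?_
      rw [logDeriv_fun_pow (by fun_prop)]
      simp [logDeriv_apply]
    have hPs : ∀ w, ‖w - s0‖ = 2 * R → ‖P s0‖ ≤ ‖P w‖ := by
      intro w hw
      simp only [hP, norm_prod, norm_pow]
      refine Finset.prod_le_prod (fun _ _ => by positivity) fun ρ hρ => ?_
      have h1 : ‖ρ - s0‖ ≤ R := by simpa [dist_eq_norm] using ((hmem ρ).1 hρ).1
      gcongr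
      have : ‖w - s0‖ ≤ ‖w - ρ‖ + ‖ρ - s0‖ := norm_sub_le_norm_sub_add_norm_sub _ _ _
      rw [norm_sub_rev s0]; linarith
    have hFs : 0 < ‖F s0‖ := norm_pos_iff.2 h0
    have hhs : h s0 ≠ 0 := fun hh => h0 (by rw [he, hh, mul_zero])
    have hPs0 : 0 < ‖P s0‖ := norm_pos_iff.2 (fun hh => h0 (by rw [he]; simp only [hP] at hh; rw [hh, zero_mul]))
    have hmax : ∀ w ∈ closedBall s0 (2 * R), ‖h w‖ ≤ ‖h s0‖ * EX (M R) := by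
      intro w hw
      refine norm_le_of_forall_mem_frontier_norm_le (isBounded_ball (x := s0) (r := 2 * R)) hd.diffContOnCl
        ?_ (by rwa [closure_ball _ bL])
      intro v hv
      rw [frontier_ball _ bL, mem_sphere, dist_eq_norm] at hv
      have h1 : ‖P s0‖ * ‖h v‖ ≤ ‖F v‖ := by
        rw [he v, norm_mul]; gcongr; exact hPs v hv
      have h2 : ‖F s0‖ = ‖P s0‖ * ‖h s0‖ := by rw [he s0, norm_mul]
      have h3 : ‖F v‖ ≤ ‖F s0‖ * EX (M R) := by
        refine (hg v).trans ?_
        rw [hv]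
        nth_rw 1 [← Real.exp_log hFs]
        rw [← eA]
        apply Real.exp_le_exp.2
        simp only [hMdef]
        have h4 := neg_abs_le (LG ‖F s0‖)
        have h5 : C * (1 + 2 * R) ^ (3 / 2 : RR) ≤ |C| * (1 + 2 * R) ^ (3 / 2 : RR) := by
          gcongr; exact le_abs_self C
        linarith
      rw [h2, mul_assoc] at h3
      exact le_of_mul_le_mul_left (h1.trans h3) hPs0
    have hMpos : 0 < M R := by simp only [hMdef]; positivity
    have := logDeriv_sub_bound h hd s0 R (M R) hRpos hMpos ?_ ?_ z bL
    · rw [hlog z hz, hlog s0 h0]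
      simp only [mul_sub, Finset.sum_sub_distrib]
      rw [← norm_neg] at this
      refine le_trans (le_of_eq (congrArg _ ?_)) this
      ring
    · intro w hw hw0
      exact hn w ((hmem w).2 ⟨ball_subset_closedBall hw, by rw [he w, hw0, mul_zero]⟩) hw0
    · exact fun w hw => hmax w (by rw [mem_closedBall]; rw [mem_ball] at hw; linarith)
  rw [tendsto_iff_norm_sub_tendsto_zero]
  refine squeeze_zero' (eF fun _ => norm_nonneg _)
    ((eventually_gt_atTop _).mono hbound) ?_
  set K := |C| * 6 + |LG ‖F s0‖| + 1 with hK
  have hlim : Tendsto (fun R : RR => 128 * K * ‖z - s0‖ * R ^ (-(1 / 2 : RR))) atTop (𝓝 0) := by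
    have := (tendsto_rpow_neg_atTop (show (0:RR) < 1 / 2 by norm_num)).const_mul (128 * K * ‖z - s0‖)
    simpa using this
  refine squeeze_zero' ?_ ?_ hlim
  · filter_upwards [eventually_gt_atTop 1] with R hR
    simp only [hMdef]; positivity
  · filter_upwards [eventually_gt_atTop 1] with R hR
    have hR0 : 0 < R := by linarith
    have h1 : (1 + 2 * R) ^ (3 / 2 : RR) ≤ 6 * R ^ (3 / 2 : RR) := by
      calc (1 + 2 * R) ^ (3 / 2 : RR) ≤ (3 * R) ^ (3 / 2 : RR) := by
            apply Real.rpow_le_rpow <;> linarith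
        _ = 3 ^ (3 / 2 : RR) * R ^ (3 / 2 : RR) := Real.mul_rpow bN hR0.le
        _ ≤ 6 * R ^ (3 / 2 : RR) := by
            gcongr
            rw [show (3 / 2 : RR) = 1 + 1 / 2 by norm_num, Real.rpow_add bN, Real.rpow_one,
              ← Real.sqrt_eq_rpow]
            have : √3 ≤ 2 := by rw [Real.sqrt_le_left bN]; norm_num
            linarith
    have h2 : 1 ≤ R ^ (3 / 2 : RR) := Real.one_le_rpow hR.le bN
    have h3 : M R ≤ K * R ^ (3 / 2 : RR) := by
      simp only [hMdef, hK]
      have := mLL h1 (abs_nonneg C)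
      nlinarith [abs_nonneg (LG ‖F s0‖)]
    have h4 : R ^ (-(1 / 2 : RR)) = R ^ (3 / 2 : RR) / R ^ 2 := by
      rw [← Real.rpow_natCast, ← Real.rpow_sub hR0]; norm_num
    rw [h4]
    calc 128 * M R / R ^ 2 * ‖z - s0‖ ≤ 128 * (K * R ^ (3 / 2 : RR)) / R ^ 2 * ‖z - s0‖ := by gcongr
      _ = _ := by ring

end HadamardA

section DigammaC
open Complex Filter Topology

noncomputable def gw (n : ℕ) (x : RR) : RR :=
  EX (-x) - (Ioc 0 (n : RR)).indicator (fun x => (1 - x / n) ^ n) x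

lemma gw_nonneg (n : ℕ) {x : RR} (hx : 0 < x) : 0 ≤ gw n x := by
  unfold gw
  by_cases h : x ≤ n
  · rw [indicator_of_mem (mem_Ioc.2 ⟨hx, h⟩)]; linarith [Real.one_sub_div_pow_le_exp_neg h]
  · rw [indicator_of_notMem (fun h' => h h'.2)]; simp [Real.exp_nonneg]

lemma gw_integral (n : ℕ) (hn : n ≠ 0) {s : CC} (hs : 0 < s.re) :
    IntegrableOn (fun x : RR => (gw n x : CC) * (x : CC) ^ (s - 1)) (Ioi 0) ∧
    ∫ x in Ip, (gw n x : CC) * (x : CC) ^ (s - 1) = Gamma s - GammaSeq s n := by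
  have h1 := GammaIntegral_convergent hs
  have h2 : IntegrableOn (fun x : RR => ((1 - x / n) ^ n : RR) * (x : CC) ^ (s - 1)) (Ioc 0 (n:RR)) := by
    rw [← iO (by positivity : (0 : RR) ≤ n)]
    apply IntervalIntegrable.continuousOn_mul
    · refine intervalIntegral.intervalIntegrable_cpow' ?_
      rwa [sub_re, one_re, ← zero_sub, sub_lt_sub_iff_right]
    · fun_prop
  have h3 : IntegrableOn ((Ioc 0 (n:RR)).indicator
      (fun x : RR => ((1 - x / n) ^ n : RR) * (x : CC) ^ (s - 1))) (Ioi 0) := by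
    rw [IntegrableOn, integrable_indicator_iff mC, IntegrableOn,
      Measure.restrict_restrict_of_subset Ioc_subset_Ioi_self]
    exact h2
  have he : (fun x : RR => (gw n x : CC) * (x : CC) ^ (s - 1)) = fun x : RR =>
      ↑(EX (-x)) * (x : CC) ^ (s - 1) - (Ioc 0 (n:RR)).indicator
      (fun x : RR => ((1 - x / n) ^ n : RR) * (x : CC) ^ (s - 1)) x := by
    ext x
    unfold gw
    by_cases h : x ∈ Ioc 0 (n:RR)
    · simp only [indicator_of_mem h]; push_cast; ring
    · simp only [indicator_of_notMem h]; push_cast; ring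
  rw [he]
  refine ⟨h1.sub h3, ?_⟩
  rw [integral_sub h1 h3, integral_indicator mC,
    Measure.restrict_restrict_of_subset Ioc_subset_Ioi_self,
    ← intervalIntegral.integral_of_le (by positivity : 0 ≤ (n : RR)),
    ← GammaSeq_eq_approx_Gamma_integral hs hn, Gamma_eq_integral hs, GammaIntegral]

lemma gw_real (n : ℕ) (hn : n ≠ 0) {a : RR} (ha : 0 < a) :
    IntegrableOn (fun x : RR => gw n x * x ^ (a - 1)) (Ioi 0) ∧
    ∫ x in Ip, gw n x * x ^ (a - 1) = ‖Gamma a - GammaSeq a n‖ := by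
  obtain ⟨h1, h2⟩ := gw_integral n hn (s := (a : CC)) (by simpa)
  have he : EqOn (fun x : RR => (gw n x : CC) * (x : CC) ^ ((a:CC) - 1))
      (fun x => ((gw n x * x ^ (a - 1) : RR) : CC)) (Ioi 0) := by
    intro x hx
    simp only [ofReal_mul]
    rw [ofReal_cpow (le_of_lt hx)]; push_cast; rfl
  rw [integrableOn_congr_fun he mI] at h1
  rw [setIntegral_congr_fun mI he] at h2
  refine ⟨by simpa [IntegrableOn] using h1.re, ?_⟩
  rw [← h2, integral_complex_ofReal, norm_real, rN]
  exact setIntegral_nonneg mI fun x hx => mul_nonneg (gw_nonneg n hx)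
    (Real.rpow_nonneg (le_of_lt hx) _)

lemma gammaSeq_dist (n : ℕ) (hn : n ≠ 0) {a b : RR} (ha : 0 < a) (hb : 0 < b) {s : CC}
    (h1 : a ≤ s.re) (h2 : s.re ≤ b) :
    ‖Gamma s - GammaSeq s n‖ ≤ ‖Gamma a - GammaSeq a n‖ + ‖Gamma b - GammaSeq b n‖ := by
  have hs : 0 < s.re := ha.trans_le h1
  rw [← (gw_real n hn ha).2, ← (gw_real n hn hb).2, ← (gw_integral n hn hs).2,
    ← integral_add (gw_real n hn ha).1 (gw_real n hn hb).1]
  refine norm_integral_le_of_norm_le ((gw_real n hn ha).1.add (gw_real n hn hb).1) ?_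
  refine (ae_restrict_iff' mI).mpr (ae_of_all _ fun x hx => ?_)
  have hx' : 0 < x := hx
  rw [norm_mul, norm_real, rN (gw_nonneg n hx), norm_cpow_eq_rpow_re_of_pos hx',
    ← mul_add]
  refine mLL ?_ (gw_nonneg n hx)
  simp only [sub_re, one_re]
  rcases le_total x 1 with h | h
  · have := Real.rpow_le_rpow_of_exponent_ge hx' h (show a - 1 ≤ s.re - 1 by linarith)
    linarith [Real.rpow_nonneg hx'.le (b - 1)]
  · have := rE h (show s.re - 1 ≤ b - 1 by linarith)
    linarith [Real.rpow_nonneg hx'.le (a - 1)]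

lemma add_nat_ne_zero' {s : CC} (hs : 0 < s.re) (k : ℕ) : s + k ≠ 0 := by
  intro h
  have := congrArg Complex.re h
  simp at this
  have h2 : (0:RR) ≤ k := by positivity
  linarith

lemma digamma_tendsto {s : CC} (hs : 0 < s.re) :
    Tendsto (fun n : ℕ => (LG n : CC) - ∑ k ∈ Finset.range (n + 1), 1 / (s + k)) atTop
      (𝓝 (digamma s)) := by
  set a := s.re / 2
  set b := s.re + 1
  have ha : 0 < a := by simp only [a]; linarith
  have hb : 0 < b := by simp only [b]; linarith
  set U : Set CC := {z | a < z.re ∧ z.re < b}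
  have hU : IsOpen U := (isOpen_lt continuous_const continuous_re).inter
    (isOpen_lt continuous_re continuous_const)
  have hsU : s ∈ U := ⟨by simp only [a]; linarith, by simp only [b]; linarith⟩
  have hunif : TendstoUniformlyOn (fun n z => GammaSeq z n) Gamma atTop U := by
    rw [Metric.tendstoUniformlyOn_iff]
    intro ε hε
    have h1 : Tendsto (fun n => ‖Gamma a - GammaSeq a n‖ + ‖Gamma b - GammaSeq b n‖) atTop (𝓝 0) := by
      have ha' := ((GammaSeq_tendsto_Gamma a).const_sub (Gamma a)).norm
      have hb' := ((GammaSeq_tendsto_Gamma b).const_sub (Gamma b)).norm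
      simpa using ha'.add hb'
    filter_upwards [h1.eventually_lt_const hε, eventually_ne_atTop 0] with n hn hn0 z hz
    rw [dist_eq_norm]
    exact (gammaSeq_dist n hn0 ha hb hz.1.le hz.2.le).trans_lt hn
  have hpos : ∀ z ∈ U, 0 < z.re := fun z hz => ha.trans hz.1
  have hdiffz : ∀ n : ℕ, n ≠ 0 → ∀ z ∈ U, DifferentiableAt CC (fun z => GammaSeq z n) z := by
    intro n hn z hz
    unfold GammaSeq
    refine DifferentiableAt.div ?_ (by fun_prop) (Finset.prod_ne_zero_iff.2 fun j _ => add_nat_ne_zero' (hpos z hz) j)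
    exact (differentiableAt_id.const_cpow (Or.inl (by simpa using hn))).mul_const _
  have hder := (hunif.tendstoLocallyUniformlyOn.deriv (by
    filter_upwards [eventually_ne_atTop 0] with n hn z hz
    exact (hdiffz n hn z hz).differentiableWithinAt) hU).tendsto_at hsU
  have hval := GammaSeq_tendsto_Gamma s
  have hG : Gamma s ≠ 0 := Gamma_ne_zero_of_re_pos hs
  have hq := hder.div hval hG
  rw [digamma_def, logDeriv_apply]
  refine hq.congr' ?_
  filter_upwards [eventually_ne_atTop 0] with n hn
  have hnc : (n : CC) ≠ 0 := by simpa using hn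
  have hprod : ∏ j ∈ Finset.range (n + 1), (s + j) ≠ 0 :=
    Finset.prod_ne_zero_iff.2 fun j _ => add_nat_ne_zero' hs j
  change logDeriv (fun z => GammaSeq z n) s = _
  unfold GammaSeq
  have hnum : (n : CC) ^ s * (n.factorial : CC) ≠ 0 :=
    mul_ne_zero (by simp [cpow_eq_zero_iff, hnc]) (by exact_mod_cast n.factorial_ne_zero)
  have hnd : DifferentiableAt CC (fun z : CC => (n : CC) ^ z) s := differentiableAt_id.const_cpow (Or.inl hnc)
  rw [logDeriv_div (f := fun z => (n : CC) ^ z * (n.factorial : CC))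
    (g := fun z => ∏ j ∈ Finset.range (n + 1), (z + j)) s hnum hprod (hnd.mul_const _) (by fun_prop)]
  congr 1
  · rw [logDeriv_mul_const (f := fun z : CC => (n : CC) ^ z) s (n.factorial : CC)
      (by exact_mod_cast n.factorial_ne_zero)]
    rw [logDeriv_apply]
    have := (hasDerivAt_id s).const_cpow (c := (n:CC)) (Or.inl hnc)
    simp only [id, mul_one] at this
    rw [this.deriv, mul_div_cancel_left₀ _ (by simp [cpow_eq_zero_iff, hnc])]
    rw [← Complex.ofReal_natCast, ← ofReal_log bPq]
  · rw [logDeriv_prod (f := fun (j : ℕ) (z : CC) => z + j) (fun j _ => add_nat_ne_zero' hs j) (fun j _ => by fun_prop)]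
    refine Finset.sum_congr rfl fun j _ => ?_
    simp [logDeriv_apply]

lemma digamma_sub_hasSum {s s0 : CC} (hs : 0 < s.re) (hs0 : 0 < s0.re) :
    HasSum (fun k : ℕ => 1 / (s0 + k) - 1 / (s + k)) (digamma s - digamma s0) := by
  have hsum : Summable (fun k : ℕ => 1 / (s0 + k) - 1 / (s + k)) := by
    have h1 : Summable (fun k : ℕ => (‖s - s0‖ * 4) * (1 / (k:RR) ^ 2)) :=
      (Real.summable_one_div_nat_pow.2 one_lt_two).mul_left _
    refine Summable.of_norm_bounded_eventually_nat h1 ?_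
    filter_upwards [eventually_gt_atTop 0] with k hk
    have hk' : (0:RR) < k := by exact_mod_cast hk
    have e : 1 / (s0 + k) - 1 / (s + k) = (s - s0) / ((s0 + k) * (s + k)) := by
      field_simp [add_nat_ne_zero' hs k, add_nat_ne_zero' hs0 k]; ring
    have hb : ∀ z : CC, 0 < z.re → (k:RR) ≤ ‖z + k‖ := fun z hz => by
      have := re_le_norm (z + k); simp at this; linarith
    rw [e, norm_div, norm_mul, mul_one_div]
    have h2 := hb s hs
    have h3 := hb s0 hs0
    have : (k:RR) ^ 2 ≤ ‖s0 + k‖ * ‖s + k‖ := by nlinarith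
    calc _ ≤ ‖s - s0‖ / (k:RR) ^ 2 := by gcongr
      _ ≤ _ := by gcongr; linarith [norm_nonneg (s - s0)]
  refine hsum.hasSum_iff.2 ?_
  refine tendsto_nhds_unique (hsum.hasSum.tendsto_sum_nat.comp (tendsto_add_atTop_nat 1)) ?_
  refine ((digamma_tendsto hs).sub (digamma_tendsto hs0)).congr fun n => ?_
  simp only [Function.comp, Finset.sum_sub_distrib]; ring

lemma re_digamma_le {z : CC} (hz : 1 ≤ z.re) (B : RR)
    (hB : ∀ n : ℕ, ∑ k ∈ Finset.range (n + 1), 1 / ((k + 1 : RR) ^ 2 + z.im ^ 2) ≤ 2 * B) :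
    (digamma z).re ≤ LG ‖z‖ + B := by
  have hz0 : 0 < z.re := by linarith
  have hstep : ∀ k : ℕ, LG ‖z + (k + 1 : ℕ)‖ - LG ‖z + k‖ ≤
      (1 / (z + k)).re + 1 / 2 * (1 / ((k + 1 : RR) ^ 2 + z.im ^ 2)) := by
    intro k
    have hn : ∀ k : ℕ, ‖z + k‖ ^ 2 = (z.re + k) ^ 2 + z.im ^ 2 := fun k => by
      rw [← normSq_eq_norm_sq, normSq_apply]; simp; ring
    have hp : ∀ k : ℕ, 0 < ‖z + k‖ := fun k => norm_pos_iff.2 (add_nat_ne_zero' hz0 k)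
    have h0 : 0 < ‖z + k‖ ^ 2 := pow_pos (hp k) 2
    have h1 : 2 * (LG ‖z + (k + 1 : ℕ)‖ - LG ‖z + k‖) =
        LG (‖z + (k + 1 : ℕ)‖ ^ 2 / ‖z + k‖ ^ 2) := by
      rw [Real.log_div (pow_pos (hp _) 2).ne' h0.ne', Real.log_pow, Real.log_pow]; push_cast; ring
    have h2 := lO (div_pos (pow_pos (hp (k + 1)) 2) h0)
    have h3 : (1 / (z + k)).re = (z.re + k) / ‖z + k‖ ^ 2 := by
      rw [one_div, inv_re, normSq_eq_norm_sq]; simp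
    have h4 : 1 / ‖z + k‖ ^ 2 ≤ 1 / ((k + 1 : RR) ^ 2 + z.im ^ 2) := by
      apply one_div_le_one_div_of_le bPq
      rw [hn]; nlinarith [(Nat.cast_nonneg k : (0:RR) ≤ k)]
    have h5 : ‖z + (k + 1 : ℕ)‖ ^ 2 / ‖z + k‖ ^ 2 - 1 = 2 * ((z.re + k) / ‖z + k‖ ^ 2) + 1 / ‖z + k‖ ^ 2 := by
      rw [div_sub_one h0.ne', ← mul_div_assoc, ← add_div]
      congr 1
      rw [hn, hn]; push_cast; ring
    rw [h3]; linarith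
  have hlim := (continuous_re.tendsto _).comp (digamma_tendsto hz0)
  refine le_of_tendsto hlim ?_
  filter_upwards [eventually_ne_atTop 0] with n hn
  have h1 := Finset.sum_le_sum fun k (_ : k ∈ Finset.range (n + 1)) => hstep k
  rw [Finset.sum_range_sub (fun k : ℕ => LG ‖z + k‖), Finset.sum_add_distrib, ← Finset.mul_sum] at h1
  have h2 : LG n ≤ LG ‖z + (n + 1 : ℕ)‖ := by
    apply Real.log_le_log bPq
    have := re_le_norm (z + (n + 1 : ℕ)); simp at this ⊢; linarith
  simp only [Function.comp, sub_re, ofReal_re, re_sum]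
  simp only [Nat.cast_zero, add_zero] at h1
  linarith [hB n]

lemma re_digamma_le_one {z : CC} (hz : 1 ≤ z.re) : (digamma z).re ≤ LG ‖z‖ + 1 := by
  refine re_digamma_le hz 1 fun n => ?_
  have h : ∀ k : ℕ, 1 / ((k + 1 : RR) ^ 2 + z.im ^ 2) ≤ 2 * (1 / (k + 1 : RR)) - 2 * (1 / ((k + 1 : ℕ) + 1 : RR)) := by
    intro k
    have : 1 / ((k + 1 : RR) ^ 2 + z.im ^ 2) ≤ 1 / ((k + 1 : RR) ^ 2) := by
      gcongr; nlinarith [sq_nonneg z.im]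
    refine this.trans ?_
    push_cast
    rw [← mul_sub, div_sub_div _ _ bPq bPq, ← mul_div_assoc,
      dD bPq bPq]
    have : (0:RR) ≤ k := by positivity
    nlinarith
  refine (Finset.sum_le_sum fun k _ => h k).trans ?_
  rw [Finset.sum_range_sub' (fun k : ℕ => 2 * (1 / (k + 1 : RR)))]
  have : 0 ≤ 2 * (1 / (((n + 1 : ℕ) : RR) + 1)) := by positivity
  simp only [Nat.cast_zero]; linarith

lemma re_digamma_le_inv {z : CC} (hz : 1 ≤ z.re) (v : RR) (hv : 0 < v) (hv' : v = |z.im|) :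
    (digamma z).re ≤ LG ‖z‖ + 1 / v := by
  refine re_digamma_le hz (1 / v) fun n => ?_
  have hv2 : z.im ^ 2 = v ^ 2 := by rw [hv', sq_abs]
  have h : ∀ k : ℕ, 1 / ((k + 1 : RR) ^ 2 + z.im ^ 2) ≤ 2 * (1 / (k + v)) - 2 * (1 / ((k + 1 : ℕ) + v)) := by
    intro k
    rw [hv2]
    push_cast
    have hk : (0:RR) ≤ k := by positivity
    rw [← mul_sub, div_sub_div _ _ bPq bPq, ← mul_div_assoc,
      dD bPq bPq]
    nlinarith [sq_nonneg (k + 1 - v)]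
  refine (Finset.sum_le_sum fun k _ => h k).trans ?_
  rw [Finset.sum_range_sub' (fun k : ℕ => 2 * (1 / (k + v)))]
  have : 0 ≤ 2 * (1 / (((n + 1 : ℕ) : RR) + v)) := by positivity
  simp only [Nat.cast_zero, zero_add]; linarith

end DigammaC

section GrowthB
open Complex Filter Topology Asymptotics

/-- growth of order at most `3/2` -/
def Gr (F : CC → CC) : Prop := ∃ C : RR, 0 ≤ C ∧ ∀ z, ‖F z‖ ≤ EX (C * (1 + ‖z‖) ^ (3/2:RR))

lemma one_le_gr (z : CC) : 1 ≤ (1 + ‖z‖) ^ (3/2:RR) :=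
  Real.one_le_rpow (by linarith [norm_nonneg z]) bN

lemma Gr.of_le {F : CC → CC} (K C : RR) (hC : 0 ≤ C)
    (h : ∀ z, ‖F z‖ ≤ K * EX (C * (1 + ‖z‖) ^ (3/2:RR))) : Gr F := by
  refine ⟨C + |K|, by positivity, fun z => (h z).trans ?_⟩
  rw [add_mul, add_comm (C * _), eA]
  have h1 := one_le_gr z
  refine mLR ?_ (Real.exp_nonneg _)
  calc K ≤ |K| := le_abs_self _
    _ ≤ |K| * (1 + ‖z‖) ^ (3/2:RR) := le_mul_of_one_le_right (abs_nonneg _) h1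
    _ ≤ |K| * (1 + ‖z‖) ^ (3/2:RR) + 1 := by linarith
    _ ≤ _ := Real.add_one_le_exp _

lemma Gr.const (c : CC) : Gr fun _ => c :=
  Gr.of_le ‖c‖ 0 le_rfl bS

lemma Gr.add {F G : CC → CC} (hF : Gr F) (hG : Gr G) : Gr fun z => F z + G z := by
  obtain ⟨C, hC, h⟩ := hF
  obtain ⟨C', hC', h'⟩ := hG
  refine Gr.of_le 2 (C + C') bPq fun z => (norm_add_le _ _).trans ?_
  have e1 : EX (C * (1 + ‖z‖) ^ (3/2:RR)) ≤ EX ((C + C') * (1 + ‖z‖) ^ (3/2:RR)) := by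
    gcongr; linarith
  have e2 : EX (C' * (1 + ‖z‖) ^ (3/2:RR)) ≤ EX ((C + C') * (1 + ‖z‖) ^ (3/2:RR)) := by
    gcongr; linarith
  linarith [h z, h' z]

lemma Gr.mul {F G : CC → CC} (hF : Gr F) (hG : Gr G) : Gr fun z => F z * G z := by
  obtain ⟨C, hC, h⟩ := hF
  obtain ⟨C', hC', h'⟩ := hG
  refine ⟨C + C', by positivity, fun z => ?_⟩
  rw [norm_mul, add_mul, eA]
  exact mul_le_mul (h z) (h' z) (norm_nonneg _) (Real.exp_nonneg _)

lemma Gr.sum {ι : Type*} (s : Finset ι) (F : ι → CC → CC) (h : ∀ i ∈ s, Gr (F i)) :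
    Gr fun z => ∑ i ∈ s, F i z := by
  classical
  induction s using Finset.induction_on with
  | empty => simpa using Gr.const 0
  | insert a s ha ih =>
    simp only [Finset.sum_insert ha]
    exact (h a bS).add (ih fun i hi => h i (by simp [hi]))

lemma Gr.id : Gr fun z => z := by
  refine ⟨1, by norm_num, fun z => ?_⟩
  have : (1 + ‖z‖) ≤ (1 + ‖z‖) ^ (3/2:RR) := by
    conv_lhs => rw [← Real.rpow_one (1 + ‖z‖)]
    exact rE (by linarith [norm_nonneg z]) bN
  linarith [Real.add_one_le_exp (1 * (1 + ‖z‖) ^ (3/2:RR))]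

lemma Gr.exp_lin (c : CC) : Gr fun z => Complex.exp (c * z) := by
  refine ⟨‖c‖, norm_nonneg _, fun z => ?_⟩
  have : (1 + ‖z‖) ≤ (1 + ‖z‖) ^ (3/2:RR) := by
    conv_lhs => rw [← Real.rpow_one (1 + ‖z‖)]
    exact rE (by linarith [norm_nonneg z]) bN
  refine (Complex.norm_exp_le_exp_norm _).trans ?_
  rw [norm_mul]
  gcongr
  linarith

lemma Gr.comp_lin {F : CC → CC} (hF : Gr F) (a b : CC) : Gr fun z => F (a * z + b) := by
  obtain ⟨C, hC, h⟩ := hF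
  refine ⟨C * (1 + ‖a‖ + ‖b‖) ^ (3/2:RR), by positivity, fun z => (h _).trans ?_⟩
  rw [mul_assoc, ← Real.mul_rpow bPq bPq]
  gcongr
  have := norm_add_le (a * z) b
  rw [norm_mul] at this
  nlinarith [norm_nonneg a, norm_nonneg b, norm_nonneg z, mul_nonneg (norm_nonneg b) (norm_nonneg z)]

lemma exp_bd_of_isBigO {f : RR → CC} {f0 : CC} (hf : ContinuousOn f (Ioi 0))
    (h : ∃ p : RR, 0 < p ∧ (fun t => f t - f0) =O[atTop] (fun t => EX (-p * t))) :
    ∃ p C : RR, 0 < p ∧ p ≤ 1 ∧ 0 ≤ C ∧ ∀ t, 1 ≤ t → ‖f t - f0‖ ≤ C * EX (-p * t) := by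
  obtain ⟨p, hp, h⟩ := h
  obtain ⟨C, hC⟩ := h.bound
  obtain ⟨M, hM⟩ := eventually_atTop.1 hC
  obtain ⟨K, hK⟩ := (isCompact_Icc (a := (1:RR)) (b := max 1 M)).exists_bound_of_continuousOn
    (f := fun t => f t - f0) ((hf.mono (fun t ht => lt_of_lt_of_le one_pos ht.1)).sub continuousOn_const)
  have hmin : 0 < min p 1 := by positivity
  refine ⟨min p 1, |C| + |K| * EX (min p 1 * max 1 M), hmin, min_le_right _ _, by positivity,
    fun t ht => ?_⟩
  by_cases h1 : M ≤ t
  · have := hM t h1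
    rw [rN (Real.exp_nonneg _)] at this
    have e : EX (-p * t) ≤ EX (-(min p 1) * t) := by
      gcongr; exact min_le_left _ _
    calc _ ≤ C * EX (-p * t) := this
      _ ≤ |C| * EX (-(min p 1) * t) := by
        refine mul_le_mul (le_abs_self _) e (Real.exp_nonneg _) (abs_nonneg _)
      _ ≤ _ := by
        gcongr; exact le_add_of_nonneg_right bPq
  · have := hK t ⟨ht, (not_le.1 h1).le.trans (le_max_right _ _)⟩
    have e : 1 ≤ EX (min p 1 * max 1 M) * EX (-(min p 1) * t) := by
      rw [← eA]
      apply Real.one_le_exp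
      have : t ≤ max 1 M := (not_le.1 h1).le.trans (le_max_right _ _)
      nlinarith
    calc _ ≤ K := this
      _ ≤ |K| * 1 := by rw [mul_one]; exact le_abs_self _
      _ ≤ |K| * (EX (min p 1 * max 1 M) * EX (-(min p 1) * t)) := by gcongr
      _ ≤ _ := by rw [add_mul, mul_assoc]; exact le_add_of_nonneg_left bPq

lemma exp_neg_le_fact {p t : RR} (hp : 0 < p) (ht : 0 < t) (n : ℕ) :
    EX (-p * t) ≤ n.factorial / p ^ n * (t ^ n)⁻¹ := by
  have h := Real.pow_div_factorial_le_exp (p * t) bPq n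
  rw [neg_mul, Real.exp_neg]
  have h0 : 0 < (p * t) ^ n / n.factorial := by positivity
  calc _ ≤ ((p * t) ^ n / n.factorial)⁻¹ := by gcongr
    _ = _ := by rw [mul_pow]; field_simp

lemma feq_growth (P : WeakFEPair CC) (hfc : ContinuousOn P.f (Ioi 0)) (hgc : ContinuousOn P.g (Ioi 0))
    (hf : ∃ p : RR, 0 < p ∧ (fun t => P.f t - P.f₀) =O[atTop] (fun t => EX (-p * t)))
    (hg : ∃ p : RR, 0 < p ∧ (fun t => P.g t - P.g₀) =O[atTop] (fun t => EX (-p * t))) :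
    Gr P.Λ₀ := by
  obtain ⟨p1, C1, hp1, hp1', hC1, h1⟩ := exp_bd_of_isBigO hfc hf
  obtain ⟨p2, C2, hp2, hp2', hC2, h2⟩ := exp_bd_of_isBigO hgc hg
  set p := min p1 p2 with hpdef
  have hp : 0 < p := by positivity
  have hp1 : p ≤ 1 := (min_le_left _ _).trans hp1'
  set C := C1 + ‖P.ε‖ * C2 with hCdef
  have hC : 0 ≤ C := by positivity
  -- pointwise bounds
  have b1 : ∀ t, 1 < t → ‖P.f_modif t‖ ≤ C * EX (-p * t) := by
    intro t ht
    have : P.f_modif t = P.f t - P.f₀ := by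
      simp [WeakFEPair.f_modif, ht, not_lt.2 ht.le]
    rw [this]
    refine (h1 t ht.le).trans ?_
    have : C1 ≤ C := le_add_of_nonneg_right bPq
    have h3 : p ≤ p1 := min_le_left _ _
    gcongr
  have b2 : ∀ t, 0 < t → t < 1 → ‖P.f_modif t‖ ≤ C * t ^ (-P.k) * EX (-p * t⁻¹) := by
    intro t ht ht1
    have e := P.hf_modif_FE t⁻¹ bPq
    have ht2 : 1 < t⁻¹ := (one_lt_inv₀ ht).2 ht1
    have e2 : P.g_modif t⁻¹ = P.g t⁻¹ - P.g₀ := by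
      simp [WeakFEPair.g_modif, ht2, not_lt.2 ht2.le]
    rw [one_div, inv_inv, e2] at e
    rw [e, norm_smul, norm_mul, norm_real, rN bPq,
      Real.inv_rpow ht.le, ← Real.rpow_neg ht.le]
    have h3 : p ≤ p2 := min_le_right _ _
    have h4 : ‖P.ε‖ * C2 ≤ C := le_add_of_nonneg_left hC1
    calc _ ≤ ‖P.ε‖ * t ^ (-P.k) * (C2 * EX (-p2 * t⁻¹)) := by
          gcongr; exact h2 _ ht2.le
      _ = (‖P.ε‖ * C2) * t ^ (-P.k) * EX (-p2 * t⁻¹) := by ring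
      _ ≤ _ := by gcongr
  have b3 : P.f_modif 1 = 0 := by simp [WeakFEPair.f_modif]
  have main : ∀ s : CC, ∀ n : ℕ, ‖s‖ + P.k + 1 ≤ n → ‖P.Λ₀ s‖ ≤ 2 * C * (n.factorial / p ^ n) := by
    intro s n hn
    set A := C * (n.factorial / p ^ n) with hA
    have hA0 : 0 ≤ A := by positivity
    have hre : |s.re| ≤ ‖s‖ := Complex.abs_re_le_norm s
    have hre1 := (abs_le.1 hre).1
    have hre2 := (abs_le.1 hre).2
    have hk := P.hk
    let B : RR → RR := fun t => if t ≤ 1 then A else A * t ^ (-2:RR)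
    have hBi1 : IntegrableOn B (Ioc 0 1) := by
      refine (integrableOn_const (C := A) bS).congr_fun (fun t ht => ?_) mC
      simp [B, ht.2]
    have hBi2 : IntegrableOn B (Ioi 1) := by
      have h0 : IntegrableOn (fun t : RR => A * t ^ (-2:RR)) (Ioi 1) :=
        ((integrableOn_Ioi_rpow_of_lt (a := -2) bN (c := 1) one_pos)).const_mul A
      refine h0.congr_fun (fun t ht => ?_) mI
      simp [B, not_le.2 (mem_Ioi.1 ht)]
    have hB1 : ∫ t in Ioc 0 1, B t = A := by
      rw [setIntegral_congr_fun (g := fun _ => A) mC (fun t ht => by simp [B, ht.2])]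
      simp
    have hB2 : ∫ t in Ioi 1, B t = A := by
      rw [setIntegral_congr_fun (g := fun t => A * t ^ (-2:RR)) mI
        (fun t ht => by simp [B, not_le.2 (mem_Ioi.1 ht)]), iC,
        integral_Ioi_rpow_of_lt bN one_pos]
      norm_num
    have hu : Ioc (0:RR) 1 ∪ Ioi 1 = Ioi 0 := Ioc_union_Ioi_eq_Ioi zO
    have hBi : IntegrableOn B (Ioi 0) := by
      rw [← hu]; exact hBi1.union hBi2
    have hBI : ∫ t in Ioi 0, B t = 2 * A := by
      rw [← hu, setIntegral_union Ioc_disjoint_Ioi_same mI hBi1 hBi2, hB1, hB2]; ring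
    have : ‖P.Λ₀ s‖ ≤ ∫ t in Ioi 0, B t := by
      unfold WeakFEPair.Λ₀ mellin
      refine norm_integral_le_of_norm_le hBi ?_
      rw [ae_restrict_iff' mI]
      refine eF fun t (ht : 0 < t) => ?_
      rw [norm_smul, norm_cpow_eq_rpow_re_of_pos ht]
      rcases lt_trichotomy t 1 with h | h | h
      · simp only [B, h.le, if_true]
        calc _ ≤ t ^ (s - 1).re * (C * t ^ (-P.k) * EX (-p * t⁻¹)) := by
              gcongr; exact b2 t ht h
          _ ≤ t ^ (s - 1).re * (C * t ^ (-P.k) * (n.factorial / p ^ n * (t⁻¹ ^ n)⁻¹)) := by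
              gcongr; exact exp_neg_le_fact hp bPq n
          _ = A * t ^ ((s-1).re + -P.k + n) := by
              rw [Real.rpow_add ht, Real.rpow_add ht, Real.rpow_natCast]
              simp only [inv_pow, inv_inv, hA]; ring
          _ ≤ A * 1 := by
              gcongr
              apply Real.rpow_le_one ht.le h.le
              simp only [sub_re, one_re]
              linarith
          _ = A := mul_one _
      · rw [h, b3]; simp [B, hA0]
      · simp only [B, not_le.2 h, if_false]
        calc _ ≤ t ^ (s - 1).re * (C * EX (-p * t)) := by
              gcongr; exact b1 t h
          _ ≤ t ^ (s - 1).re * (C * (n.factorial / p ^ n * (t ^ n)⁻¹)) := by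
              gcongr; exact exp_neg_le_fact hp bPq n
          _ = A * t ^ ((s-1).re + -(n:RR)) := by
              rw [Real.rpow_add ht, Real.rpow_neg ht.le, Real.rpow_natCast]
              simp only [hA]; ring
          _ ≤ A * t ^ (-2:RR) := by
              gcongr
              · exact h.le
              simp only [sub_re, one_re]
              linarith
    rw [hBI] at this
    linarith
  -- conclude
  set K := P.k + 2 with hK
  have hk := P.hk
  refine Gr.of_le (2 * C) ((p⁻¹ + 2) * (K + 1) ^ (3/2:RR)) bPq fun s => ?_
  obtain ⟨n, hn1, hn2⟩ : ∃ n : ℕ, ‖s‖ + P.k + 1 ≤ n ∧ (n:RR) ≤ ‖s‖ + K := by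
    refine ⟨⌈‖s‖ + P.k + 1⌉₊, Nat.le_ceil _, ?_⟩
    have := Nat.ceil_lt_add_one (a := ‖s‖ + P.k + 1) bPq
    linarith
  refine (main s n hn1).trans ?_
  gcongr
  have hn0 : (1:RR) ≤ n := by linarith [norm_nonneg s]
  have hn0' : (0:RR) < n := by linarith
  calc (n.factorial / p ^ n : RR) ≤ (n:RR) ^ n * (p⁻¹) ^ n := by
        rw [inv_pow, div_eq_mul_inv]
        gcongr
        exact_mod_cast Nat.factorial_le_pow n
    _ = EX (n * (LG n + LG p⁻¹)) := by
        rw [mul_add, eA, mul_comm (n:RR), mul_comm (n:RR), ← Real.rpow_def_of_pos hn0',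
          ← Real.rpow_def_of_pos bPq, Real.rpow_natCast, Real.rpow_natCast]
    _ ≤ EX ((p⁻¹ + 2) * (n:RR) ^ (3/2:RR)) := by
        apply Real.exp_le_exp.2
        have e1 : LG n ≤ 2 * (n:RR) ^ (1/2:RR) := by
          have := Real.log_le_rpow_div hn0'.le (ε := 1/2) bN
          linarith
        have e2 : LG p⁻¹ ≤ p⁻¹ := (lO bPq).trans bL
        have e3 : (n:RR) ^ (3/2:RR) = n * (n:RR) ^ (1/2:RR) := by
          rw [← Real.rpow_one_add' bPq bN]; norm_num
        have e4 : 1 ≤ (n:RR) ^ (1/2:RR) := Real.one_le_rpow hn0 bN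
        have hpi : 0 < p⁻¹ := by positivity
        calc _ ≤ (n:RR) * (2 * (n:RR) ^ (1/2:RR) + p⁻¹ * (n:RR) ^ (1/2:RR)) := by
              gcongr
              exact e2.trans (le_mul_of_one_le_right hpi.le e4)
          _ = _ := by rw [e3]; ring
    _ ≤ _ := by
        rw [mul_assoc, ← Real.mul_rpow bPq bPq]
        gcongr
        nlinarith [norm_nonneg s]

lemma growth_even (a : UnitAddCircle) : Gr (HurwitzZeta.completedHurwitzZetaEven₀ a) := by
  have h : Gr (HurwitzZeta.hurwitzEvenFEPair a).Λ₀ := by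
    refine feq_growth _ (continuous_ofReal.comp_continuousOn (HurwitzZeta.continuousOn_evenKernel a))
      (continuous_ofReal.comp_continuousOn (HurwitzZeta.continuousOn_cosKernel a)) ?_ ?_
    · obtain ⟨p, hp, h⟩ := HurwitzZeta.isBigO_atTop_evenKernel_sub a
      refine ⟨p, hp, ?_⟩
      rw [← isBigO_norm_left] at h ⊢
      refine h.congr_left fun t => ?_
      rw [← norm_real]
      simp only [HurwitzZeta.hurwitzEvenFEPair, Function.comp]
      split_ifs <;> simp
    · obtain ⟨p, hp, h⟩ := HurwitzZeta.isBigO_atTop_cosKernel_sub a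
      refine ⟨p, hp, ?_⟩
      rw [← isBigO_norm_left] at h ⊢
      refine h.congr_left fun t => ?_
      rw [← norm_real]
      simp [HurwitzZeta.hurwitzEvenFEPair]
  have := (h.comp_lin (1/2) 0).mul (Gr.const (1/2))
  convert this using 2 with s
  simp only [HurwitzZeta.completedHurwitzZetaEven₀]
  rw [div_eq_mul_inv]; norm_num; congr 2; ring

lemma growth_odd (a : UnitAddCircle) : Gr (HurwitzZeta.completedHurwitzZetaOdd a) := by
  have h : Gr (HurwitzZeta.hurwitzOddFEPair a).Λ₀ := by
    refine feq_growth _ (continuous_ofReal.comp_continuousOn (HurwitzZeta.continuousOn_oddKernel a))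
      (continuous_ofReal.comp_continuousOn (HurwitzZeta.continuousOn_sinKernel a)) ?_ ?_
    · obtain ⟨p, hp, h⟩ := HurwitzZeta.isBigO_atTop_oddKernel a
      refine ⟨p, hp, ?_⟩
      rw [← isBigO_norm_left] at h ⊢
      refine h.congr_left fun t => ?_
      rw [← norm_real]
      simp [HurwitzZeta.hurwitzOddFEPair]
    · obtain ⟨p, hp, h⟩ := HurwitzZeta.isBigO_atTop_sinKernel a
      refine ⟨p, hp, ?_⟩
      rw [← isBigO_norm_left] at h ⊢
      refine h.congr_left fun t => ?_
      rw [← norm_real]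
      simp [HurwitzZeta.hurwitzOddFEPair]
  have := (h.comp_lin (1/2) (1/2)).mul (Gr.const (1/2))
  convert this using 2 with s
  simp only [HurwitzZeta.completedHurwitzZetaOdd, WeakFEPair.Λ]
  simp only [HurwitzZeta.hurwitzOddFEPair, smul_zero, sub_zero]
  rw [div_eq_mul_inv]; norm_num; congr 2; ring

lemma growth_completedL {N : ℕ} [NeZero N] (Φ : ZMod N → CC) : Gr (ZMod.completedLFunction₀ Φ) := by
  unfold ZMod.completedLFunction₀
  have hN : (N:CC) ≠ 0 := Nat.cast_ne_zero.2 (NeZero.ne N)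
  have h1 : Gr fun s => (N:CC) ^ (-s) := by
    convert Gr.exp_lin (-(Complex.log N)) using 2 with s
    rw [cpow_def_of_ne_zero hN]; ring_nf
  exact (h1.mul (Gr.sum _ _ fun j _ => (Gr.const _).mul (growth_even _))).add
    (h1.mul (Gr.sum _ _ fun j _ => (Gr.const _).mul (growth_odd _)))

end GrowthB

section XiB
open Complex Filter Topology ComplexConjugate

/-- the completed L-function -/
noncomputable def Xi {q : ℕ} [NeZero q] (χ : DC q) (s : CC) : CC :=
  if q = 1 then s * (s - 1) * completedRiemannZeta₀ s + 1
  else cexp ((LG q / 2 : RR) * s) * DirichletCharacter.completedLFunction χ s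

/-- shift in the gamma factor -/
noncomputable def Xia {q : ℕ} (χ : DC q) : ℕ :=
  open Classical in if q = 1 then 2 else if χ.Even then 0 else 1

/-- pole indicator -/
noncomputable def Xie (q : ℕ) : RR := if q = 1 then 1 else 0

lemma ne_one_of_prim {q : ℕ} [NeZero q] {χ : DC q} (hχ : χ.IsPrimitive)
    (hq : q ≠ 1) : χ ≠ 1 := by
  rintro rfl
  rw [DirichletCharacter.isPrimitive_def, DirichletCharacter.conductor_one] at hχ
  exact hq hχ.symm

lemma Xi_diff' {q : ℕ} [NeZero q] {χ : DC q} (hχ : q ≠ 1 → χ ≠ 1) :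
    Differentiable CC (Xi χ) := by
  unfold Xi
  by_cases hq : q = 1
  · simp only [hq, if_true]
    have := differentiable_completedZeta₀
    fun_prop
  · simp only [hq, if_false]
    have := DirichletCharacter.differentiable_completedLFunction (hχ hq)
    fun_prop

lemma Xi_diff {q : ℕ} [NeZero q] {χ : DC q} (hχ : χ.IsPrimitive) :
    Differentiable CC (Xi χ) := Xi_diff' (ne_one_of_prim hχ)

lemma Xi_gr {q : ℕ} [NeZero q] {χ : DC q} (hχ : χ.IsPrimitive) :
    Gr (Xi χ) := by
  unfold Xi
  by_cases hq : q = 1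
  · simp only [hq, if_true]
    have h := growth_even 0
    have h1 : Gr fun s : CC => s - 1 := by
      simpa [sub_eq_add_neg] using Gr.id.add (Gr.const (-1))
    exact ((Gr.id.mul h1).mul h).add (Gr.const 1)
  · simp only [hq, if_false]
    refine (Gr.exp_lin _).mul ?_
    have h1 := ne_one_of_prim hχ hq
    have h2 : (χ : ZMod q → CC) 0 = 0 := χ.map_zero' hq
    have h3 : ∑ j, χ j = 0 := MulChar.sum_eq_zero_of_ne_one h1
    convert growth_completedL (χ : ZMod q → CC) using 1
    ext s
    rw [DirichletCharacter.completedLFunction, ZMod.completedLFunction_eq, h2, h3]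
    simp

/-- constant in front -/
noncomputable def Xic {q : ℕ} (χ : DC q) : RR :=
  open Classical in if q = 1 then 2 else if χ.Even then 1 else PI ^ (-(1/2) : RR)

lemma Xic_ne {q : ℕ} (χ : DC q) : Xic χ ≠ 0 := by
  unfold Xic
  have : PI ^ (-(1/2) : RR) ≠ 0 := by positivity
  split_ifs <;> simp_all

/-- polar factor -/
noncomputable def Xip (q : ℕ) (s : CC) : CC := if q = 1 then s - 1 else 1

lemma pi_cpow (s : CC) : (PI : CC) ^ s = cexp ((LG PI : RR) * s) := by
  rw [cpow_def_of_ne_zero (by simp [Real.pi_ne_zero]), ofReal_log Real.pi_pos.le]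

lemma Xi_formula {q : ℕ} [NeZero q] (χ : DC q) {s : CC} (hs : 0 < s.re)
    (h1 : q = 1 → s ≠ 1) :
    Xi χ s = Xic χ * Xip q s * cexp ((LG (q / PI) / 2 : RR) * s) *
      Gamma ((s + Xia χ) / 2) * DirichletCharacter.LFunction χ s := by
  have hs0 : s ≠ 0 := by rintro rfl; simp at hs
  by_cases hq : q = 1
  · subst hq
    have h1 := h1 rfl
    have h1' : 1 - s ≠ 0 := sub_ne_zero.2 (Ne.symm h1)
    have hg : Gammaℝ s ≠ 0 := Gammaℝ_ne_zero_of_re_pos hs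
    have e1 : Xi χ s = s * (s - 1) * (Gammaℝ s * riemannZeta s) := by
      rw [riemannZeta_def_of_ne_zero hs0, completedRiemannZeta_eq, mul_div_cancel₀ _ hg]
      simp only [Xi, if_true]
      field_simp
      ring
    rw [e1, DirichletCharacter.LFunction_modOne_eq, Gammaℝ_def]
    simp only [Xic, Xip, Xia, if_true]
    have e2 : Gamma ((s + (2:ℕ)) / 2) = s / 2 * Gamma (s / 2) := by
      rw [← Complex.Gamma_add_one _ (by simpa using hs0)]; congr 1; push_cast; ring
    rw [e2, pi_cpow]
    have e3 : LG ((1:ℕ) / PI) = - LG PI := by simp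
    rw [e3]
    have e4 : ((LG PI : RR) : CC) * (-s / 2) = ((-LG PI / 2 : RR):CC) * s := by
      push_cast; ring
    rw [e4]
    push_cast
    ring
  · have hqpos : (0:RR) < q := by exact_mod_cast Nat.pos_of_ne_zero (NeZero.ne q)
    have hL := DirichletCharacter.LFunction_eq_completed_div_gammaFactor χ s (Or.inr hq)
    rw [Real.log_div hqpos.ne' Real.pi_ne_zero]
    rcases χ.even_or_odd with he | ho
    · have hg : Gammaℝ s ≠ 0 := Gammaℝ_ne_zero_of_re_pos hs
      rw [he.gammaFactor_def] at hL
      simp only [Xi, Xic, Xip, Xia, hq, he, if_true, if_false]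
      rw [hL, Gammaℝ_def, pi_cpow]
      have hG : Gamma (s/2) ≠ 0 := by
        intro h; apply hg; rw [Gammaℝ_def, h, mul_zero]
      have e5 : cexp (((LG q - LG PI) / 2 : RR) * s) =
        cexp ((LG q / 2 : RR) * s) * cexp ((LG PI : RR) * (-s/2)) := by
        rw [← Complex.exp_add]; congr 1; push_cast; ring
      rw [e5]
      simp only [Nat.cast_zero, add_zero]
      field_simp
      simp
    · have hs1 : 0 < (s+1).re := by simp; linarith
      have hne : ¬ χ.Even := by
        intro he
        have a1 : χ (-1) = 1 := he
        have a2 : χ (-1) = -1 := ho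
        rw [a1] at a2; norm_num at a2
      have hg : Gammaℝ (s+1) ≠ 0 := Gammaℝ_ne_zero_of_re_pos hs1
      rw [ho.gammaFactor_def] at hL
      simp only [Xi, Xic, Xip, Xia, hq, hne, if_false]
      rw [hL, Gammaℝ_def, pi_cpow]
      have hG : Gamma ((s+1)/2) ≠ 0 := by
        intro h; apply hg; rw [Gammaℝ_def, h, mul_zero]
      have e6 : ((PI ^ (-(1/2):RR) : RR):CC) = cexp ((LG PI : RR) * (-(1/2))) := by
        rw [ofReal_cpow Real.pi_pos.le, pi_cpow]; push_cast; rfl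
      have e5 : cexp ((LG q / 2 : RR) * s) * cexp ((LG PI : RR) * (-(s+1)/2)) =
        cexp ((LG PI : RR) * (-(1/2))) * cexp (((LG q - LG PI) / 2 : RR) * s) := by
        rw [← Complex.exp_add, ← Complex.exp_add]; congr 1; push_cast; ring
      rw [e6, mul_one, ← e5]
      simp only [Nat.cast_one]
      field_simp

lemma Xi_ne {q : ℕ} [NeZero q] {χ : DC q} (hχ : χ.IsPrimitive) {s : CC}
    (hs : 1 ≤ s.re) : Xi χ s ≠ 0 := by
  by_cases h : q = 1 → s ≠ 1
  · rw [Xi_formula χ bL h]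
    have h1 : Xip q s ≠ 0 := by
      unfold Xip
      split_ifs with h2
      · exact sub_ne_zero.2 (h h2)
      · simp
    have h2 : Gamma ((s + Xia χ) / 2) ≠ 0 := by
      apply Gamma_ne_zero_of_re_pos
      have : ((s + Xia χ) / 2).re = (s.re + Xia χ) / 2 := by simp
      rw [this]
      have : (0:RR) ≤ Xia χ := by positivity
      linarith
    have h3 : DirichletCharacter.LFunction χ s ≠ 0 := by
      apply DirichletCharacter.LFunction_ne_zero_of_one_le_re χ _ hs
      by_cases hq : q = 1
      · exact Or.inr (h hq)
      · exact Or.inl (ne_one_of_prim hχ hq)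
    have h4 : (Xic χ : CC) ≠ 0 := by exact_mod_cast Xic_ne χ
    simp [h1, h2, h3, h4]
  · push Not at h
    simp [Xi, h.1, h.2]

lemma L_conj {q : ℕ} [NeZero q] (χ : DC q) {s : CC} (hs : 1 < s.re) :
    conj (DirichletCharacter.LFunction χ (conj s)) = DirichletCharacter.LFunction χ⁻¹ s := by
  rw [DirichletCharacter.LFunction_eq_LSeries _ (by simpa using hs),
    DirichletCharacter.LFunction_eq_LSeries _ hs, LSeries, LSeries, conj_tsum]
  congr 1
  ext n
  rw [LSeries.term_def, LSeries.term_def]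
  split_ifs with h
  · simp
  · rw [map_div₀, ← MulChar.star_apply']
    congr 1
    rw [cpow_conj _ _ (by rw [natCast_arg]; exact Real.pi_pos.ne)]
    simp

lemma inv_even_iff {q : ℕ} [NeZero q] (χ : DC q) : (χ⁻¹).Even ↔ χ.Even := by
  unfold DirichletCharacter.Even
  rw [← MulChar.star_apply']
  constructor
  · intro h; simpa using congrArg star h
  · intro h; rw [h]; simp

lemma Xi_conj {q : ℕ} [NeZero q] {χ : DC q} (hχ : χ.IsPrimitive) (s : CC) :
    conj (Xi χ (conj s)) = Xi χ⁻¹ s := by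
  have h1 : Differentiable CC (conj ∘ Xi χ ∘ conj) := by
    intro z
    have := (Xi_diff hχ (conj z)).conj_conj
    simpa using this
  have h2 := Xi_diff' (χ := χ⁻¹) (fun h h' => ne_one_of_prim hχ h (inv_eq_one.1 h'))
  have : (conj ∘ Xi χ ∘ conj) = Xi χ⁻¹ := by
    refine AnalyticOnNhd.eq_of_eventuallyEq (𝕜 := CC) (z₀ := 2) (fun z _ => h1.analyticAt z)
      (fun z _ => h2.analyticAt z) ?_
    have : ∀ᶠ z : CC in 𝓝 2, 1 < z.re :=
      continuous_re.continuousAt.eventually (lt_mem_nhds bN)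
    filter_upwards [this] with z hz
    have hz1 : z ≠ 1 := by rintro rfl; simp at hz
    have hz2 : conj z ≠ 1 := by
      intro h; apply hz1; simpa using congrArg conj h
    simp only [Function.comp]
    rw [Xi_formula χ (by simp; linarith) (fun _ => hz2), Xi_formula χ⁻¹ bL (fun _ => hz1)]
    have ha : Xia χ⁻¹ = Xia χ := by
      by_cases h : χ.Even <;> simp [Xia, h, inv_even_iff χ]
    have hc : Xic χ⁻¹ = Xic χ := by
      by_cases h : χ.Even <;> simp [Xic, h, inv_even_iff χ]
    have hp : conj (Xip q (conj z)) = Xip q z := by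
      unfold Xip; split_ifs <;> simp
    have hg : conj (Gamma ((conj z + Xia χ) / 2)) = Gamma ((z + Xia χ) / 2) := by
      rw [← Gamma_conj]; simp [map_ofNat]
    have he : conj (cexp ((LG (q / PI) / 2 : RR) * conj z)) =
        cexp ((LG (q / PI) / 2 : RR) * z) := by
      rw [← exp_conj, map_mul, conj_ofReal, conj_conj]
    rw [map_mul, map_mul, map_mul, map_mul, L_conj χ hz, hg, hp, he, conj_ofReal, ha, hc]
  exact congrFun this s

lemma Xi_sym {q : ℕ} [NeZero q] {χ : DC q} (hχ : χ.IsPrimitive) :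
    ∃ C : CC, C ≠ 0 ∧ ∀ s, Xi χ (1 - conj s) = C * conj (Xi χ s) := by
  have key : ∃ C : CC, ∀ s, Xi χ (1 - s) = C * Xi χ⁻¹ s := by
    by_cases hq : q = 1
    · subst hq
      refine ⟨1, fun s => ?_⟩
      simp only [Xi, if_true]
      rw [completedRiemannZeta₀_one_sub]; ring
    · have hqpos : (0:RR) < q := by exact_mod_cast Nat.pos_of_ne_zero (NeZero.ne q)
      have hq0 : (q:CC) ≠ 0 := Nat.cast_ne_zero.2 (NeZero.ne q)
      refine ⟨DirichletCharacter.rootNumber χ, fun s => ?_⟩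
      simp only [Xi, hq, if_false]
      rw [hχ.completedLFunction_one_sub, cpow_def_of_ne_zero hq0]
      have : Complex.log q = (LG q : RR) := by
        rw [ofReal_log hqpos.le]; simp
      rw [this]
      have e : cexp ((LG q / 2 : RR) * s) = cexp ((LG q / 2 : RR) * (1 - s)) *
        cexp ((LG q : RR) * (s - 1/2)) := by
        rw [← Complex.exp_add]; congr 1; push_cast; ring
      rw [e]; ring
  obtain ⟨C, hC⟩ := key
  refine ⟨C, ?_, fun s => ?_⟩
  · rintro rfl
    have := hC (-1)
    rw [zero_mul] at this
    exact Xi_ne hχ bN this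
  · rw [hC, ← Xi_conj hχ]; simp

lemma Xi_zero {q : ℕ} [NeZero q] {χ : DC q} (hχ : χ.IsPrimitive) {ρ : CC}
    (h : Xi χ ρ = 0) : DirichletCharacter.LFunction χ ρ = 0 ∧ 0 < ρ.re ∧ ρ.re < 1 := by
  have h1 : ρ.re < 1 := by
    by_contra h1
    exact Xi_ne hχ (not_lt.1 h1) h
  have h0 : 0 < ρ.re := by
    by_contra h0
    obtain ⟨C, hC, hs⟩ := Xi_sym hχ
    have h2 := hs ρ
    rw [h, map_zero, mul_zero] at h2
    refine Xi_ne hχ ?_ h2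
    simp; linarith
  refine ⟨?_, h0, h1⟩
  have hρ1 : ρ ≠ 1 := by rintro rfl; simp at h1
  rw [Xi_formula χ h0 (fun _ => hρ1)] at h
  have h2 : Gamma ((ρ + Xia χ) / 2) ≠ 0 := by
    apply Gamma_ne_zero_of_re_pos
    have : ((ρ + Xia χ) / 2).re = (ρ.re + Xia χ) / 2 := by simp
    rw [this]
    have : (0:RR) ≤ Xia χ := by positivity
    linarith
  have h3 : Xip q ρ ≠ 0 := by
    unfold Xip
    split_ifs with h2
    · exact sub_ne_zero.2 hρ1
    · simp
  have h4 : (Xic χ : CC) ≠ 0 := by exact_mod_cast Xic_ne χ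
  simpa [h2, h3, h4] using h

lemma Xi_logDeriv {q : ℕ} [NeZero q] {χ : DC q} (hχ : χ.IsPrimitive) {s : CC}
    (hs : 1 < s.re) : logDeriv (Xi χ) s = (LG (q / PI) / 2 : RR) +
      digamma ((s + Xia χ) / 2) / 2 + logDeriv (DirichletCharacter.LFunction χ) s + Xie q / (s - 1) := by
  have hs1 : s ≠ 1 := by rintro rfl; simp at hs
  have ev : Xi χ =ᶠ[𝓝 s] fun s => Xic χ * (Xip q s * (cexp ((LG (q / PI) / 2 : RR) * s) *
      (Gamma ((s + Xia χ) / 2) * DirichletCharacter.LFunction χ s))) := by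
    have : ∀ᶠ z : CC in 𝓝 s, 1 < z.re :=
      continuous_re.continuousAt.eventually (lt_mem_nhds hs)
    filter_upwards [this] with z hz
    have hz1 : z ≠ 1 := by rintro rfl; simp at hz
    rw [Xi_formula χ bL (fun _ => hz1)]; ring
  have hre : 0 < ((s + Xia χ) / 2).re := by
    have : ((s + Xia χ) / 2).re = (s.re + Xia χ) / 2 := by simp
    rw [this]
    have : (0:RR) ≤ Xia χ := by positivity
    linarith
  have hGd : DifferentiableAt CC Gamma ((s + Xia χ) / 2) := by
    apply differentiableAt_Gamma
    intro m h
    rw [h] at hre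
    simp at hre
    have : (0:RR) ≤ m := by positivity
    linarith
  have hGd' : DifferentiableAt CC (fun s : CC => Gamma ((s + Xia χ) / 2)) s :=
    DifferentiableAt.comp s (f := fun s : CC => (s + Xia χ) / 2) hGd (by fun_prop)
  have hG : Gamma ((s + Xia χ) / 2) ≠ 0 := Gamma_ne_zero_of_re_pos hre
  have hLd : DifferentiableAt CC (DirichletCharacter.LFunction χ) s :=
    DirichletCharacter.differentiableAt_LFunction χ s (Or.inl hs1)
  have hL : DirichletCharacter.LFunction χ s ≠ 0 :=
    DirichletCharacter.LFunction_ne_zero_of_one_le_re χ (Or.inr hs1) hs.le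
  have hp : Xip q s ≠ 0 := by
    unfold Xip
    split_ifs with h2
    · exact sub_ne_zero.2 hs1
    · simp
  have hpd : DifferentiableAt CC (Xip q) s := by
    unfold Xip; split_ifs <;> fun_prop
  have hc : (Xic χ : CC) ≠ 0 := by exact_mod_cast Xic_ne χ
  have hE : DifferentiableAt CC (fun s => cexp ((LG (q / PI) / 2 : RR) * s)) s := by fun_prop
  have e0 : logDeriv (Xi χ) s = logDeriv (fun s => Xic χ * (Xip q s * (cexp ((LG (q / PI) / 2 : RR) * s) *
      (Gamma ((s + Xia χ) / 2) * DirichletCharacter.LFunction χ s)))) s := by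
    rw [logDeriv_apply, logDeriv_apply, ev.deriv_eq, ev.eq_of_nhds]
  rw [e0, logDeriv_const_mul (f := fun s => _) s _ hc,
    logDeriv_mul (f := Xip q) (g := fun s => cexp ((LG (q / PI) / 2 : RR) * s) *
      (Gamma ((s + Xia χ) / 2) * DirichletCharacter.LFunction χ s)) s hp (by simp [hG, hL]) hpd
      (hE.mul (hGd'.mul hLd)),
    logDeriv_mul (g := fun s => Gamma ((s + Xia χ) / 2) * DirichletCharacter.LFunction χ s) s bS
      (by simp [hG, hL]) hE (hGd'.mul hLd),
    logDeriv_mul s hG hL hGd' hLd]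
  have e1 : logDeriv (Xip q) s = Xie q / (s - 1) := by
    unfold Xip Xie
    rw [logDeriv_apply]
    split_ifs
    · simp
    · simp
  have e2 : logDeriv (fun s : CC => cexp ((LG (q / PI) / 2 : RR) * s)) s =
      (LG (q / PI) / 2 : RR) := by
    rw [logDeriv_apply]
    have : HD (fun s : CC => cexp ((LG (q / PI) / 2 : RR) * s))
      (cexp ((LG (q / PI) / 2 : RR) * s) * ((LG (q / PI) / 2 : RR) * 1)) s :=
      ((hasDerivAt_id s).const_mul _).cexp
    rw [this.deriv, mul_one, mul_div_cancel_left₀ _ (exp_ne_zero _)]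
  have e3 : logDeriv (fun s : CC => Gamma ((s + Xia χ) / 2)) s = digamma ((s + Xia χ) / 2) / 2 := by
    have := logDeriv_comp (f := Gamma) (g := fun s : CC => (s + Xia χ) / 2) (x := s) hGd (by fun_prop)
    rw [show (fun s : CC => Gamma ((s + Xia χ) / 2)) = Gamma ∘ (fun s : CC => (s + Xia χ) / 2) from rfl, this]
    have hd : deriv (fun s : CC => (s + Xia χ) / 2) s = 1/2 := by
      simp
    rw [hd, digamma]; ring
  rw [e1, e2, e3]; ring

end XiB

section ZerosD
open Complex Filter Topology ComplexConjugate

lemma tendsto_exhaust {E : Type*} [NormedAddCommGroup E]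
    (Z : Set CC) (S : RR → Finset CC) (hm : Monotone S)
    (hZ : ∀ R, ∀ ρ ∈ S R, ρ ∈ Z) (hc : ∀ ρ ∈ Z, ∃ R, ρ ∈ S R) {f : CC → E} {a : E} (hf : HasSum f a)
    (h0 : ∀ ρ, ρ ∉ Z → f ρ = 0) : Tendsto (fun R => ∑ ρ ∈ S R, f ρ) atTop (𝓝 a) := by
  classical
  have h1 : HasSum (fun ρ : Z => f ρ) a := by
    refine (hasSum_subtype_iff_of_support_subset (s := Z) (f := f) ?_).2 hf
    intro ρ hρ; by_contra h; exact hρ (h0 ρ h)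
  have h2 : Tendsto (fun R => (S R).subtype (· ∈ Z)) atTop atTop := by
    apply tendsto_atTop_finset_of_monotone
    · intro R R' h ρ hρ
      rw [Finset.mem_subtype] at hρ ⊢
      exact hm h hρ
    · intro ρ
      obtain ⟨R, hR⟩ := hc ρ ρ.2
      exact ⟨R, by rw [Finset.mem_subtype]; exact hR⟩
  have h3 := h1.comp h2
  refine h3.congr fun R => ?_
  exact Finset.sum_subtype_of_mem f (hZ R)

lemma hasSum_exhaust (Z : Set CC) (S : RR → Finset CC) (hm : Monotone S)
    (hZ : ∀ R, ∀ ρ ∈ S R, ρ ∈ Z) (hc : ∀ ρ ∈ Z, ∃ R, ρ ∈ S R) {f : CC → RR} {a : RR}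
    (hpos : ∀ ρ, 0 ≤ f ρ) (h0 : ∀ ρ, ρ ∉ Z → f ρ = 0)
    (ht : Tendsto (fun R => ∑ ρ ∈ S R, f ρ) atTop (𝓝 a)) : HasSum f a := by
  classical
  have hmono : Monotone fun R => ∑ ρ ∈ S R, f ρ := fun R R' h =>
    Finset.sum_le_sum_of_subset_of_nonneg (hm h) fun i _ _ => hpos i
  have hle : ∀ R, ∑ ρ ∈ S R, f ρ ≤ a := fun R => hmono.ge_of_tendsto ht R
  have hs : Summable f := by
    refine summable_of_sum_le (c := a) hpos fun F => ?_
    have : ∃ R, ∀ ρ ∈ F, ρ ∈ Z → ρ ∈ S R := by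
      induction F using Finset.induction_on with
      | empty => exact ⟨0, by simp⟩
      | insert x F hx ih =>
        obtain ⟨R, hR⟩ := ih
        by_cases hxZ : x ∈ Z
        · obtain ⟨R', hR'⟩ := hc x hxZ
          refine ⟨max R R', fun ρ hρ hρZ => ?_⟩
          rcases Finset.mem_insert.1 hρ with rfl | h
          · exact hm (le_max_right _ _) hR'
          · exact hm (le_max_left _ _) (hR ρ h hρZ)
        · refine ⟨R, fun ρ hρ hρZ => ?_⟩
          rcases Finset.mem_insert.1 hρ with rfl | h
          · exact absurd hρZ hxZ
          · exact hR ρ h hρZ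
    obtain ⟨R, hR⟩ := this
    refine le_trans ?_ (hle R)
    calc ∑ ρ ∈ F, f ρ = ∑ ρ ∈ F with ρ ∈ Z, f ρ := by
          rw [Finset.sum_filter]
          refine Finset.sum_congr rfl fun ρ _ => ?_
          split_ifs with h
          · rfl
          · exact h0 ρ h
      _ ≤ _ := Finset.sum_le_sum_of_subset_of_nonneg (fun ρ hρ => by
            rw [Finset.mem_filter] at hρ; exact hR ρ hρ.1 hρ.2) fun i _ _ => hpos i
  have := tendsto_exhaust Z S hm hZ hc hs.hasSum h0
  rw [tendsto_nhds_unique ht this]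
  exact hs.hasSum

variable {q : ℕ} [NeZero q]

/-- multiplicity of zeros -/
noncomputable def mz (χ : DC q) (ρ : CC) : RR := analyticOrderNatAt (Xi χ) ρ

lemma mz_nonneg (χ : DC q) (ρ : CC) : 0 ≤ mz χ ρ := Nat.cast_nonneg _

lemma mz_eq_zero {χ : DC q} (hχ : χ.IsPrimitive) {ρ : CC} (h : Xi χ ρ ≠ 0) :
    mz χ ρ = 0 := by
  have : analyticOrderAt (Xi χ) ρ = 0 := by
    rw [((Xi_diff hχ).analyticAt ρ).analyticOrderAt_eq_zero]; exact h
  simp [mz, analyticOrderNatAt, this]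

lemma mz_zero {χ : DC q} (hχ : χ.IsPrimitive) {ρ : CC} (h : mz χ ρ ≠ 0) :
    Xi χ ρ = 0 := by
  by_contra h'; exact h (mz_eq_zero hχ h')

lemma mz_re {χ : DC q} (hχ : χ.IsPrimitive) {ρ : CC} (h : mz χ ρ ≠ 0) :
    0 < ρ.re ∧ ρ.re < 1 := (Xi_zero hχ (mz_zero hχ h)).2

/-- the finite set of zeros -/
noncomputable def SZ {χ : DC q} (hχ : χ.IsPrimitive) (R : RR) : Finset CC :=
  (finite_zeros (Xi χ) (Xi_diff hχ) 2 (Xi_ne hχ bN) R).toFinset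

lemma mem_SZ {χ : DC q} (hχ : χ.IsPrimitive) (R : RR) (ρ : CC) :
    ρ ∈ SZ hχ R ↔ ρ ∈ Metric.closedBall 2 R ∧ Xi χ ρ = 0 := by
  simp [SZ]

lemma SZ_mono {χ : DC q} (hχ : χ.IsPrimitive) : Monotone (SZ hχ) := by
  intro R R' h ρ hρ
  rw [mem_SZ] at hρ ⊢
  exact ⟨Metric.closedBall_subset_closedBall h hρ.1, hρ.2⟩

lemma Xi_hadamard {χ : DC q} (hχ : χ.IsPrimitive) (z : CC) (hz : Xi χ z ≠ 0) :
    Tendsto (fun R : RR => ∑ ρ ∈ SZ hχ R, (mz χ ρ : CC) * (1/(z-ρ) - 1/(2-ρ))) atTop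
      (𝓝 (logDeriv (Xi χ) z - logDeriv (Xi χ) 2)) := by
  obtain ⟨C, hC, hg⟩ := Xi_gr hχ
  have := hadamard_diff (Xi χ) (Xi_diff hχ) 2 (Xi_ne hχ bN) (C * 3 ^ (3/2:RR)) (fun z => by
    refine (hg z).trans ?_
    rw [mul_assoc, ← Real.mul_rpow bPq bPq]
    gcongr
    have h1 : ‖z‖ ≤ ‖z - 2‖ + ‖(2:CC)‖ := by
      simpa using norm_add_le (z - 2) 2
    have h2 : ‖(2:CC)‖ = 2 := by simp
    linarith [norm_nonneg (z - 2)]) z hz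
  simpa [mz, SZ] using this

lemma Xi_logDeriv_sym {χ : DC q} (hχ : χ.IsPrimitive) (s : CC) :
    logDeriv (Xi χ) (1 - conj s) = - conj (logDeriv (Xi χ) s) := by
  obtain ⟨C, hC, h⟩ := Xi_sym hχ
  have e : (fun z => Xi χ (1 - z)) = fun z => C * (conj ∘ Xi χ ∘ conj) z := by
    ext z
    have := h (conj z)
    simpa using this
  have h1 : HD (fun z => Xi χ (1 - z)) (- deriv (Xi χ) (1 - conj s)) (conj s) := by
    have := ((Xi_diff hχ) (1 - conj s)).hasDerivAt.comp (conj s) ((hasDerivAt_id (conj s)).const_sub 1)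
    simpa [Function.comp_def] using this
  have h2 : HD (fun z => C * (conj ∘ Xi χ ∘ conj) z) (C * conj (deriv (Xi χ) s)) (conj s) :=
    (((Xi_diff hχ) s).hasDerivAt.conj_conj).const_mul C
  rw [e] at h1
  have h3 := h1.unique h2
  rw [logDeriv_apply, logDeriv_apply, h s, map_div₀, neg_eq_iff_eq_neg.1 h3]
  by_cases h4 : conj (Xi χ s) = 0
  · simp [h4]
  · field_simp

/-- The kernel. -/
noncomputable def Kf (b u : RR) : RR := (2 - b) / ((2 - b)^2 + u^2) + (1 + b) / ((1 + b)^2 + u^2)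

lemma Kf_pos {b u : RR} (h0 : 0 < b) (h1 : b < 1) : 0 < Kf b u := by
  unfold Kf
  have : 0 < 2 - b := by linarith
  positivity

lemma hasSum_Kf {χ : DC q} (hχ : χ.IsPrimitive) (t : RR) :
    HasSum (fun ρ => mz χ ρ * Kf ρ.re (t - ρ.im)) (2 * (logDeriv (Xi χ) (2 + t * I)).re) := by
  have hne2 : Xi χ (2 + t * I) ≠ 0 := Xi_ne hχ bS
  have hcs : 1 - conj (2 + t * I) = -1 + t * I := by
    simp [map_ofNat]; ring
  have hne1 : Xi χ (-1 + t * I) ≠ 0 := by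
    obtain ⟨C, hC, h⟩ := Xi_sym hχ
    rw [← hcs, h]; simp [hC, hne2]
  have hld := Xi_logDeriv_sym hχ (2 + t * I)
  rw [hcs] at hld
  have T := (Xi_hadamard hχ _ hne2).sub (Xi_hadamard hχ _ hne1)
  rw [hld] at T
  have T2 := (continuous_re.tendsto _).comp T
  refine hasSum_exhaust {ρ | Xi χ ρ = 0} (SZ hχ) (SZ_mono hχ) (fun R ρ h => ((mem_SZ hχ R ρ).1 h).2)
    (fun ρ h => ⟨dist ρ 2, by rw [mem_SZ]; exact ⟨by simp, h⟩⟩) ?_ ?_ ?_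
  · intro ρ
    by_cases h : mz χ ρ = 0
    · simp [h]
    · exact mul_nonneg (mz_nonneg _ _) (Kf_pos (mz_re hχ h).1 (mz_re hχ h).2).le
  · intro ρ h
    rw [mz_eq_zero hχ h, zero_mul]
  · convert T2 using 1
    · ext R
      simp only [Function.comp]
      rw [← Finset.sum_sub_distrib, Complex.re_sum]
      refine Finset.sum_congr rfl fun ρ hρ => ?_
      rw [← mul_sub, Complex.re_ofReal_mul]
      congr 1
      have e : ∀ w : CC, (1 / w).re = w.re / (w.re ^ 2 + w.im ^ 2) := by
        intro w; rw [one_div, inv_re, normSq_apply]; ring_nf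
      simp only [sub_re, e]
      simp [Kf]
      have : (-1 - ρ.re) = -(1 + ρ.re) := by ring
      rw [this, neg_sq]
      ring
    · congr 1
      simp
      ring

lemma norm_sq_le_Kf {ρ : CC} (h0 : 0 < ρ.re) (h1 : ρ.re < 1) : 1 / ‖2 - ρ‖ ^ 2 ≤ Kf ρ.re (0 - ρ.im) := by
  have e : ‖2 - ρ‖ ^ 2 = (2 - ρ.re)^2 + (0 - ρ.im)^2 := by
    rw [← normSq_eq_norm_sq, normSq_apply]; simp; ring
  unfold Kf
  rw [e]
  have h2 : 0 < 2 - ρ.re := by linarith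
  refine le_add_of_le_of_nonneg ?_ bPq
  gcongr
  linarith

lemma summable_mz {χ : DC q} (hχ : χ.IsPrimitive) :
    Summable fun ρ => mz χ ρ * (1 / ‖2 - ρ‖ ^ 2) := by
  refine Summable.of_nonneg_of_le (fun ρ => mul_nonneg (mz_nonneg _ _) bPq) (fun ρ => ?_)
    (hasSum_Kf hχ 0).summable
  by_cases h : mz χ ρ = 0
  · simp [h]
  · exact mLL (norm_sq_le_Kf (mz_re hχ h).1 (mz_re hχ h).2) (mz_nonneg _ _)

lemma hadamard_term_bound {s ρ : CC} (hs : s.re = 3) (h1 : ρ.re < 1) :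
    ‖1/(s-ρ) - 1/(2-ρ)‖ ≤ ‖s - 2‖ * (1 + ‖s - 2‖) * (1 / ‖2 - ρ‖ ^ 2) := by
  have a1 : 2 ≤ ‖s - ρ‖ := by
    refine le_trans ?_ (Complex.re_le_norm _)
    simp [hs]; linarith
  have a2 : 1 ≤ ‖2 - ρ‖ := by
    refine le_trans ?_ (Complex.re_le_norm _)
    simp; linarith
  have n1 : s - ρ ≠ 0 := by rw [← norm_ne_zero_iff]; positivity
  have n2 : 2 - ρ ≠ 0 := by rw [← norm_ne_zero_iff]; positivity
  have e : 1/(s-ρ) - 1/(2-ρ) = - (s - 2) / ((s - ρ) * (2 - ρ)) := by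
    field_simp; ring
  have a3 : ‖2 - ρ‖ ≤ (1 + ‖s - 2‖) * ‖s - ρ‖ := by
    have : ‖2 - ρ‖ ≤ ‖s - ρ‖ + ‖s - 2‖ := by
      have := norm_sub_le (s - ρ) (s - 2)
      simpa using this
    nlinarith [norm_nonneg (s-2)]
  rw [e, norm_div, norm_neg, norm_mul, mul_one_div, dD bPq bPq]
  calc ‖s - 2‖ * ‖2 - ρ‖ ^ 2 = ‖s - 2‖ * ‖2 - ρ‖ * ‖2 - ρ‖ := by ring
    _ ≤ ‖s - 2‖ * ‖2 - ρ‖ * ((1 + ‖s - 2‖) * ‖s - ρ‖) := by gcongr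
    _ = _ := by ring

lemma hasSum_hadamard {χ : DC q} (hχ : χ.IsPrimitive) {s : CC} (hs : s.re = 3) :
    HasSum (fun ρ => (mz χ ρ : CC) * (1/(s-ρ) - 1/(2-ρ))) (logDeriv (Xi χ) s - logDeriv (Xi χ) 2) := by
  have hsum : Summable (fun ρ => (mz χ ρ : CC) * (1/(s-ρ) - 1/(2-ρ))) := by
    refine Summable.of_norm_bounded ((summable_mz hχ).mul_left (‖s - 2‖ * (1 + ‖s - 2‖))) fun ρ => ?_
    rw [norm_mul, norm_real, rN (mz_nonneg _ _), mul_left_comm]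
    by_cases h : mz χ ρ = 0
    · simp [h]
    · exact mLL (hadamard_term_bound hs (mz_re hχ h).2) (mz_nonneg _ _)
  have h1 := tendsto_exhaust {ρ | Xi χ ρ = 0} (SZ hχ) (SZ_mono hχ) (fun R ρ h => ((mem_SZ hχ R ρ).1 h).2)
    (fun ρ h => ⟨dist ρ 2, by rw [mem_SZ]; exact ⟨by simp, h⟩⟩) hsum.hasSum
    (fun ρ h => by rw [mz_eq_zero hχ h]; simp)
  have h2 := Xi_hadamard hχ s (Xi_ne hχ (by rw [hs]; norm_num))
  rw [← tendsto_nhds_unique h1 h2]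
  exact hsum.hasSum

lemma order_sym {F : CC → CC} (hF : ∀ z, AnalyticAt CC F z) {C : CC} (hC : C ≠ 0)
   (h : ∀ s, F (1 - conj s) = C * conj (F s)) (ρ : CC) (n : ℕ) (hn : analyticOrderAt F ρ = n) :
   analyticOrderAt F (1 - conj ρ) = n := by
  rw [(hF ρ).analyticOrderAt_eq_natCast] at hn
  rw [(hF _).analyticOrderAt_eq_natCast]
  obtain ⟨g, hg, h0, he⟩ := hn
  have ht : Tendsto (fun w : CC => 1 - conj w) (𝓝 (1 - conj ρ)) (𝓝 ρ) := by
    have : Continuous (fun w : CC => 1 - conj w) := by fun_prop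
    have := this.tendsto (1 - conj ρ)
    simpa using this
  refine ⟨fun w => C * (-1)^n * conj (g (1 - conj w)), ?_, ?_, ?_⟩
  · rw [Complex.analyticAt_iff_eventually_differentiableAt] at hg ⊢
    filter_upwards [ht.eventually hg] with w hw
    apply DifferentiableAt.const_mul
    have h1 : DifferentiableAt CC (fun z => g (1 - z)) (conj w) := by
      have : DifferentiableAt CC (fun z : CC => 1 - z) (conj w) := by fun_prop
      exact DifferentiableAt.comp (g := g) (conj w) hw this
    have h2 := h1.conj_conj
    rw [conj_conj] at h2
    exact h2
  · simp [hC, h0]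
  · filter_upwards [ht.eventually he] with w hw
    have := h (1 - conj w)
    simp only [map_sub, map_one, conj_conj, sub_sub_cancel] at this
    rw [this, hw]
    simp only [smul_eq_mul, map_mul, map_pow, map_sub, map_one, conj_conj]
    rw [show (w - (1 - conj ρ)) = (-1) * (1 - w - conj ρ) by ring, mul_pow]
    have : ((-1:CC)^n)*(-1)^n = 1 := by rw [← mul_pow]; simp
    linear_combination (-(C * (1 - w - conj ρ)^n * conj (g (1 - conj w)))) * this

/-- symmetry of multiplicities -/
lemma mz_sym {χ : DC q} (hχ : χ.IsPrimitive) (ρ : CC) :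
    mz χ (1 - conj ρ) = mz χ ρ := by
  obtain ⟨C, hC, h⟩ := Xi_sym hχ
  have key := order_sym (fun z => (Xi_diff hχ).analyticAt z) hC h
  rw [mz, mz, analyticOrderNatAt, analyticOrderNatAt]
  cases h1 : analyticOrderAt (Xi χ) ρ with
  | coe n => rw [key ρ n h1]
  | top =>
    cases h2 : analyticOrderAt (Xi χ) (1 - conj ρ) with
    | top => rfl
    | coe m =>
      have := key _ m h2
      simp only [map_sub, map_one, conj_conj, sub_sub_cancel] at this
      rw [h1] at this
      exact absurd this bS

end ZerosD

section BoundD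
set_option linter.unusedSectionVars false
open Complex Filter Topology ComplexConjugate

variable {q : ℕ} [NeZero q]

lemma L_hasSum (χ : DC q) {s : CC} (hs : 1 < s.re) :
    HasSum (fun n : ℕ => (vM n : CC) * χ n * (n:CC)^(-s))
      (-logDeriv χ.LFunction s) := by
  have h1 := DirichletCharacter.LSeries_twist_vonMangoldt_eq χ hs
  have h2 := (DirichletCharacter.LSeriesSummable_twist_vonMangoldt χ hs)
  have h3 := h2.LSeriesHasSum
  rw [h1] at h3
  have h4 : -logDeriv χ.LFunction s = - deriv (LSeries (χ ·)) s / LSeries (χ ·) s := by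
    rw [logDeriv_apply, DirichletCharacter.LFunction_eq_LSeries χ hs,
      DirichletCharacter.deriv_LFunction_eq_deriv_LSeries χ hs]
    ring
  rw [h4]
  have h5 : (fun n : ℕ => (vM n : CC) * χ n * (n:CC)^(-s)) =
      LSeries.term ((fun n : ℕ => χ n) * fun n : ℕ => (vM n : CC)) s := by
    ext n
    rw [LSeries.term_def₀ bS]
    simp [mul_comm]
  rw [h5]
  exact h3

lemma vm_le_sqrt (n : ℕ) : vM n ≤ Real.sqrt n := by
  rcases Nat.eq_zero_or_pos n with rfl | hn
  · simp
  refine ArithmeticFunction.vonMangoldt_le_log.trans ?_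
  have hn' : (0:RR) < n := by exact_mod_cast hn
  have h0 : 0 < Real.sqrt n := Real.sqrt_pos.2 hn'
  have h1 : LG n = 2 * LG (Real.sqrt n) := by
    rw [Real.log_sqrt hn'.le]; ring
  have h2 := lO (show 0 < Real.sqrt n / 2 by positivity)
  rw [Real.log_div h0.ne' bN] at h2
  have := Real.log_two_lt_d9
  linarith

lemma three_half_step (n : ℕ) (hn : 1 ≤ n) :
    1 / (((n+1:ℕ):RR) * Real.sqrt ((n+1:ℕ):RR)) ≤ 2 / Real.sqrt n - 2 / Real.sqrt ((n+1:ℕ):RR) := by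
  have hn' : (0:RR) < n := by exact_mod_cast hn
  have ha : 0 < Real.sqrt n := Real.sqrt_pos.2 hn'
  have hb : 0 < Real.sqrt ((n+1:ℕ):RR) := Real.sqrt_pos.2 bPq
  have ha2 := Real.sq_sqrt hn'.le
  have hb2 := Real.sq_sqrt (show (0:RR) ≤ ((n+1:ℕ):RR) by positivity)
  have hab : Real.sqrt n ≤ Real.sqrt ((n+1:ℕ):RR) := Real.sqrt_le_sqrt (by push_cast; linarith)
  set a := Real.sqrt n
  set b := Real.sqrt ((n+1:ℕ):RR)
  rw [← hb2]
  have e : b^2 - a^2 = 1 := by rw [hb2, ha2]; push_cast; ring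
  rw [div_sub_div _ _ ha.ne' hb.ne', dD bPq bPq]
  have e2 : (b - a) * (b + a) = 1 := by linarith
  have hba : 0 ≤ b - a := by linarith
  have : 1 ≤ (b - a) * (2 * b) := by nlinarith
  have h3 : a * b ≤ b * b := by nlinarith
  nlinarith [mul_pos hb hb, mul_nonneg hba hb.le, mul_pos (mul_pos hb hb) ha]

lemma sum_three_half (N : ℕ) :
    ∑ n ∈ Finset.range N, (if 2 ≤ n then 1 / ((n:RR) * Real.sqrt n) else 0) ≤ 2 := by
  have key : ∀ M : ℕ, ∑ n ∈ Finset.range (M+2), (if 2 ≤ n then 1 / ((n:RR) * Real.sqrt n) else 0)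
      ≤ 2 - 2 / Real.sqrt ((M+1:ℕ):RR) := by
    intro M
    induction M with
    | zero => simp [Finset.sum_range_succ]
    | succ k ih =>
      rw [Finset.sum_range_succ, if_pos (by omega)]
      have := three_half_step (k+1) (by omega)
      linarith
  have h2 : ∑ n ∈ Finset.range N, (if 2 ≤ n then 1 / ((n:RR) * Real.sqrt n) else 0) ≤
      ∑ n ∈ Finset.range (N+2), (if 2 ≤ n then 1 / ((n:RR) * Real.sqrt n) else 0) :=
    Finset.sum_le_sum_of_subset_of_nonneg (fun i hi => by simp at hi ⊢; omega)
      (fun i _ _ => by split_ifs <;> positivity)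
  have := key N
  have h3 : 0 ≤ 2 / Real.sqrt ((N+1:ℕ):RR) := by positivity
  linarith

lemma norm_term_le (χ : DC q) (t : RR) (n : ℕ) :
    ‖(vM n : CC) * χ n * (n:CC)^(-(2+t*I))‖ ≤
      vM n / (n:RR)^2 := by
  rcases Nat.eq_zero_or_pos n with rfl | hn
  · simp
  rw [norm_mul, norm_mul, Complex.norm_natCast_cpow_of_pos hn]
  have h1 := χ.norm_le_one n
  have h0 : (0:RR) ≤ vM n := vN
  have e : (-(2+t*I)).re = -2 := by simp
  rw [e, Real.rpow_neg bPq, div_eq_mul_inv]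
  rw [show ((n:RR)^(2:RR)) = (n:RR)^2 by norm_cast]
  rw [cN, rN h0]
  gcongr
  nlinarith

lemma vm_sum_le (N : ℕ) : ∑ n ∈ Finset.range N, vM n / (n:RR)^2 ≤ 2 := by
  refine le_trans (Finset.sum_le_sum fun n _ => ?_) (sum_three_half N)
  split_ifs with h
  · have hn : (0:RR) < n := by exact_mod_cast (by omega : 0 < n)
    have := vm_le_sqrt n
    have h0 : 0 < Real.sqrt n := Real.sqrt_pos.2 hn
    have h2 := Real.sq_sqrt hn.le
    rw [dD bPq bPq]
    calc vM n * ((n:RR) * Real.sqrt n) ≤ Real.sqrt n * ((n:RR) * Real.sqrt n) := by gcongr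
      _ = 1 * (n:RR)^2 := by rw [show Real.sqrt n * ((n:RR) * Real.sqrt n) = n * (Real.sqrt n)^2 by ring, h2]; ring
  · interval_cases n <;> simp

lemma vm_summable : Summable fun n : ℕ => vM n / (n:RR)^2 :=
  summable_of_sum_range_le (fun n => div_nonneg vN bPq)
    vm_sum_le

lemma norm_logDeriv_L_le (χ : DC q) (t : RR) :
    ‖logDeriv χ.LFunction (2+t*I)‖ ≤ 2 := by
  have h := L_hasSum χ (s := 2+t*I) bS
  rw [← norm_neg, ← h.tsum_eq]
  refine (tsum_of_norm_bounded vm_summable.hasSum (norm_term_le χ t)).trans ?_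
  exact vm_summable.tsum_le_of_sum_range_le vm_sum_le

/-- `2 Re Ξ'/Ξ(2+it)` -/
noncomputable def Dt (χ : DC q) (t : RR) : RR := 2 * (logDeriv (Xi χ) (2+t*I)).re

lemma Xia_le (χ : DC q) : Xia χ ≤ 2 := by
  unfold Xia; split_ifs <;> norm_num

lemma Xie_le (q : ℕ) : Xie q ≤ 1 := by
  unfold Xie; split_ifs <;> norm_num

lemma Xie_nonneg (q : ℕ) : 0 ≤ Xie q := by
  unfold Xie; split_ifs <;> norm_num

lemma Dt_eq {χ : DC q} (hχ : χ.IsPrimitive) (t : RR) :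
    Dt χ t = LG q - LG PI + (digamma ((2 + t*I + Xia χ)/2)).re
      + 2 * (logDeriv χ.LFunction (2+t*I)).re + 2 * Xie q / (1+t^2) := by
  have h := Xi_logDeriv hχ (s := 2+t*I) bS
  have hq : (q:RR) ≠ 0 := by exact_mod_cast NeZero.ne q
  rw [Dt, h, Real.log_div hq Real.pi_ne_zero]
  have e1 : ((digamma ((2 + t*I + Xia χ)/2))/2).re = (digamma ((2 + t*I + Xia χ)/2)).re/2 := by
    simp
  have e2 : ((Xie q : CC) / (2 + t*I - 1)).re = Xie q / (1+t^2) := by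
    rw [show (2:CC) + t*I - 1 = 1 + t * I by ring, Complex.div_re]
    simp [Complex.normSq_apply]
    ring
  simp only [Complex.add_re, e1, e2, Complex.ofReal_re]
  ring

lemma z_re (χ : DC q) (t : RR) : ((2 + t*I + Xia χ)/2 : CC).re = 1 + Xia χ / 2 := by
  simp; ring
lemma z_im (χ : DC q) (t : RR) : ((2 + t*I + Xia χ)/2 : CC).im = t / 2 := by
  simp

lemma z_norm (χ : DC q) (t : RR) :
    ‖((2 + t*I + Xia χ)/2 : CC)‖ ≤ Real.sqrt (16 + t^2) / 2 := by
  have h1 : (Xia χ : RR) ≤ 2 := by exact_mod_cast Xia_le χ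
  have h0 : (0:RR) ≤ Xia χ := by positivity
  rw [Complex.norm_def]
  rw [show Real.sqrt (16 + t^2) / 2 = Real.sqrt ((16 + t^2)/4) by
    rw [Real.sqrt_div bPq, show (4:RR) = 2^2 by norm_num, Real.sqrt_sq bN]]
  apply Real.sqrt_le_sqrt
  rw [Complex.normSq_apply, z_re, z_im]
  nlinarith

lemma z_norm_pos (χ : DC q) (t : RR) :
    0 < ‖((2 + t*I + Xia χ)/2 : CC)‖ := by
  rw [norm_pos_iff]
  intro h
  have := z_re χ t
  rw [h] at this
  have h0 : (0:RR) ≤ Xia χ := by positivity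
  simp at this; linarith

lemma Dt_le_low {χ : DC q} (hχ : χ.IsPrimitive) {T t : RR} (hT : 100 ≤ T)
    (ht : |t| ≤ T) : Dt χ t ≤ LG (q * T) + 5.3 := by
  have hq : (0:RR) < q := by exact_mod_cast NeZero.pos q
  have h0 : (0:RR) ≤ Xia χ := by positivity
  rw [Dt_eq hχ, Real.log_mul hq.ne' bL]
  have h1 := re_digamma_le_one (z := (2 + t*I + Xia χ)/2) (by rw [z_re]; linarith)
  have h2 : LG ‖((2 + t*I + Xia χ)/2 : CC)‖ ≤ LG (T * 0.52) := by
    apply Real.log_le_log (z_norm_pos χ t)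
    refine (z_norm χ t).trans ?_
    have : Real.sqrt (16 + t^2) ≤ 1.04 * T := by
      apply Real.sqrt_le_iff.2 ⟨by linarith, ?_⟩
      have := sq_le_sq' (by linarith [neg_abs_le t]) ((le_abs_self t).trans ht)
      nlinarith
    linarith
  rw [Real.log_mul bL bN] at h2
  have h3 : LG 0.52 ≤ -0.653 := by
    have := lO (show (0:RR) < 1.04 by norm_num)
    rw [show (0.52:RR) = 1.04 / 2 by norm_num, Real.log_div bN bN]
    have := Real.log_two_gt_d9
    linarith
  have h4 : 1.09 ≤ LG PI := by
    have : LG 3 ≤ LG PI := Real.log_le_log bN Real.pi_gt_three.le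
    have h5 : 1.09 ≤ LG 3 := by
      have h6 := Real.log_three_gt_d9
      linarith
    linarith
  have h5 : (logDeriv χ.LFunction (2+t*I)).re ≤ 2 := (Complex.re_le_norm _).trans (norm_logDeriv_L_le χ t)
  have h6 : 2 * Xie q / (1+t^2) ≤ 2 := by
    rw [dI bPq]
    nlinarith [Xie_le q, sq_nonneg t]
  linarith

lemma Dt_le_high {χ : DC q} (hχ : χ.IsPrimitive) {t : RR} (ht : 98.5 ≤ |t|) :
    Dt χ t ≤ LG (q * |t| / (2 * PI)) + 0.022 + 2 * (logDeriv χ.LFunction (2+t*I)).re := by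
  have hq : (0:RR) < q := by exact_mod_cast NeZero.pos q
  have h0 : (0:RR) ≤ Xia χ := by positivity
  have hp := Real.pi_pos
  have ht0 : 0 < |t| := by linarith
  rw [Dt_eq hχ, Real.log_div bPq bPq, Real.log_mul bPq bPq,
    Real.log_mul bPq bPq]
  have h1 := re_digamma_le_inv (z := (2 + t*I + Xia χ)/2) (by rw [z_re]; linarith) (|t|/2) bL
    (by rw [z_im, abs_div]; norm_num)
  have h2 : LG ‖((2 + t*I + Xia χ)/2 : CC)‖ ≤ LG (|t| * (1/2 * (1 + 0.00083))) := by
    apply Real.log_le_log (z_norm_pos χ t)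
    refine (z_norm χ t).trans ?_
    have : Real.sqrt (16 + t^2) ≤ |t| * 1.00083 := by
      apply Real.sqrt_le_iff.2 ⟨by linarith, ?_⟩
      rw [mul_pow, sq_abs, ← sq_abs t]
      nlinarith
    linarith
  rw [Real.log_mul bPq bN, Real.log_mul bPq bN] at h2
  have h3 : LG (1 + 0.00083) ≤ 0.00083 := by
    have := lO (show (0:RR) < 1 + 0.00083 by norm_num); linarith
  have h4 : LG (1/2) = - LG 2 := by simp
  have h6 : 2 * Xie q / (1+t^2) ≤ 0.0003 := by
    rw [dI bPq, ← sq_abs t]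
    nlinarith [Xie_le q]
  have h7 : 1 / (|t|/2) ≤ 0.02031 := by
    rw [dI bPq]; linarith
  linarith

end BoundD

section GaussE
open Complex Filter Topology

/-- integrand -/
noncomputable def gk (c b : CC) (t : RR) : CC := cexp (-(c*t^2/2) + b*t)

noncomputable def Gk (c b s : CC) : CC := ∫ t in Ip, gk c b t * (t:CC)^(s-1)

lemma gk_norm (c b : CC) (t : RR) : ‖gk c b t‖ = EX (-(c.re*t^2/2) + b.re*t) := by
  rw [gk, Complex.norm_exp]
  congr 1
  simp [← Complex.ofReal_pow]

lemma gk_term_norm (c b s : CC) {t : RR} (ht : 0 < t) :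
    ‖gk c b t * (t:CC)^(s-1)‖ = EX (-(c.re*t^2/2) + b.re*t) * t^(s.re-1) := by
  rw [norm_mul, gk_norm, cR ht]
  simp

lemma gk_cont (c b : CC) : Continuous (gk c b) := by
  unfold gk; fun_prop

lemma cpow_contOn (s : CC) : ContinuousOn (fun t : RR => (t:CC)^s) (Ioi 0) := by
  intro t ht
  exact (Complex.continuousAt_ofReal_cpow_const t s (Or.inr (ne_of_gt ht))).continuousWithinAt

lemma real_gauss_le {κ β t : RR} (hκ : 0 < κ) :
    EX (-(κ*t^2/2) + β*t) ≤ EX (β^2/κ) * EX (-(κ/4) * t^2) := by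
  rw [← eA]
  apply Real.exp_le_exp.2
  have : 0 ≤ (κ*t - 2*β)^2/(4*κ) := by positivity
  have e : (κ*t - 2*β)^2/(4*κ) = κ*t^2/4 - β*t + β^2/κ := by field_simp; ring
  linarith

lemma real_gauss_int {κ : RR} (β : RR) (hκ : 0 < κ) {σ : RR} (hσ : 0 < σ) :
    IntegrableOn (fun t : RR => EX (-(κ*t^2/2) + β*t) * t^(σ-1)) (Ioi 0) := by
  have h := (integrableOn_rpow_mul_exp_neg_mul_sq (b := κ/4) bPq
    (s := σ-1) bL).const_mul (EX (β^2/κ))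
  refine Integrable.mono' h ?_ ?_
  · apply ContinuousOn.aestronglyMeasurable _ mI
    apply ContinuousOn.mul (by fun_prop)
    intro t ht
    exact (Real.continuousAt_rpow_const t _ (Or.inl (ne_of_gt ht))).continuousWithinAt
  · filter_upwards [ae_restrict_mem mI] with t ht
    have ht : 0 < t := ht
    rw [rN bPq]
    have := real_gauss_le (β := β) (t := t) hκ
    have h0 : 0 ≤ t^(σ-1) := by positivity
    nlinarith

lemma gk_aesm (c b s : CC) :
    AEStronglyMeasurable (fun t : RR => gk c b t * (t:CC)^(s-1)) (volume.restrict (Ioi 0)) := by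
  apply ContinuousOn.aestronglyMeasurable _ mI
  exact (gk_cont c b).continuousOn.mul (cpow_contOn _)

lemma gk_int {c : CC} (b : CC) {s : CC} (hc : 0 < c.re) (hs : 0 < s.re) :
    IntegrableOn (fun t : RR => gk c b t * (t:CC)^(s-1)) (Ioi 0) := by
  refine Integrable.mono' (real_gauss_int b.re hc hs) (gk_aesm c b s) ?_
  filter_upwards [ae_restrict_mem mI] with t ht
  rw [gk_term_norm c b s ht]

lemma Gk_norm_le {c b s : CC} :
    ‖Gk c b s‖ ≤ ∫ t in Ip, EX (-(c.re*t^2/2) + b.re*t) * t^(s.re-1) := by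
  refine (norm_integral_le_integral_norm _).trans (le_of_eq ?_)
  refine setIntegral_congr_fun mI fun t ht => gk_term_norm c b s ht

lemma gk_hasDerivAt (c b : CC) (t : RR) : HD (gk c b) ((-(c*t) + b) * gk c b t) t := by
  have h1 : HD (fun z : CC => cexp (-(c*z^2/2) + b*z)) (cexp (-(c*(t:CC)^2/2) + b*t) * (-(c*t)+b)) (t:CC) := by
    apply HasDerivAt.cexp
    have h2 := (((hasDerivAt_id (t:CC)).pow 2).const_mul c).div_const 2
    have h3 := h2.neg.add ((hasDerivAt_id (t:CC)).const_mul b)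
    refine h3.congr_deriv ?_
    simp
    ring
  have h4 := h1.comp_ofReal
  rw [mul_comm]
  exact h4

lemma gauss_tendsto {κ : RR} (β : RR) (hκ : 0 < κ) (σ : RR) :
    Tendsto (fun t : RR => EX (-(κ*t^2/2) + β*t) * t^σ) atTop (𝓝 0) := by
  have h1 : Tendsto (fun t : RR => t^σ * EX (-1 * t)) atTop (𝓝 0) :=
    tendsto_rpow_mul_exp_neg_mul_atTop_nhds_zero σ 1 one_pos
  refine tendsto_of_tendsto_of_tendsto_of_le_of_le' tendsto_const_nhds h1 ?_ ?_
  · filter_upwards [eventually_ge_atTop 0] with t ht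
    positivity
  · filter_upwards [eventually_ge_atTop (2*(|β|+1)/κ), eventually_ge_atTop 0] with t ht h0
    rw [mul_comm]
    apply mLL _ bPq
    apply Real.exp_le_exp.2
    rw [dI hκ] at ht
    have := le_abs_self β
    nlinarith

lemma Gk_rec {c : CC} (b : CC) {s : CC} (hc : 0 < c.re) (hs : 0 < s.re) :
    s * Gk c b s = c * Gk c b (s+2) - b * Gk c b (s+1) := by
  have i0 := gk_int b hc hs
  have i1 := gk_int b hc (s := s+1) (by simp; linarith)
  have i2 := gk_int b hc (s := s+2) (by simp; linarith)
  have hs0 : s ≠ 0 := by rintro rfl; simp at hs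
  have key := integral_Ioi_of_hasDerivAt_of_tendsto (a := (0:RR)) (m := 0)
    (f := fun t : RR => gk c b t * (t:CC)^s)
    (f' := fun t => s * (gk c b t * (t:CC)^(s-1)) + b * (gk c b t * (t:CC)^(s+1-1)) - c * (gk c b t * (t:CC)^(s+2-1)))
    ?_ ?_ ?_ ?_
  · rw [integral_sub, integral_add, iC, iC, iC] at key
    · simp only [Complex.ofReal_zero, Complex.zero_cpow hs0, mul_zero, sub_zero] at key
      unfold Gk
      linear_combination key
    · exact i0.const_mul s
    · exact i1.const_mul b
    · exact (i0.const_mul s).add (i1.const_mul b)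
    · exact i2.const_mul c
  · apply ContinuousAt.continuousWithinAt
    apply (gk_cont c b).continuousAt.mul
    exact (Complex.continuous_ofReal_cpow_const hs).continuousAt
  · intro t ht
    have ht : 0 < t := ht
    have h1 := (gk_hasDerivAt c b t).mul (hasDerivAt_ofReal_cpow_const ht.ne' hs0)
    have htc : (t:CC) ≠ 0 := by exact_mod_cast ht.ne'
    refine h1.congr_deriv ?_
    have e1 : (t:CC)^(s+1-1) = (t:CC)^(s-1) * t := by
      rw [show s+1-1 = (s - 1) + 1 by ring, Complex.cpow_add _ _ htc, Complex.cpow_one]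
    have e2 : (t:CC)^(s+2-1) = (t:CC)^(s-1) * t * t := by
      rw [show s+2-1 = (s - 1) + 1 + 1 by ring, Complex.cpow_add _ _ htc, Complex.cpow_add _ _ htc, Complex.cpow_one]
    have e3 : (t:CC)^s = (t:CC)^(s-1) * t := by
      rw [Complex.cpow_sub _ _ htc, Complex.cpow_one]; field_simp
    rw [e1, e2, e3]
    ring
  · exact ((i0.const_mul s).add (i1.const_mul b)).sub (i2.const_mul c)
  · rw [tendsto_zero_iff_norm_tendsto_zero]
    refine (gauss_tendsto b.re hc s.re).congr' ?_
    filter_upwards [eventually_gt_atTop 0] with t ht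
    rw [norm_mul, gk_norm, cR ht]

/-- fast decay on vertical lines -/
lemma Gk_decay {c : CC} (b : CC) (hc : 0 < c.re) (n : ℕ) : ∀ σ : RR, 0 < σ →
    ∃ C, ∀ s : CC, s.re = σ → ‖s‖^n * ‖Gk c b s‖ ≤ C := by
  induction n with
  | zero =>
    intro σ hσ
    refine ⟨∫ t in Ip, EX (-(c.re*t^2/2) + b.re*t) * t^(σ-1), fun s hs => ?_⟩
    rw [pow_zero, one_mul, ← hs]
    exact Gk_norm_le
  | succ n ih =>
    intro σ hσ
    obtain ⟨C1, h1⟩ := ih (σ+1) bL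
    obtain ⟨C2, h2⟩ := ih (σ+2) bL
    refine ⟨‖c‖ * C2 + ‖b‖ * C1, fun s hs => ?_⟩
    have hs' : 0 < s.re := by linarith
    have le : ∀ k : RR, 0 ≤ k → ‖s‖ ≤ ‖s + k‖ := by
      intro k hk
      rw [Complex.norm_def, Complex.norm_def]
      apply Real.sqrt_le_sqrt
      simp only [Complex.normSq_apply, Complex.add_re, Complex.add_im, Complex.ofReal_re, Complex.ofReal_im]
      nlinarith
    have l1 := le 1 bN
    have l2 := le 2 bN
    push_cast at l1 l2
    have := h1 (s+1) (by simp [hs])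
    have := h2 (s+2) (by simp [hs])
    calc ‖s‖^(n+1) * ‖Gk c b s‖ = ‖s‖^n * ‖s * Gk c b s‖ := by rw [norm_mul]; ring
      _ = ‖s‖^n * ‖c * Gk c b (s+2) - b * Gk c b (s+1)‖ := by rw [Gk_rec b hc hs']
      _ ≤ ‖s‖^n * (‖c * Gk c b (s+2)‖ + ‖b * Gk c b (s+1)‖) := by gcongr; exact norm_sub_le _ _
      _ = ‖c‖ * (‖s‖^n * ‖Gk c b (s+2)‖) + ‖b‖ * (‖s‖^n * ‖Gk c b (s+1)‖) := by
          rw [norm_mul, norm_mul]; ring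
      _ ≤ ‖c‖ * (‖s+2‖^n * ‖Gk c b (s+2)‖) + ‖b‖ * (‖s+1‖^n * ‖Gk c b (s+1)‖) := by gcongr
      _ ≤ _ := by gcongr

end GaussE

section MellinE
open Complex Filter Topology

lemma Gk_line_cont {c : CC} (b : CC) (hc : 0 < c.re) : Continuous fun t : RR => Gk c b (3 + t * I) := by
  unfold Gk
  refine continuous_of_dominated (bound := fun t : RR => EX (-(c.re*t^2/2) + b.re*t) * t^((3:RR)-1))
    (fun t => gk_aesm c b _) ?_ (real_gauss_int b.re hc bN) ?_
  · intro t
    filter_upwards [ae_restrict_mem mI] with u hu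
    rw [gk_term_norm c b _ hu]
    simp
  · filter_upwards [ae_restrict_mem mI] with u hu
    have hu : 0 < u := hu
    have : (u:CC) ≠ 0 := by exact_mod_cast hu.ne'
    apply continuous_const.mul
    apply Continuous.const_cpow (by fun_prop)
    exact Or.inl this

lemma exists_W {c : CC} (b : CC) (hc : 0 < c.re) {x : RR} (hx : 0 < x) :
    ∃ W : RR → CC, Continuous W ∧ Integrable (fun t : RR => (1+t^2)*‖W t‖) ∧
      ∀ y : RR, 0 < y → ∫ t, W t * (y:CC)^(-(3+t*I)) = gk c b (y/x) := by
  obtain ⟨C, hC⟩ := Gk_decay b hc 4 3 bN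
  have hcont := Gk_line_cont b hc
  have hGb : ∀ t : RR, (1+t^2)^2 * ‖Gk c b (3 + t*I)‖ ≤ C := by
    intro t
    refine le_trans ?_ (hC (3+t*I) bS)
    gcongr
    have : ‖(3 + t*I : CC)‖^2 = 9 + t^2 := by
      rw [← Complex.normSq_eq_norm_sq, Complex.normSq_apply]; simp; ring
    rw [show ‖(3 + t*I : CC)‖^4 = (‖(3 + t*I : CC)‖^2)^2 by ring, this]
    gcongr; norm_num
  have hGint : Integrable (fun t : RR => (1+t^2) * ‖Gk c b (3 + t*I)‖) := by
    refine Integrable.mono' (integrable_inv_one_add_sq.const_mul C) (by fun_prop) ?_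
    filter_upwards with t
    rw [rN bPq, ← div_eq_mul_inv, lI bPq]
    have := hGb t
    nlinarith
  have hxc : (x:CC) ≠ 0 := by exact_mod_cast hx.ne'
  refine ⟨fun t => (1/(2*PI) : RR) * ((x:CC)^(3+t*I) * Gk c b (3+t*I)), ?_, ?_, ?_⟩
  · apply continuous_const.mul
    apply Continuous.mul _ hcont
    exact Continuous.const_cpow (by fun_prop) (Or.inl hxc)
  · have := hGint.const_mul ((1/(2*PI)) * x^(3:RR))
    refine this.congr ?_
    filter_upwards with t
    rw [norm_mul, norm_mul, cR hx, cN,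
      rN bPq]
    simp
    ring
  · intro y hy
    have hm : ∀ s, mellin (gk c b) s = Gk c b s := by
      intro s
      unfold mellin Gk
      simp only [smul_eq_mul, mul_comm]
    have hyx : 0 < y/x := by positivity
    have key := mellinInv_mellin_eq 3 (gk c b) hyx (by
      have := gk_int b hc (s := 3) bN
      unfold MellinConvergent
      simpa only [smul_eq_mul, mul_comm, Complex.ofReal_ofNat] using this) (by
      unfold Complex.VerticalIntegrable
      simp only [hm]
      refine Integrable.mono' hGint ?_ ?_
      · exact hcont.aestronglyMeasurable
      · filter_upwards with t
        push_cast
        have := norm_nonneg (Gk c b (3 + t*I))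
        nlinarith [sq_nonneg t]) (gk_cont c b).continuousAt
    rw [← key, mellinInv]
    rw [← integral_smul]
    congr 1
    ext t
    simp only [hm, smul_eq_mul]
    push_cast
    have hyc : (y:CC) ≠ 0 := by exact_mod_cast hy.ne'
    rw [show ((y:CC)/x) = (y:CC) * ((x⁻¹:RR):CC) by push_cast; rw [div_eq_mul_inv],
      Complex.mul_cpow_ofReal_nonneg hy.le bPq]
    have : (((x⁻¹:RR):CC))^(-(3+t*I)) = (x:CC)^(3+t*I) := by
      push_cast
      rw [Complex.inv_cpow _ _ (by rw [Complex.arg_ofReal_of_nonneg hx.le]; exact Real.pi_pos.ne), Complex.cpow_neg, inv_inv]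
    rw [this]
    simp [Complex.real_smul]
    ring

end MellinE

section ExplicitE
set_option linter.unusedVariables false
open Complex Filter Topology

lemma hasSum_of_eq {ι : Type*} {f g : ι → CC} {a : CC} (h : ∀ b, f b = g b) (hg : HasSum g a) : HasSum f a := by
  rw [funext h]; exact hg

lemma W_int {W : RR → CC} (hWc : Continuous W) (hW : Integrable (fun t : RR => (1+t^2)*‖W t‖)) {H : RR → CC}
    (hH : AEStronglyMeasurable H) {C : RR} (hb : ∀ t, ‖H t‖ ≤ C * (1+t^2)) :
    Integrable (fun t => W t * H t) := by
  refine Integrable.mono' (hW.const_mul C) (hWc.aestronglyMeasurable.mul hH) ?_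
  filter_upwards with t
  rw [norm_mul]
  have := hb t
  have h0 := norm_nonneg (W t)
  nlinarith

lemma hasSum_int_W {W : RR → CC} (hWc : Continuous W) (hW : Integrable (fun t : RR => (1+t^2)*‖W t‖))
    {ι : Type*} (Z : Set ι) (hZ : Z.Countable) (h : ι → RR → CC) (m : ι → RR) (hm : Summable m)
    (hm0 : ∀ i, 0 ≤ m i)
    (h0 : ∀ i, i ∉ Z → ∀ t, h i t = 0) (hc : ∀ i, Continuous (h i)) (C : RR) (hC : 0 ≤ C)
    (hb : ∀ i t, ‖h i t‖ ≤ m i * (C * (1+t^2)))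
    (H : RR → CC) (hs : ∀ t, HasSum (fun i => h i t) (H t)) :
    Integrable (fun t => W t * H t) ∧ HasSum (fun i => ∫ t, W t * h i t) (∫ t, W t * H t) := by
  have : Countable Z := hZ.to_subtype
  have hs' : ∀ t, HasSum (fun i : Z => h i t) (H t) := by
    intro t
    refine (hasSum_subtype_iff_of_support_subset (f := fun i => h i t) (s := Z) ?_).2 (hs t)
    intro i hi; by_contra hn; exact hi (h0 i hn t)
  have hHm : AEStronglyMeasurable H := by
    refine aestronglyMeasurable_of_tendsto_ae (u := atTop)
      (f := fun (F : Finset Z) t => ∑ i ∈ F, h i t) (fun F => ?_) (eF fun t => hs' t)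
    exact (continuous_finsetSum F fun (i : Z) _ => hc i).aestronglyMeasurable
  have hHb : ∀ t, ‖H t‖ ≤ (∑' i, m i) * C * (1+t^2) := by
    intro t
    rw [← (hs t).tsum_eq, mul_assoc]
    exact tsum_of_norm_bounded (hm.hasSum.mul_right _) (fun i => hb i t)
  refine ⟨W_int hWc hW hHm hHb, ?_⟩
  have e : ∀ t, W t * H t = ∑' i : Z, W t * h i t := by
    intro t
    rw [tsum_mul_left, (hs' t).tsum_eq]
  have key := hasSum_integral_of_summable_integral_norm (μ := volume) (F := fun (i : Z) t => W t * h i t)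
    (fun i => W_int hWc hW (hc i).aestronglyMeasurable (C := m i * C) (fun t => by rw [mul_assoc]; exact hb i t)) (by
      refine Summable.of_nonneg_of_le (fun i => integral_nonneg fun t => norm_nonneg _) (fun i => ?_)
        ((hm.subtype Z).mul_left (C * ∫ t : RR, (1+t^2)*‖W t‖))
      have i1 := (W_int hWc hW (hc i).aestronglyMeasurable (C := m i * C) (fun t => by rw [mul_assoc]; exact hb i t)).norm
      have i2 := hW.const_mul (m i * C)
      have := integral_mono i1 i2 (fun t => by
        simp only [norm_mul]
        have := hb i t
        have h0 := norm_nonneg (W t)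
        nlinarith)
      refine this.trans (le_of_eq ?_)
      rw [iC]
      simp only [Function.comp]
      ring)
  simp only [← e] at key
  refine (hasSum_subtype_iff_of_support_subset (f := fun i => ∫ t, W t * h i t) (s := Z) ?_).1 key
  intro i hi; by_contra hn; exact hi (by simp [h0 i hn])

lemma W_pole {W : RR → CC} (hWc : Continuous W) (hW : Integrable (fun t : RR => (1+t^2)*‖W t‖)) {f : RR → CC}
    (hf : ∀ y : RR, 0 < y → ∫ t, W t * (y:CC)^(-(3+t*I)) = f y) {ρ : CC} (hρ : ρ.re < 3) :
    ∫ t : RR, W t * (1/(3+t*I-ρ)) = ∫ y in Ioi (1:RR), f y * (y:CC)^(ρ-1) := by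
  have hWi : Integrable W := by
    refine Integrable.mono' hW hWc.aestronglyMeasurable ?_
    filter_upwards with t
    nlinarith [norm_nonneg (W t), sq_nonneg t]
  have h1 : ∀ t : RR, W t * (1/(3+t*I-ρ)) = ∫ y in Ioi (1:RR), W t * (y:CC)^(ρ-1-(3+t*I)) := by
    intro t
    rw [iC, integral_Ioi_cpow_of_lt (by simp; linarith) one_pos]
    simp only [Complex.ofReal_one, Complex.one_cpow]
    congr 1
    rw [show ρ - 1 - (3+t*I) + 1 = -(3+t*I-ρ) by ring, neg_div_neg_eq]
  have h2 : ∀ y ∈ Ioi (1:RR), f y * (y:CC)^(ρ-1) = ∫ t : RR, W t * (y:CC)^(ρ-1-(3+t*I)) := by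
    intro y hy
    have hy0 : 0 < y := one_pos.trans hy
    have hyc : (y:CC) ≠ 0 := by exact_mod_cast hy0.ne'
    rw [← hf y hy0, ← integral_mul_const]
    congr 1
    ext t
    rw [mul_assoc, ← Complex.cpow_add _ _ hyc]
    ring_nf
  rw [setIntegral_congr_fun mI h2]
  simp_rw [h1]
  rw [integral_integral_swap]
  have hd : IntegrableOn (fun y : RR => y^(ρ.re-4)) (Ioi 1) := iR bL one_pos
  refine Integrable.mono' (hWi.norm.mul_prod hd) ?_ ?_
  · apply AEStronglyMeasurable.mul
    · exact hWi.aestronglyMeasurable.comp_fst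
    · apply Measurable.aestronglyMeasurable
      apply Measurable.pow
      · fun_prop
      · fun_prop
  · have : ∀ᵐ p : RR × RR ∂(volume.prod (volume.restrict (Ioi 1))), p.2 ∈ Ioi (1:RR) := by
      apply Measure.quasiMeasurePreserving_snd.ae
      exact ae_restrict_mem mI
    filter_upwards [this] with p hp
    simp only [Function.uncurry]
    rw [norm_mul, cR (one_pos.trans hp)]
    apply le_of_eq
    congr 2
    simp; ring

variable {q : ℕ} [NeZero q]

lemma zeros_countable {χ : DC q} (hχ : χ.IsPrimitive) :
    {ρ : CC | Xi χ ρ = 0}.Countable := by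
  have : {ρ : CC | Xi χ ρ = 0} ⊆ ⋃ n : ℕ, (SZ hχ n : Set CC) := by
    intro ρ hρ
    obtain ⟨n, hn⟩ := exists_nat_ge (dist ρ 2)
    exact mem_iUnion.2 ⟨n, by rw [Finset.mem_coe, mem_SZ]; exact ⟨hn, hρ⟩⟩
  exact (countable_iUnion fun n : ℕ => (SZ hχ n).countable_toSet).mono this

noncomputable def If (f : RR → CC) (ρ : CC) : CC := ∫ y in Ioi (1:RR), f y * (y:CC)^(ρ-1)

lemma line_ne {ρ : CC} (hρ : ρ.re < 3) (t : RR) : (3 + t*I - ρ : CC) ≠ 0 := by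
  intro h
  have := congrArg Complex.re h
  simp at this; linarith

lemma line_cont {ρ : CC} (hρ : ρ.re < 3) : Continuous fun t : RR => 1/(3+t*I-ρ) :=
  Continuous.div continuous_const (by fun_prop) (line_ne hρ)

theorem explicit_formula {χ : DC q} (hχ : χ.IsPrimitive) {W : RR → CC} (hWc : Continuous W)
    (hW : Integrable (fun t : RR => (1+t^2)*‖W t‖)) {f : RR → CC}
    (hf : ∀ y : RR, 0 < y → ∫ t, W t * (y:CC)^(-(3+t*I)) = f y) :
    ∃ S P Q : CC, HasSum (fun n : ℕ => (vM n : CC) * χ n * f n) S ∧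
      HasSum (fun ρ : CC => (mz χ ρ : CC) * (f 1 / (2 - ρ) - If f ρ)) P ∧
      HasSum (fun k : ℕ => f 1 / (2 + Xia χ + 2 * k) - If f (-(Xia χ + 2 * k))) Q ∧
      S = P + Q + Xie q * (If f 1 - f 1) - logDeriv χ.LFunction 2 * f 1 := by
  have hWi : Integrable W := by
    refine Integrable.mono' hW hWc.aestronglyMeasurable ?_
    filter_upwards with t
    nlinarith [norm_nonneg (W t), sq_nonneg t]
  have hf1 : ∫ t, W t = f 1 := by
    have := hf 1 one_pos
    simpa using this
  have hpole : ∀ ρ : CC, ρ.re < 3 → Integrable (fun t : RR => W t * (1/(3+t*I-ρ))) := by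
    intro ρ hρ
    refine W_int hWc hW (line_cont hρ).aestronglyMeasurable (C := 1/(3-ρ.re)) fun t => ?_
    have h1 : 3 - ρ.re ≤ ‖(3+t*I-ρ : CC)‖ := by
      refine le_trans (le_of_eq ?_) (Complex.re_le_norm _)
      simp
    have h2 : 0 < 3 - ρ.re := by linarith
    rw [norm_div, norm_one]
    calc 1 / ‖(3+t*I-ρ : CC)‖ ≤ 1/(3-ρ.re) := by gcongr
      _ ≤ 1/(3-ρ.re) * (1+t^2) := by
        apply le_mul_of_one_le_right bPq; nlinarith [sq_nonneg t]
  have hlin : ∀ ρ : CC, ρ.re < 3 → ∀ c : CC, ∫ t : RR, W t * (c - 1/(3+t*I-ρ)) = f 1 * c - If f ρ := by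
    intro ρ hρ c
    simp_rw [mul_sub]
    rw [integral_sub (hWi.mul_const c) (hpole ρ hρ), integral_mul_const, hf1, W_pole hWc hW hf hρ, If]
  have hs3 : ∀ t : RR, ((3:CC) + t*I).re = 3 := by intro t; simp
  -- primes
  have A1 := hasSum_int_W hWc hW (univ : Set ℕ) (countable_univ)
    (fun n t => (vM n : CC) * χ n * (n:CC)^(-(3+t*I)))
    (fun n => vM n / (n:RR)^2) vm_summable
    (fun n => div_nonneg vN bPq)
    (fun n hn => absurd (mem_univ n) hn) (fun n => by
      rcases Nat.eq_zero_or_pos n with rfl | hn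
      · simp; exact continuous_const
      apply continuous_const.mul
      exact Continuous.const_cpow (by fun_prop) (Or.inl (by exact_mod_cast hn.ne'))) 1 zO
    (fun n t => by
      rcases Nat.eq_zero_or_pos n with rfl | hn
      · simp
      have h1 := norm_term_le χ 0 n
      have h2 : (1:RR) ≤ n := by exact_mod_cast hn
      have h3 : ‖(n:CC)^(-(3+t*I))‖ ≤ ‖(n:CC)^(-(2+((0:RR):CC)*I))‖ := by
        rw [Complex.norm_natCast_cpow_of_pos hn, Complex.norm_natCast_cpow_of_pos hn]
        apply rE h2
        simp; norm_num
      rw [norm_mul] at h1 ⊢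
      have h4 : 0 ≤ vM n / (n:RR)^2 :=
        div_nonneg vN bPq
      calc _ ≤ ‖(vM n : CC) * χ n‖ * ‖(n:CC)^(-(2+((0:RR):CC)*I))‖ := by gcongr
        _ ≤ _ := h1
        _ ≤ _ := by apply le_mul_of_one_le_right h4; nlinarith [sq_nonneg t])
    (fun t => -logDeriv χ.LFunction (3+t*I)) (fun t => L_hasSum χ (by rw [hs3]; norm_num))
  -- zeros
  have A2 := hasSum_int_W hWc hW _ (zeros_countable hχ)
    (fun ρ t => (mz χ ρ:CC)*(1/(3+t*I-ρ)-1/(2-ρ)))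
    (fun ρ => mz χ ρ * (1/‖2-ρ‖^2)) (summable_mz hχ)
    (fun ρ => mul_nonneg (mz_nonneg _ _) bPq)
    (fun ρ hρ t => by rw [mz_eq_zero hχ hρ]; simp) (fun ρ => by
      by_cases h : mz χ ρ = 0
      · simp only [h, Complex.ofReal_zero, zero_mul]; exact continuous_const
      exact continuous_const.mul ((line_cont (by linarith [(mz_re hχ h).2])).sub continuous_const)) 2 zero_le_two
    (fun ρ t => by
      by_cases h : mz χ ρ = 0
      · simp [h]
      rw [norm_mul, cN, rN (mz_nonneg _ _), mul_assoc]
      apply mLL _ (mz_nonneg _ _)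
      refine (hadamard_term_bound (hs3 t) (mz_re hχ h).2).trans ?_
      rw [mul_comm]
      apply mLL _ bPq
      have e : ‖(3 + t*I - 2 : CC)‖^2 = 1 + t^2 := by
        rw [← Complex.normSq_eq_norm_sq, Complex.normSq_apply]; simp; ring
      have h0 := norm_nonneg (3 + t*I - 2 : CC)
      nlinarith [sq_nonneg (‖(3 + t*I - 2 : CC)‖ - 1), sq_nonneg t])
    (fun t => logDeriv (Xi χ) (3+t*I) - logDeriv (Xi χ) 2) (fun t => hasSum_hadamard hχ (hs3 t))
  have ha0 : (0:RR) ≤ Xia χ := by positivity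
  have hre : ∀ k : ℕ, (-((Xia χ:CC) + 2 * k)).re < 3 := by
    intro k
    have : (0:RR) ≤ k := by positivity
    simp; linarith
  -- trivial zeros
  have A3 := hasSum_int_W hWc hW (univ : Set ℕ) (countable_univ)
    (fun k t => 1/(2 + (Xia χ:CC) + 2 * k) - 1/(3+t*I - (-((Xia χ:CC) + 2 * k))))
    (fun k : ℕ => 1/((k+1:ℕ):RR)^2) ((summable_nat_add_iff (f := fun k : ℕ => 1/(k:RR)^2) 1).2
      (Real.summable_one_div_nat_pow.2 bN))
    (fun n => by positivity)
    (fun n hn => absurd (mem_univ n) hn) (fun k => continuous_const.sub (line_cont (hre k))) 1 zO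
    (fun k t => by
      have hk : (0:RR) ≤ k := by positivity
      have n1 : (2 + (Xia χ:CC) + 2 * k) = ((2 + Xia χ + 2*k : RR):CC) := by push_cast; ring
      have p1 : 0 < (2 + Xia χ + 2*k : RR) := by positivity
      have n2 := line_ne (hre k) t
      have n3 : (2 + (Xia χ:CC) + 2 * k) ≠ 0 := by rw [n1]; exact_mod_cast p1.ne'
      rw [div_sub_div _ _ n3 n2, norm_div, norm_mul]
      have b1 : ((k:RR)+1) ≤ ‖(2 + (Xia χ:CC) + 2 * k)‖ := by
        rw [n1, cN, rN p1.le]; linarith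
      have b2 : ((k:RR)+1) ≤ ‖(3+t*I - (-((Xia χ:CC) + 2 * k)))‖ := by
        refine le_trans ?_ (Complex.re_le_norm _)
        simp; linarith
      have b3 : ‖1 * (3+t*I - (-((Xia χ:CC) + 2 * k))) - (2 + (Xia χ:CC) + 2 * k) * 1‖ ≤ 1 + t^2 := by
        rw [show 1 * (3+t*I - (-((Xia χ:CC) + 2 * k))) - (2 + (Xia χ:CC) + 2 * k) * 1 = 1 + t*I by ring]
        have e : ‖(1 + t*I : CC)‖^2 = 1 + t^2 := by
          rw [← Complex.normSq_eq_norm_sq, Complex.normSq_apply]; simp; ring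
        have := norm_nonneg (1 + t*I : CC)
        nlinarith [sq_nonneg t]
      rw [one_div_mul_eq_div, one_mul (1+t^2)]
      refine div_le_div₀ bPq b3 bPq ?_
      push_cast
      rw [sq]
      exact mul_le_mul b1 b2 bPq (norm_nonneg _))
    (fun t => (1/2) * (digamma ((3+t*I+Xia χ)/2) - digamma ((2+Xia χ)/2))) (fun t => by
      have := digamma_sub_hasSum (s := (3+t*I+Xia χ)/2) (s0 := (2+Xia χ)/2) (by simp; linarith) (by simp; linarith)
      have h2 := this.mul_left (1/2)
      refine hasSum_of_eq (fun k => ?_) h2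
      have hk : (0:RR) ≤ k := by positivity
      have n1 : (2 + (Xia χ:CC) + 2 * k) ≠ 0 := by
        have p1 : 0 < (2 + Xia χ + 2*k : RR) := by positivity
        exact_mod_cast p1.ne'
      have n2 := line_ne (hre k) t
      rw [show (2 + (Xia χ:CC))/2 + k = (2 + (Xia χ:CC) + 2 * k)/2 by ring,
        show (3 + t*I + (Xia χ:CC))/2 + k = (3+t*I - (-((Xia χ:CC) + 2 * k)))/2 by ring]
      field_simp)
  have X2 := Xi_logDeriv hχ (s := 2) bN
  have eq : ∀ t : RR, W t * -logDeriv χ.LFunction (3+t*I) =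
      -(W t * (logDeriv (Xi χ) (3+t*I) - logDeriv (Xi χ) 2)) +
      W t * ((1/2) * (digamma ((3+t*I+Xia χ)/2) - digamma ((2+Xia χ)/2))) +
      (-(Xie q:CC)) * (W t * (1 - 1/(3+t*I-1))) - W t * logDeriv χ.LFunction 2 := by
    intro t
    have X3 := Xi_logDeriv hχ (s := 3+t*I) (by rw [hs3]; norm_num)
    rw [X3, X2]
    ring
  have hone : (1:CC).re < 3 := by norm_num
  have I3 : Integrable (fun t : RR => W t * (1 - 1/(3+t*I-1))) := by
    simp_rw [mul_sub]
    exact (hWi.mul_const 1).sub (hpole 1 hone)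
  refine ⟨∫ t : RR, W t * -logDeriv χ.LFunction (3+t*I), -∫ t, W t * (logDeriv (Xi χ) (3+t*I) - logDeriv (Xi χ) 2),
    ∫ t : RR, W t * ((1/2) * (digamma ((3+t*I+Xia χ)/2) - digamma ((2+Xia χ)/2))), ?_, ?_, ?_, ?_⟩
  · refine hasSum_of_eq (fun n => ?_) A1.2
    rcases Nat.eq_zero_or_pos n with rfl | hn
    · simp
    rw [← hf n (by exact_mod_cast hn), ← iC]
    congr 1
    ext t
    push_cast
    ring
  · refine hasSum_of_eq (fun ρ => ?_) A2.2.neg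
    by_cases h : mz χ ρ = 0
    · simp [h]
    have := hlin ρ (by linarith [(mz_re hχ h).2]) (1/(2-ρ))
    rw [mul_one_div] at this
    rw [← this, ← iC, ← integral_neg]
    congr 1
    ext t
    ring
  · refine hasSum_of_eq (fun k => ?_) A3.2
    rw [hlin _ (hre k), mul_one_div]
  · simp_rw [eq]
    rw [integral_sub, integral_add, integral_add, integral_neg, iC, integral_mul_const, hf1,
      hlin 1 hone 1]
    · ring
    · exact A2.1.neg
    · exact A3.1
    · exact A2.1.neg.add A3.1
    · exact I3.const_mul _
    · exact (A2.1.neg.add A3.1).add (I3.const_mul _)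
    · exact hWi.mul_const _

end ExplicitE

section LocalE
open Complex Filter Topology

/-- the weight -/
noncomputable def fw (c d : RR) (y : RR) : CC := gk (c:CC) (d * I) y

lemma fw_norm (c d y : RR) : ‖fw c d y‖ = EX (-(c*y^2/2)) := by
  rw [fw, gk_norm]; simp

lemma fw_norm_le {c : RR} (hc : 0 < c) (d y : RR) : ‖fw c d y‖ ≤ 1 := by
  rw [fw_norm]; apply Real.exp_le_one_iff.2
  have : 0 ≤ c*y^2/2 := by positivity
  linarith

lemma fw_cont (c d : RR) : Continuous (fw c d) := gk_cont _ _

noncomputable def fp (c d y : RR) : CC := -(c*y) + d*I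

lemma fw_deriv (c d y : RR) : HD (fw c d) (fp c d y * fw c d y) y := by
  have := gk_hasDerivAt (c:CC) (d*I) y
  exact this

lemma fp_deriv (c d y : RR) : HD (fp c d) (-(c:CC)) y := by
  have h1 : HD (fun y : RR => ((y:RR):CC)) 1 y := (hasDerivAt_id (y:CC)).comp_ofReal
  have := ((h1.const_mul (c:CC)).neg).add_const ((d:CC)*I)
  refine this.congr_deriv ?_
  simp

lemma fp_cont (c d : RR) : Continuous (fp c d) := by
  unfold fp; fun_prop

lemma fp_norm_le {c d y : RR} (hc : 0 < c) (hc' : c ≤ 0.01) (hd : |d| ≤ 0.01) (hy : 0 ≤ y) (hy' : y ≤ 1) :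
    ‖fp c d y‖ ≤ 0.02 := by
  unfold fp
  refine (norm_add_le _ _).trans ?_
  rw [norm_neg, norm_mul, norm_mul, Complex.norm_I, cN, cN, cN,
    rN hc.le, rN hy, Real.norm_eq_abs]
  nlinarith

lemma unit_int {g : RR → CC} (hg : Continuous g) {s : CC} (hs : 0 < s.re) :
    IntervalIntegrable (fun y : RR => g y * (y:CC)^(s-1)) volume 0 1 := by
  have := (intervalIntegral.intervalIntegrable_cpow' (a := 0) (b := 1) (r := s-1) (by simp; linarith))
  exact this.continuousOn_mul hg.continuousOn

lemma unit_bound {g : RR → CC} {C : RR} (hC : 0 ≤ C) (hb : ∀ y ∈ Icc (0:RR) 1, ‖g y‖ ≤ C) {s : CC} (hs : 1 ≤ s.re) :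
    ‖∫ y in (0:RR)..1, g y * (y:CC)^(s-1)‖ ≤ C := by
  have := intervalIntegral.norm_integral_le_of_norm_le_const (a := (0:RR)) (b := 1) (C := C)
    (f := fun y : RR => g y * (y:CC)^(s-1)) (fun y hy => by
      rw [uIoc_of_le zO] at hy
      rw [norm_mul, cR hy.1]
      have h1 := hb y ⟨hy.1.le, hy.2⟩
      have h2 : y^(s-1).re ≤ 1 := Real.rpow_le_one hy.1.le hy.2 (by simp; linarith)
      calc _ ≤ C * 1 := mul_le_mul h1 h2 (Real.rpow_nonneg hy.1.le _) hC
        _ = C := mul_one C)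
  simpa using this

lemma J_formula {c d : RR} {ρ : CC} (hρ : 0 < ρ.re) :
    ∫ y in (0:RR)..1, fw c d y * (y:CC)^(ρ-1) =
      fw c d 1 / ρ - fp c d 1 * fw c d 1 / (ρ*(ρ+1)) +
        (1/(ρ*(ρ+1))) * ∫ y in (0:RR)..1, ((fp c d y^2 - c) * fw c d y) * (y:CC)^(ρ+2-1) := by
  have h0 : ρ ≠ 0 := by rintro rfl; simp at hρ
  have h1 : ρ + 1 ≠ 0 := by
    intro h; have := congrArg Complex.re h; simp at this; linarith
  have c2 : Continuous fun y => (fp c d y^2 - c) * fw c d y :=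
    (((fp_cont c d).pow 2).sub continuous_const).mul (fw_cont c d)
  have i1 := unit_int (fw_cont c d) hρ
  have i2 := (unit_int c2 (s := ρ+2) (by simp; linarith)).const_mul (1/(ρ*(ρ+1)))
  have key := intervalIntegral.integral_eq_sub_of_hasDerivAt_of_le (a := (0:RR)) (b := 1) zO
    (f := fun y : RR => fw c d y * (y:CC)^ρ * (1/ρ) - (fp c d y * fw c d y) * (y:CC)^(ρ+1) * (1 / (ρ*(ρ+1))))
    (f' := fun y : RR => fw c d y * (y:CC)^(ρ-1) - (1/(ρ*(ρ+1))) * (((fp c d y^2 - c) * fw c d y) * (y:CC)^(ρ+2-1)))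
    ?_ ?_ (i1.sub i2)
  · rw [intervalIntegral.integral_sub i1 i2, intervalIntegral.integral_const_mul] at key
    simp only [Complex.ofReal_one, Complex.one_cpow, Complex.ofReal_zero, Complex.zero_cpow h0, Complex.zero_cpow h1] at key
    rw [sub_eq_iff_eq_add] at key
    rw [key]
    ring
  · apply Continuous.continuousOn
    have k1 := Complex.continuous_ofReal_cpow_const hρ
    have k2 := Complex.continuous_ofReal_cpow_const (y := ρ+1) (by simp; linarith)
    exact (((fw_cont c d).mul k1).mul continuous_const).sub ((((fp_cont c d).mul (fw_cont c d)).mul k2).mul continuous_const)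
  · intro y hy
    have hy0 : y ≠ 0 := hy.1.ne'
    have d1 := ((fw_deriv c d y).mul (hasDerivAt_ofReal_cpow_const hy0 h0)).mul_const (1/ρ)
    have d2 := ((((fp_deriv c d y).mul (fw_deriv c d y))).mul (hasDerivAt_ofReal_cpow_const hy0 h1)).mul_const (1/(ρ*(ρ+1)))
    refine (d1.sub d2).congr_deriv ?_
    have hyc : (y:CC) ≠ 0 := by exact_mod_cast hy0
    have e1 : (y:CC)^ρ = (y:CC)^(ρ-1) * y := by rw [Complex.cpow_sub _ _ hyc, Complex.cpow_one]; field_simp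
    have e2 : (y:CC)^(ρ+1-1) = (y:CC)^(ρ-1) * y := by rw [add_sub_cancel_right, e1]
    have e3 : (y:CC)^(ρ+1) = (y:CC)^(ρ-1) * y * y := by rw [Complex.cpow_add _ _ hyc, Complex.cpow_one, e1]
    have e4 : (y:CC)^(ρ+2-1) = (y:CC)^(ρ-1) * y * y := by rw [show ρ+2-1 = ρ + 1 by ring, e3]
    rw [e4, e3, e2, e1]
    simp only [Pi.mul_apply]
    field_simp
    ring

lemma If_eq {c d : RR} (hc : 0 < c) {ρ : CC} (hρ : 0 < ρ.re) :
    If (fw c d) ρ = Gk c (d*I) ρ - ∫ y in (0:RR)..1, fw c d y * (y:CC)^(ρ-1) := by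
  have hi := gk_int (c := (c:CC)) (d*I) (by simpa using hc) hρ
  have : Gk c (d*I) ρ = (∫ y in (0:RR)..1, fw c d y * (y:CC)^(ρ-1)) + If (fw c d) ρ := by
    unfold Gk If
    rw [intervalIntegral.integral_of_le zO, ← setIntegral_union (Ioc_disjoint_Ioi le_rfl) mI, Ioc_union_Ioi_eq_Ioi zO]
    · rfl
    · exact hi.mono_set Ioc_subset_Ioi_self
    · exact hi.mono_set (Ioi_subset_Ioi zO)
  rw [this]; ring

lemma zero_term {c d : RR} (hc : 0 < c) (hc' : c ≤ 0.0001) (hd : |d| ≤ 0.01) {ρ : CC} (h0 : 0 < ρ.re) (h1 : ρ.re < 1)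
    (h2 : 4 + ρ.im^2 ≤ 16 * ‖ρ‖^2) :
    ‖fw c d 1 / (2 - ρ) - If (fw c d) ρ + Gk c (d*I) ρ‖ ≤ 17 * Kf ρ.re (0 - ρ.im) := by
  have n0 : ρ ≠ 0 := by rintro rfl; simp at h0
  have n1 : ρ + 1 ≠ 0 := by
    intro h; have := congrArg Complex.re h; simp at this; linarith
  have n2 : 2 - ρ ≠ 0 := by
    intro h; have := congrArg Complex.re h; simp at this; linarith
  have c2 : ∀ y ∈ Icc (0:RR) 1, ‖(fp c d y^2 - c) * fw c d y‖ ≤ 0.01 := by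
    intro y hy
    rw [norm_mul]
    have b1 := fw_norm_le hc d y
    have b2 := fp_norm_le hc bL hd hy.1 hy.2
    have b3 : ‖fp c d y^2 - c‖ ≤ 0.01 := by
      refine (norm_sub_le _ _).trans ?_
      rw [norm_pow, cN, rN hc.le]
      nlinarith [norm_nonneg (fp c d y)]
    nlinarith [norm_nonneg (fw c d y), norm_nonneg (fp c d y^2 - c)]
  have J := unit_bound bN c2 (s := ρ+2) (by simp; linarith)
  set JJ := ∫ y in (0:RR)..1, ((fp c d y^2 - c) * fw c d y) * (y:CC)^(ρ+2-1) with hJJ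
  have e : fw c d 1 / (2 - ρ) - If (fw c d) ρ + Gk c (d*I) ρ =
      2 * fw c d 1 / (ρ * (2-ρ)) + (JJ - fp c d 1 * fw c d 1) / (ρ*(ρ+1)) := by
    rw [If_eq hc h0, J_formula h0, ← hJJ]
    field_simp
    ring
  rw [e]
  have b1 := fw_norm_le hc d 1
  have b2 := fp_norm_le hc bL hd zO le_rfl
  have b3 : ‖JJ - fp c d 1 * fw c d 1‖ ≤ 0.03 := by
    refine (norm_sub_le _ _).trans ?_
    rw [norm_mul]
    nlinarith [norm_nonneg (fw c d 1), norm_nonneg (fp c d 1)]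
  set u := ρ.im
  have s1 : 4 + u^2 ≤ 4 * ‖ρ+1‖^2 := by
    rw [← Complex.normSq_eq_norm_sq, Complex.normSq_apply]; simp; nlinarith
  have s2 : 4 + u^2 ≤ 4 * ‖2-ρ‖^2 := by
    rw [← Complex.normSq_eq_norm_sq, Complex.normSq_apply]; simp; nlinarith
  have hu : 0 < 4 + u^2 := by positivity
  have r : ∀ w : CC, 4 + u^2 ≤ 4 * ‖w‖^2 → 4 + u^2 ≤ 8 * (‖ρ‖ * ‖w‖) := by
    intro w hw
    have : (4+u^2)^2 ≤ (8 * (‖ρ‖ * ‖w‖))^2 := by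
      calc (4+u^2)^2 = (4+u^2)*(4+u^2) := by ring
        _ ≤ (16 * ‖ρ‖^2) * (4 * ‖w‖^2) := mul_le_mul h2 hw hu.le bPq
        _ = _ := by ring
    exact abs_le_of_sq_le_sq' this bPq |>.2
  have t1 : ‖2 * fw c d 1 / (ρ * (2-ρ))‖ ≤ 16 / (4+u^2) := by
    rw [norm_div, norm_mul, norm_mul]
    have p : 0 < ‖ρ‖ * ‖2 - ρ‖ := mul_pos (norm_pos_iff.2 n0) (norm_pos_iff.2 n2)
    rw [dD p hu]
    have := r _ s2
    have : ‖(2:CC)‖ = 2 := by simp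
    rw [this]
    nlinarith
  have t2 : ‖(JJ - fp c d 1 * fw c d 1) / (ρ*(ρ+1))‖ ≤ 1 / (4+u^2) := by
    rw [norm_div, norm_mul]
    have p : 0 < ‖ρ‖ * ‖ρ+1‖ := mul_pos (norm_pos_iff.2 n0) (norm_pos_iff.2 n1)
    rw [dD p hu]
    have := r _ s1
    nlinarith
  have t3 : 1 / (4+u^2) ≤ Kf ρ.re (0-u) := by
    unfold Kf
    have q1 : 0 ≤ (1+ρ.re)/((1+ρ.re)^2+(0-u)^2) := by positivity
    have q2 : 1 / (4+u^2) ≤ (2-ρ.re)/((2-ρ.re)^2+(0-u)^2) := by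
      have : 0 < 2 - ρ.re := by linarith
      rw [dD hu bPq]
      nlinarith [sq_nonneg u]
    linarith
  calc _ ≤ 16 / (4+u^2) + 1 / (4+u^2) := (norm_add_le _ _).trans (add_le_add t1 t2)
    _ = 17 * (1 / (4+u^2)) := by ring
    _ ≤ _ := by gcongr

lemma fw_lip {c d : RR} (hc : 0 < c) (hc' : c ≤ 0.0001) (hd : |d| ≤ 0.01) {y : RR} (hy : 1 ≤ y) :
    ‖fw c d 1 - fw c d y‖ ≤ y - 1 := by
  have := Convex.norm_image_sub_le_of_norm_hasDerivWithin_le (f := fw c d) (f' := fun y => fp c d y * fw c d y)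
    (s := Icc 1 y) (C := 1) (fun z _ => (fw_deriv c d z).hasDerivWithinAt) (fun z hz => by
      have hz0 : 0 ≤ z := by linarith [hz.1]
      rw [norm_mul, fw_norm]
      have h1 : ‖fp c d z‖ ≤ c*z + 0.01 := by
        unfold fp
        refine (norm_add_le _ _).trans ?_
        rw [norm_neg, norm_mul, norm_mul, Complex.norm_I, cN, cN, cN,
          rN hc.le, rN hz0, Real.norm_eq_abs]
        linarith
      have h2 : c*z + 0.01 ≤ EX (c*z^2/2) := by
        have := Real.add_one_le_exp (c*z^2/2)
        nlinarith [mul_nonneg hc.le (sq_nonneg (z-1))]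
      rw [Real.exp_neg, ← div_eq_mul_inv, div_le_one (eP _)]
      linarith) (convex_Icc 1 y) (right_mem_Icc.2 hy) (left_mem_Icc.2 hy)
  rw [one_mul, Real.norm_eq_abs, abs_sub_comm, abs_of_nonneg bL] at this
  exact this

end LocalE

section AssembleE
open Complex Filter Topology

lemma triv_ge_two {c d : RR} (hc : 0 < c) (hc' : c ≤ 0.0001) (hd : |d| ≤ 0.01) {b : RR} (hb : 2 ≤ b) :
    ‖fw c d 1 / (2 + b) - If (fw c d) (-b)‖ ≤ 3 / (b * (b-1)) := by
  have i1 : IntegrableOn (fun y : RR => (y:CC)^((-b-3 : RR):CC)) (Ioi 1) :=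
    integrableOn_Ioi_cpow_of_lt (by rw [Complex.ofReal_re]; linarith) one_pos
  have e1 : fw c d 1 / (2 + b) = ∫ y in Ioi (1:RR), fw c d 1 * (y:CC)^((-b-3:RR):CC) := by
    rw [iC, integral_Ioi_cpow_of_lt (by rw [Complex.ofReal_re]; linarith) one_pos]
    push_cast
    rw [Complex.one_cpow, show (-(b:CC)-3+1) = -(2+b) by ring, neg_div_neg_eq, mul_one_div]
  have i2 : IntegrableOn (fun y : RR => fw c d y * (y:CC)^(-(b:CC)-1)) (Ioi 1) := by
    have h1 : IntegrableOn (fun y : RR => (y:CC)^(-(b:CC)-1)) (Ioi 1) :=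
      integrableOn_Ioi_cpow_of_lt (by simp; linarith) one_pos
    refine Integrable.bdd_mul (c := 1) h1 (fw_cont c d).aestronglyMeasurable ?_
    exact eF fun y => fw_norm_le hc d y
  rw [e1, If, ← integral_sub (i1.const_mul _) i2]
  have i3 : IntegrableOn (fun y : RR => 3 * (y^(-b) - y^(-b-1))) (Ioi 1) :=
    ((iR bL one_pos).sub
      (iR bL one_pos)).const_mul 3
  refine (norm_integral_le_of_norm_le i3 ?_).trans (le_of_eq ?_)
  · filter_upwards [ae_restrict_mem mI] with y hy
    have hy : 1 < y := hy
    have hy0 : 0 < y := by linarith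
    have hyc : (y:CC) ≠ 0 := by exact_mod_cast hy0.ne'
    have e2 : (y:CC)^((-b-3:RR):CC) = (y:CC)^(-(b:CC)-1) * ((1/y^2:RR):CC) := by
      push_cast
      rw [show -(b:CC)-3 = (-(b:CC)-1) - (2:ℕ) by push_cast; ring, Complex.cpow_sub _ _ hyc, Complex.cpow_natCast]
      ring
    rw [e2, show fw c d 1 * ((y:CC)^(-(b:CC)-1) * ((1/y^2:RR):CC)) - fw c d y * (y:CC)^(-(b:CC)-1) =
      (-(fw c d 1 * ((1-1/y^2:RR):CC)) + (fw c d 1 - fw c d y)) * (y:CC)^(-(b:CC)-1) by push_cast; ring]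
    rw [norm_mul, cR hy0]
    have e3 : (-(b:CC)-1).re = -b-1 := by simp
    rw [e3, show y^(-b) = y^(-b-1) * y by
      rw [← Real.rpow_add_one hy0.ne']; ring_nf]
    have p : 0 < y^(-b-1) := by positivity
    have l1 := fw_lip hc hc' hd hy.le
    have l2 := fw_norm_le hc d 1
    have l3 : 0 ≤ 1 - 1/y^2 := by
      rw [sub_nonneg, div_le_one bPq]; nlinarith
    have l4 : 1 - 1/y^2 ≤ 2 * (y-1) := by
      have : 1 - 1/y^2 = (y-1)*(y+1)/y^2 := by field_simp; ring
      rw [this, dI bPq]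
      nlinarith [mul_pos (sub_pos.2 hy) hy0, mul_pos (mul_pos (sub_pos.2 hy) hy0) (sub_pos.2 hy)]
    have l5 : ‖-(fw c d 1 * ((1-1/y^2:RR):CC)) + (fw c d 1 - fw c d y)‖ ≤ 3 * (y-1) := by
      refine (norm_add_le _ _).trans ?_
      rw [norm_neg, norm_mul, cN, rN l3]
      nlinarith [norm_nonneg (fw c d 1)]
    nlinarith
  · rw [iC, integral_sub (iR bL one_pos)
      (iR bL one_pos), integral_Ioi_rpow_of_lt bL one_pos,
      integral_Ioi_rpow_of_lt bL one_pos]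
    simp only [Real.one_rpow]
    have h1 : b - 1 ≠ 0 := by linarith
    have h2 : b ≠ 0 := by linarith
    have h3 : -b + 1 ≠ 0 := by intro h; apply h1; linarith
    have h4 : -b - 1 + 1 = -b := by ring
    rw [h4, show -b+1 = -(b-1) by ring]
    field_simp
    ring

lemma gauss_half {x : RR} (hx : 0 < x) :
    ∫ t in Ip, EX (-((1/x^2)*t^2/2) + 0*t) * t^((1/2:RR)-1) ≤ 3.26 * Real.sqrt x := by
  have hp : (1:RR)/2 - 1 = -(1/2) := by norm_num
  have i1 : IntegrableOn (fun t : RR => t^((1/2:RR)-1)) (Ioc 0 x) := by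
    have := intervalIntegral.intervalIntegrable_rpow' (a := 0) (b := x) (r := (1/2:RR)-1) bN
    rwa [iO hx.le] at this
  have i2 : IntegrableOn (fun t : RR => EX (-(1/(2*x^2))*t^2)) (Ioi 0) :=
    (integrable_exp_neg_mul_sq bPq).integrableOn
  have i3 := (i1.integrable_indicator mC)
  have hmain := integral_mono_of_nonneg (μ := volume.restrict (Ioi 0))
    (f := fun t : RR => EX (-((1/x^2)*t^2/2) + 0*t) * t^((1/2:RR)-1))
    (g := fun t => (Ioc 0 x).indicator (fun t : RR => t^((1/2:RR)-1)) t + x^((1/2:RR)-1) * EX (-(1/(2*x^2))*t^2))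
    (by
      filter_upwards [ae_restrict_mem mI] with t ht
      have : (0:RR) < t := ht
      simp only [Pi.zero_apply]; positivity)
    (i3.integrableOn.add (i2.const_mul _)) (by
      filter_upwards [ae_restrict_mem mI] with t ht
      have ht : (0:RR) < t := ht
      have e : -((1/x^2)*t^2/2) + 0*t = -(1/(2*x^2))*t^2 := by field_simp; ring
      rw [e]
      have hexp : EX (-(1/(2*x^2))*t^2) ≤ 1 := by
        apply Real.exp_le_one_iff.2
        have : 0 ≤ (1/(2*x^2))*t^2 := by positivity
        linarith
      have p1 : 0 < t^((1/2:RR)-1) := by positivity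
      have p2 : 0 < x^((1/2:RR)-1) := by positivity
      by_cases h : t ≤ x
      · rw [indicator_of_mem (show t ∈ Ioc 0 x from ⟨ht, h⟩)]
        have := eP (-(1/(2*x^2))*t^2)
        nlinarith [mul_pos p2 this]
      · rw [indicator_of_notMem (fun h' => h h'.2), zero_add, mul_comm]
        apply mLR _ (eP _).le
        exact Real.rpow_le_rpow_of_nonpos hx bL bN)
  refine hmain.trans ?_
  rw [integral_add i3.integrableOn (i2.const_mul _), iC, integral_gaussian_Ioi,
    setIntegral_indicator mC, inter_eq_self_of_subset_right Ioc_subset_Ioi_self,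
    ← intervalIntegral.integral_of_le hx.le, integral_rpow (Or.inl bN)]
  rw [Real.zero_rpow bN, show (1/2:RR)-1+1 = 1/2 by norm_num, Real.rpow_sub hx, Real.rpow_one, ← Real.sqrt_eq_rpow]
  have e1 : Real.sqrt (PI/(1/(2*x^2))) = x * Real.sqrt (2*PI) := by
    rw [show PI/(1/(2*x^2)) = x^2*(2*PI) by field_simp, Real.sqrt_mul bPq, Real.sqrt_sq hx.le]
  rw [e1]
  have e2 : Real.sqrt (2*PI) ≤ 2.52 := by
    rw [Real.sqrt_le_left bN]
    have := Real.pi_lt_d2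
    norm_num at this ⊢; linarith
  have hs : 0 < Real.sqrt x := Real.sqrt_pos.2 hx
  have e3 : Real.sqrt x / x * (x * Real.sqrt (2*PI)/2) = Real.sqrt x * (Real.sqrt (2*PI)/2) := by
    field_simp
  rw [e3]
  nlinarith

lemma triv_any {x d : RR} (hx : 0 < x) {b : RR} (hb : 0 ≤ b) :
    ‖fw (1/x^2) d 1 / (2 + b) - If (fw (1/x^2) d) (-b)‖ ≤ 1/2 + 3.26 * Real.sqrt x := by
  have hc : 0 < 1/x^2 := by positivity
  refine (norm_sub_le _ _).trans (add_le_add ?_ ?_)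
  · rw [norm_div, show (2:CC)+b = ((2+b:RR):CC) by push_cast; ring, cN, rN bPq]
    apply div_le_div₀ zO (fw_norm_le hc d 1) bN bL
  · refine le_trans ?_ (gauss_half hx)
    have hi := real_gauss_int (κ := 1/x^2) 0 hc (σ := 1/2) bN
    refine (norm_integral_le_of_norm_le (hi.mono_set (Ioi_subset_Ioi zO)) ?_).trans ?_
    · filter_upwards [ae_restrict_mem mI] with y hy
      have hy : 1 < y := hy
      rw [norm_mul, fw_norm, cR bL, zero_mul, add_zero]
      refine mLL (rE hy.le ?_) (eP _).le
      simp; linarith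
    · apply setIntegral_mono_set hi
      · filter_upwards [ae_restrict_mem mI] with y hy
        have : (0:RR) < y := hy
        simp only [Pi.zero_apply]; positivity
      · exact (Ioi_subset_Ioi zO).eventuallyLE

lemma Gk_scale {x : RR} (hx : 0 < x) (d : RR) (s : CC) :
    Gk ((1/x^2:RR):CC) ((d/x:RR)*I) s = (x:CC)^s * Gk 1 (d*I) s := by
  have hxc : (x:CC) ≠ 0 := by exact_mod_cast hx.ne'
  have h := integral_comp_mul_left_Ioi (fun t : RR => gk ((1/x^2:RR):CC) ((d/x:RR)*I) t * (t:CC)^(s-1)) 0 hx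
  rw [mul_zero] at h
  unfold Gk
  have h2 : (∫ t in Ip, gk ((1/x^2:RR):CC) ((d/x:RR)*I) t * (t:CC)^(s-1)) =
      x • ∫ (t : RR) in Ioi 0, gk ((1/x^2:RR):CC) ((d/x:RR)*I) (x*t) * ((x*t:RR):CC)^(s-1) := by
    rw [h, smul_smul, mul_inv_cancel₀ hx.ne', one_smul]
  rw [h2, ← iC, ← integral_smul]
  refine setIntegral_congr_fun mI fun t ht => ?_
  have ht : 0 < t := ht
  rw [Complex.ofReal_mul, Complex.mul_cpow_ofReal_nonneg hx.le ht.le]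
  have e : gk ((1/x^2:RR):CC) ((d/x:RR)*I) (x*t) = gk 1 (d*I) t := by
    unfold gk
    push_cast
    congr 1
    field_simp
  rw [e, Complex.real_smul]
  rw [Complex.cpow_sub _ _ hxc, Complex.cpow_one]
  field_simp

variable {q : ℕ} [NeZero q]

lemma sum_tel (F : ℕ → CC) (B : RR) (h0 : ‖F 0‖ ≤ B) (h : ∀ k : ℕ, 1 ≤ k → ‖F k‖ ≤ 3 / ((k:RR) * (k+1))) {Q : CC}
    (hQ : HasSum F Q) : ‖Q‖ ≤ B + 3 := by
  refine le_of_tendsto (hQ.tendsto_sum_nat.norm) (Filter.Eventually.of_forall fun n => ?_)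
  rcases n with _ | n
  · simp; linarith [norm_nonneg (F 0)]
  have : ‖∑ i ∈ Finset.range (n+1), F i‖ ≤ B + 3 - 3/((n:RR)+1) := by
    induction n with
    | zero => simp; exact h0
    | succ m ih =>
      rw [Finset.sum_range_succ]
      refine (norm_add_le _ _).trans ?_
      have := h (m+1) (by omega)
      have e : (3:RR)/(((m+1:ℕ):RR)*((m+1:ℕ)+1)) = 3/((m:RR)+1) - 3/(((m+1:ℕ):RR)+1) := by
        push_cast; field_simp; ring
      linarith
  have p : 0 ≤ 3/((n:RR)+1) := by positivity
  linarith

theorem explicit_bound {χ : DC q} (hχ : χ.IsPrimitive) {x d : RR} (hx : 1600 ≤ x)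
    (hd : |d| ≤ 0.01 * x) (hz : ∀ ρ, mz χ ρ ≠ 0 → 4 + ρ.im^2 ≤ 16 * ‖ρ‖^2) {B : RR}
    (hB : ∀ F : Finset CC, ∑ ρ ∈ F, mz χ ρ * (x^ρ.re * ‖Gk 1 (d*I) ρ‖) ≤ B) :
    ∃ S : CC, HasSum (fun n : ℕ => (vM n : CC) * χ n * fw (1/x^2) (d/x) n) S ∧
      ‖S - Xie q * (x * Gk 1 (d*I) 1)‖ ≤ B + 17 * (LG q + 10) + 3.26 * Real.sqrt x + 7.5 := by
  have hx0 : 0 < x := by linarith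
  have hc : 0 < 1/x^2 := by positivity
  have hc' : 1/x^2 ≤ 0.0001 := by
    rw [dI bPq]; nlinarith
  have hd' : |d/x| ≤ 0.01 := by
    rw [abs_div, abs_of_pos hx0, dI hx0]; exact hd
  obtain ⟨W, hWc, hW, hf⟩ := exists_W (c := ((1/x^2:RR):CC)) ((d/x:RR)*I) (by rw [Complex.ofReal_re]; exact hc) one_pos
  obtain ⟨S, P, Q, hS, hP, hQ, hE⟩ := explicit_formula hχ hWc hW (f := fw (1/x^2) (d/x))
    (fun y hy => by rw [hf y hy, div_one]; rfl)
  refine ⟨S, hS, ?_⟩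
  have bP : ‖P‖ ≤ 17 * (LG q + 10) + B := by
    refine le_of_tendsto hP.norm (Filter.Eventually.of_forall fun F => ?_)
    refine (norm_sum_le _ _).trans ?_
    have h1 : ∀ ρ ∈ F, ‖(mz χ ρ : CC) * (fw (1/x^2) (d/x) 1 / (2 - ρ) - If (fw (1/x^2) (d/x)) ρ)‖ ≤
        17 * (mz χ ρ * Kf ρ.re (0 - ρ.im)) + mz χ ρ * (x^ρ.re * ‖Gk 1 (d*I) ρ‖) := by
      intro ρ _
      by_cases h : mz χ ρ = 0
      · simp [h]
      obtain ⟨r0, r1⟩ := mz_re hχ h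
      have z := zero_term hc hc' hd' r0 r1 (hz ρ h)
      have g : ‖Gk ((1/x^2:RR):CC) ((d/x:RR)*I) ρ‖ = x^ρ.re * ‖Gk 1 (d*I) ρ‖ := by
        rw [Gk_scale hx0, norm_mul, cR hx0]
      rw [norm_mul, cN, rN (mz_nonneg _ _)]
      rw [show 17 * (mz χ ρ * Kf ρ.re (0 - ρ.im)) + mz χ ρ * (x^ρ.re * ‖Gk 1 (d*I) ρ‖) =
        mz χ ρ * (17 * Kf ρ.re (0 - ρ.im) + x^ρ.re * ‖Gk 1 (d*I) ρ‖) by ring]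
      apply mLL _ (mz_nonneg _ _)
      rw [← g]
      have := norm_sub_le (fw (1/x^2) (d/x) 1 / (2 - ρ) - If (fw (1/x^2) (d/x)) ρ + Gk ((1/x^2:RR):CC) ((d/x:RR)*I) ρ)
        (Gk ((1/x^2:RR):CC) ((d/x:RR)*I) ρ)
      rw [add_sub_cancel_right] at this
      linarith
    refine (Finset.sum_le_sum h1).trans ?_
    rw [Finset.sum_add_distrib, ← Finset.mul_sum]
    have hK := hasSum_Kf hχ 0
    have h2 : ∑ ρ ∈ F, mz χ ρ * Kf ρ.re (0 - ρ.im) ≤ Dt χ 0 := by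
      refine sum_le_hasSum F (fun ρ _ => ?_) hK
      by_cases h : mz χ ρ = 0
      · simp [h]
      exact mul_nonneg (mz_nonneg _ _) (Kf_pos (mz_re hχ h).1 (mz_re hχ h).2).le
    have h3 := Dt_le_low hχ (T := 100) (t := 0) le_rfl bN
    have hq : (0:RR) < q := by exact_mod_cast NeZero.pos q
    rw [Real.log_mul hq.ne' bN] at h3
    have h4 : LG 100 ≤ 4.7 := by
      rw [show (100:RR) = (2*(1/2)*10)^2 by norm_num, Real.log_pow]
      have : LG (2*(1/2)*10) = LG 2 * 3 + LG 1.25 := by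
        rw [mul_comm (LG 2), show (3:RR) * LG 2 = LG (2^3) by rw [Real.log_pow]; norm_num, ← Real.log_mul bN bN]
        norm_num
      have h5 := lO (show (0:RR) < 1.25 by norm_num)
      have := Real.log_two_lt_d9
      push_cast
      linarith
    have := hB F
    linarith
  have bQ : ‖Q‖ ≤ (1/2 + 3.26 * Real.sqrt x) + 3 := by
    refine sum_tel _ _ ?_ ?_ hQ
    · have := triv_any (d := d/x) hx0 (b := Xia χ) bPq
      simpa using this
    · intro k hk
      have hk' : (1:RR) ≤ k := by exact_mod_cast hk
      have ha : (0:RR) ≤ Xia χ := by positivity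
      have := triv_ge_two hc hc' hd' (b := Xia χ + 2*k) bL
      push_cast at this
      rw [← add_assoc] at this
      push_cast
      refine this.trans ?_
      apply div_le_div₀ bN le_rfl bPq
      nlinarith
  have hL := norm_logDeriv_L_le χ 0
  rw [Complex.ofReal_zero, zero_mul, add_zero] at hL
  have hf1 := fw_norm_le hc (d/x) 1
  have h1 : If (fw (1/x^2) (d/x)) 1 = x * Gk 1 (d*I) 1 - ∫ y in (0:RR)..1, fw (1/x^2) (d/x) y * (y:CC)^((1:CC)-1) := by
    rw [If_eq hc bN, Gk_scale hx0, Complex.cpow_one]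
  have h2 := unit_bound (g := fw (1/x^2) (d/x)) zO (fun y _ => fw_norm_le hc (d/x) y) (s := 1) bN
  set J := ∫ y in (0:RR)..1, fw (1/x^2) (d/x) y * (y:CC)^((1:CC)-1)
  rw [hE, h1]
  have e : P + Q + Xie q * (x * Gk 1 (d*I) 1 - J - fw (1/x^2) (d/x) 1) - logDeriv χ.LFunction 2 * fw (1/x^2) (d/x) 1
      - Xie q * (x * Gk 1 (d*I) 1) = P + Q - (Xie q * (J + fw (1/x^2) (d/x) 1) + logDeriv χ.LFunction 2 * fw (1/x^2) (d/x) 1) := by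
    ring
  rw [e]
  refine (norm_sub_le _ _).trans ?_
  have n1 := norm_add_le P Q
  have n2 : ‖(Xie q:CC) * (J + fw (1/x^2) (d/x) 1) + logDeriv χ.LFunction 2 * fw (1/x^2) (d/x) 1‖ ≤ 4 := by
    refine (norm_add_le _ _).trans ?_
    rw [norm_mul, norm_mul, cN, rN (Xie_nonneg q)]
    have := norm_add_le J (fw (1/x^2) (d/x) 1)
    have a1 : Xie q * ‖J + fw (1/x^2) (d/x) 1‖ ≤ 1 * 2 :=
      mul_le_mul (Xie_le q) bL (norm_nonneg _) zO
    have a2 : ‖logDeriv χ.LFunction 2‖ * ‖fw (1/x^2) (d/x) 1‖ ≤ 2 * 1 :=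
      mul_le_mul hL hf1 (norm_nonneg _) bN
    linarith
  linarith

end AssembleE

section
open Complex Filter Topology

lemma Kf_half (u : RR) : Kf (1/2) u = 3/(9/4+u^2) := by
  unfold Kf
  norm_num
  rw [← add_div]; norm_num

lemma Kf_sum_le {q : ℕ} [NeZero q] {χ : DC q} (hχ : χ.IsPrimitive) (F : Finset CC) (t : RR) :
    ∑ ρ ∈ F, mz χ ρ * Kf ρ.re (t - ρ.im) ≤ Dt χ t := by
  refine sum_le_hasSum F (fun ρ _ => ?_) (hasSum_Kf hχ t)
  by_cases h : mz χ ρ = 0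
  · simp [h]
  exact mul_nonneg (mz_nonneg _ _) (Kf_pos (mz_re hχ h).1 (mz_re hχ h).2).le

lemma int_Kf_half (a b γ : RR) : ∫ t in a..b, Kf (1/2) (t - γ) =
    2 * Real.arctan ((b-γ)/1.5) - 2 * Real.arctan ((a-γ)/1.5) := by
  have hd : ∀ t : RR, HD (fun t => 2 * Real.arctan ((t-γ)/1.5)) (Kf (1/2) (t-γ)) t := by
    intro t
    have := ((((hasDerivAt_id t).sub_const γ).div_const 1.5).arctan).const_mul 2
    refine this.congr_deriv ?_
    rw [Kf_half]
    simp only [id]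
    have : 9/4 + (t-γ)^2 ≠ 0 := by positivity
    have : 1 + ((t-γ)/1.5)^2 ≠ 0 := by positivity
    field_simp
    ring
  rw [intervalIntegral.integral_eq_sub_of_hasDerivAt (fun t _ => hd t)]
  apply Continuous.intervalIntegrable
  have : (fun t => Kf (1/2) (t-γ)) = fun t => 3/(9/4+(t-γ)^2) := by ext t; rw [Kf_half]
  rw [this]
  exact continuous_const.div (by fun_prop) (fun t => by positivity)

lemma int_Kf_half_ge {T γ : RR} (hT : 100 ≤ T) (hγ : |γ| ≤ T) : 3.1 ≤ ∫ t in (-T)..T, Kf (1/2) (t - γ) := by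
  rw [int_Kf_half]
  have h := abs_le.1 hγ
  have key : ∀ y : RR, 100 ≤ y → 1.55 ≤ Real.arctan (y/1.5) := by
    intro y hy
    have h1 := Real.arctan_inv_of_pos (show 0 < y/1.5 by positivity)
    have h2 : Real.arctan (y/1.5)⁻¹ ≤ (y/1.5)⁻¹ := by
      have h0 : 0 ≤ Real.arctan (y/1.5)⁻¹ := Real.arctan_nonneg.2 bPq
      have := Real.le_tan h0 (Real.arctan_lt_pi_div_two _)
      rwa [Real.tan_arctan] at this
    have h3 : (y/1.5)⁻¹ ≤ 0.015 := by
      rw [inv_div, dI bL]; linarith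
    have := Real.pi_gt_d2
    linarith
  rw [show (-T-γ)/1.5 = -((T+γ)/1.5) by ring, Real.arctan_neg]
  have n1 : 0 ≤ Real.arctan ((T-γ)/1.5) := Real.arctan_nonneg.2 (by apply div_nonneg <;> linarith)
  have n2 : 0 ≤ Real.arctan ((T+γ)/1.5) := Real.arctan_nonneg.2 (by apply div_nonneg <;> linarith)
  rcases le_total 0 γ with hg | hg
  · have := key (T+γ) bL; linarith
  · have := key (T-γ) bL; linarith

lemma count_low {q : ℕ} [NeZero q] {χ : DC q} (hχ : χ.IsPrimitive) {T : RR} (hT : 100 ≤ T)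
    (F : Finset CC) (hF : ∀ ρ ∈ F, ρ.re = 1/2 ∧ |ρ.im| ≤ T) :
    3.1 * ∑ ρ ∈ F, mz χ ρ ≤ 2 * T * (LG (q*T) + 5.3) := by
  have hc : ∀ γ : RR, Continuous (fun t => Kf (1/2) (t-γ)) := by
    intro γ
    have : (fun t => Kf (1/2) (t-γ)) = fun t => 3/(9/4+(t-γ)^2) := by ext t; rw [Kf_half]
    rw [this]
    exact continuous_const.div (by fun_prop) (fun t => by positivity)
  have h1 : ∫ t in (-T)..T, ∑ ρ ∈ F, mz χ ρ * Kf (1/2) (t - ρ.im) ≤ ∫ t in (-T)..T, (LG (q*T) + 5.3) := by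
    apply intervalIntegral.integral_mono_on bL
    · apply Continuous.intervalIntegrable
      exact continuous_finsetSum _ fun ρ _ => continuous_const.mul (hc _)
    · exact intervalIntegrable_const
    · intro t ht
      refine le_trans ?_ (Dt_le_low hχ hT (abs_le.2 ht))
      refine le_trans (le_of_eq ?_) (Kf_sum_le hχ F t)
      exact Finset.sum_congr rfl fun ρ hρ => by rw [(hF ρ hρ).1]
  have hi : ∀ ρ ∈ F, IntervalIntegrable (fun t => mz χ ρ * Kf (1/2) (t - ρ.im)) volume (-T) T :=
    fun ρ _ => (continuous_const.mul (hc _)).intervalIntegrable _ _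
  rw [intervalIntegral.integral_finsetSum hi, intervalIntegral.integral_const] at h1
  have h2 : 3.1 * ∑ ρ ∈ F, mz χ ρ ≤ ∑ ρ ∈ F, ∫ t in (-T)..T, mz χ ρ * Kf (1/2) (t - ρ.im) := by
    rw [Finset.mul_sum]
    refine Finset.sum_le_sum fun ρ hρ => ?_
    rw [intervalIntegral.integral_const_mul, mul_comm]
    exact mLL (int_Kf_half_ge hT (hF ρ hρ).2) (mz_nonneg _ _)
  rw [smul_eq_mul] at h1
  linarith

lemma pair_low {q : ℕ} [NeZero q] {χ : DC q} (hχ : χ.IsPrimitive) {T : RR} (hT : 100 ≤ T)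
    (F : Finset CC) (hF : ∀ ρ ∈ F, ρ.re = 1/2 ∧ |ρ.im| ≤ T) :
    ∑ ρ ∈ F, ∑ ρ' ∈ F, mz χ ρ * mz χ ρ' * (1/(1/4+(ρ.im-ρ'.im)^2)) ≤ 1.936 * T * (LG (q*T) + 5.3)^2 := by
  set L := LG (q*T) + 5.3
  have hL : 0 ≤ L := by
    have hq : (1:RR) ≤ q := by exact_mod_cast NeZero.one_le
    have := Real.log_nonneg (show 1 ≤ q*T by nlinarith)
    simp only [L]; linarith
  have h1 : ∀ ρ ∈ F, ∑ ρ' ∈ F, mz χ ρ * mz χ ρ' * (1/(1/4+(ρ.im-ρ'.im)^2)) ≤ mz χ ρ * (3 * L) := by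
    intro ρ hρ
    simp_rw [mul_assoc]
    rw [← Finset.mul_sum]
    refine mLL ?_ (mz_nonneg _ _)
    have h2 := (Kf_sum_le hχ F ρ.im).trans (Dt_le_low hχ hT (hF ρ hρ).2)
    have h3 : ∑ ρ' ∈ F, mz χ ρ' * (1/(1/4+(ρ.im-ρ'.im)^2)) ≤ 3 * ∑ ρ' ∈ F, mz χ ρ' * Kf ρ'.re (ρ.im-ρ'.im) := by
      rw [Finset.mul_sum]
      refine Finset.sum_le_sum fun ρ' h' => ?_
      rw [(hF ρ' h').1, Kf_half, ← mul_assoc, mul_comm 3, mul_assoc]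
      refine mLL ?_ (mz_nonneg _ _)
      rw [← mul_div_assoc, dD bPq bPq]
      nlinarith [sq_nonneg (ρ.im-ρ'.im)]
    exact h3.trans (mLL h2 bN)
  refine (Finset.sum_le_sum h1).trans ?_
  rw [← Finset.sum_mul]
  have h4 := count_low hχ hT F hF
  change _ ≤ 2 * T * L at h4
  have h5 : ∑ ρ ∈ F, mz χ ρ ≤ 2*T*L/3.1 := by rw [lI bN]; linarith
  calc (∑ ρ ∈ F, mz χ ρ) * (3*L) ≤ (2*T*L/3.1)*(3*L) := by gcongr
    _ = (6/3.1) * (T*L^2) := by ring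
    _ ≤ 1.936 * (T * L^2) := by
      have : 0 ≤ T * L^2 := by positivity
      nlinarith
    _ = _ := by ring

lemma sq_int01 (u : RR) : IntegrableOn (fun t : RR => (t:CC)^(-1/2+u*I:CC)) (Ioc 0 1) ∧
    ∫ t in Ioc (0:RR) 1, (t:CC)^(-1/2+u*I:CC) = 1/(1/2+u*I) := by
  have hr : -1 < (-1/2+u*I:CC).re := by simp; norm_num
  have h := intervalIntegral.intervalIntegrable_cpow' (a := 0) (b := 1) hr
  refine ⟨(iO zO).1 h, ?_⟩
  rw [← intervalIntegral.integral_of_le zO, integral_cpow (Or.inl hr)]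
  have e : (-1/2+u*I:CC) + 1 = 1/2+u*I := by ring
  have e0 : (1/2+u*I:CC) ≠ 0 := by
    intro h; have := congrArg Complex.re h; simp at this
  rw [e, ofReal_one, one_cpow, ofReal_zero, zero_cpow e0, sub_zero]

lemma sq_int1 (u : RR) : IntegrableOn (fun t : RR => (t:CC)^(-3/2+u*I:CC)) (Ioi 1) ∧
    ∫ t in Ioi (1:RR), (t:CC)^(-3/2+u*I:CC) = 1/(1/2-u*I) := by
  have hr : (-3/2+u*I:CC).re < -1 := by simp; norm_num
  refine ⟨integrableOn_Ioi_cpow_of_lt hr one_pos, ?_⟩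
  rw [integral_Ioi_cpow_of_lt hr one_pos]
  have e : (-3/2+u*I:CC) + 1 = -(1/2-u*I) := by ring
  rw [e, ofReal_one, one_cpow, div_neg, neg_div, neg_neg]

lemma normsq_sum (F : Finset CC) (a : CC → CC) (t σ : RR) (ht : 0 < t) :
    ((‖∑ ρ ∈ F, a ρ * (t:CC)^((ρ.im:CC)*I)‖^2 * t^σ : RR) : CC) =
      ∑ ρ ∈ F, ∑ ρ' ∈ F, (a ρ * (starRingEnd CC) (a ρ')) * (t:CC)^(σ+((ρ.im-ρ'.im:RR):CC)*I) := by
  have htc : (t:CC) ≠ 0 := by exact_mod_cast ht.ne'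
  rw [ofReal_mul, ofReal_pow, ← Complex.mul_conj', map_sum, Finset.sum_mul_sum, Finset.sum_mul]
  refine Finset.sum_congr rfl fun ρ _ => ?_
  rw [Finset.sum_mul]
  refine Finset.sum_congr rfl fun ρ' _ => ?_
  have h1 : (starRingEnd CC) ((t:CC)^((ρ'.im:CC)*I)) = (t:CC)^(-((ρ'.im:CC)*I)) := by
    have h := Complex.cpow_conj (t:CC) ((ρ'.im:CC)*I) (by rw [Complex.arg_ofReal_of_nonneg ht.le]; exact Real.pi_pos.ne)
    rw [conj_ofReal] at h
    rw [← h]; simp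
  rw [map_mul, h1, ofReal_cpow ht.le, ofReal_sub, sub_mul, ← add_sub_assoc, sub_eq_add_neg,
    cpow_add _ _ htc, cpow_add _ _ htc]
  ring

lemma dsum_int {S : Set RR} (F : Finset CC) (a : CC → CC) (σ : RR) (hS : MeasurableSet S) (hS0 : S ⊆ Ioi 0)
    (hi : ∀ u : RR, IntegrableOn (fun t : RR => (t:CC)^(σ+u*I:CC)) S) :
    IntegrableOn (fun t : RR => ‖∑ ρ ∈ F, a ρ * (t:CC)^((ρ.im:CC)*I)‖^2 * t^σ) S ∧
    ((∫ t in S, ‖∑ ρ ∈ F, a ρ * (t:CC)^((ρ.im:CC)*I)‖^2 * t^σ : RR) : CC) =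
      ∑ ρ ∈ F, ∑ ρ' ∈ F, (a ρ * (starRingEnd CC) (a ρ')) * ∫ t in S, (t:CC)^(σ+((ρ.im-ρ'.im:RR):CC)*I) := by
  have h1 : ∀ ρ ∈ F, ∀ ρ' ∈ F, IntegrableOn (fun t : RR => (a ρ * (starRingEnd CC) (a ρ')) * (t:CC)^(σ+((ρ.im-ρ'.im:RR):CC)*I)) S :=
    fun ρ _ ρ' _ => (hi _).const_mul _
  have h2 : ∀ ρ ∈ F, IntegrableOn (fun t : RR => ∑ ρ' ∈ F, (a ρ * (starRingEnd CC) (a ρ')) * (t:CC)^(σ+((ρ.im-ρ'.im:RR):CC)*I)) S :=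
    fun ρ hρ => integrable_finsetSum _ (h1 ρ hρ)
  have h3 := integrable_finsetSum F h2
  constructor
  · have h4 : IntegrableOn (fun t : RR => ((‖∑ ρ ∈ F, a ρ * (t:CC)^((ρ.im:CC)*I)‖^2 * t^σ : RR) : CC)) S := by
      refine Integrable.congr h3 ?_
      filter_upwards [ae_restrict_mem hS] with t ht
      rw [normsq_sum F a t σ (hS0 ht)]
    exact h4.re
  · rw [← integral_complex_ofReal]
    rw [setIntegral_congr_fun hS (fun t ht => normsq_sum F a t σ (hS0 ht)), integral_finsetSum _ h2]
    refine Finset.sum_congr rfl fun ρ hρ => ?_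
    rw [integral_finsetSum _ (h1 ρ hρ)]
    refine Finset.sum_congr rfl fun ρ' hρ' => ?_
    rw [iC]

lemma sq_total {q : ℕ} [NeZero q] {χ : DC q} (hχ : χ.IsPrimitive) {T : RR} (hT : 100 ≤ T)
    (F : Finset CC) (hF : ∀ ρ ∈ F, ρ.re = 1/2 ∧ |ρ.im| ≤ T) (c : CC → CC) (hc : ∀ ρ, ‖c ρ‖ ≤ 1) :
    (∫ t in Ioc (0:RR) 1, ‖∑ ρ ∈ F, (mz χ ρ * c ρ) * (t:CC)^((ρ.im:CC)*I)‖^2 * t^(-1/2:RR)) +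
    (∫ t in Ioi (1:RR), ‖∑ ρ ∈ F, (mz χ ρ * c ρ) * (t:CC)^((ρ.im:CC)*I)‖^2 * t^(-3/2:RR)) ≤
      1.936 * T * (LG (q*T) + 5.3)^2 := by
  have h1 := (dsum_int F (fun ρ => mz χ ρ * c ρ) (-1/2) mC Ioc_subset_Ioi_self
    (fun u => by have := (sq_int01 u).1; push_cast; exact this)).2
  have h2 := (dsum_int F (fun ρ => mz χ ρ * c ρ) (-3/2) mI (Ioi_subset_Ioi zO)
    (fun u => by have := (sq_int1 u).1; push_cast; exact this)).2
  have h3 := congrArg₂ (· + ·) h1 h2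
  simp only [← ofReal_add, ← Finset.sum_add_distrib, ← mul_add] at h3
  refine le_trans (le_trans (le_abs_self _) ?_) (pair_low hχ hT F hF)
  rw [← Real.norm_eq_abs, ← cN, h3]
  refine (norm_sum_le _ _).trans (Finset.sum_le_sum fun ρ _ => (norm_sum_le _ _).trans (Finset.sum_le_sum fun ρ' _ => ?_))
  have e1 := (sq_int01 (ρ.im-ρ'.im)).2
  have e2 := (sq_int1 (ρ.im-ρ'.im)).2
  push_cast at e1 e2 ⊢
  rw [e1, e2]
  rw [norm_mul]
  have hm : ‖(mz χ ρ * c ρ) * (starRingEnd CC) (mz χ ρ' * c ρ')‖ ≤ mz χ ρ * mz χ ρ' := by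
    rw [norm_mul, Complex.norm_conj, norm_mul, norm_mul, cN, cN,
      rN (mz_nonneg _ _), rN (mz_nonneg _ _)]
    exact mul_le_mul (mO (mz_nonneg _ _) (hc _)) (mO (mz_nonneg _ _) (hc _))
      (mul_nonneg (mz_nonneg _ _) (norm_nonneg _)) (mz_nonneg _ _)
  refine mul_le_mul hm (le_of_eq ?_) (norm_nonneg _) (mul_nonneg (mz_nonneg _ _) (mz_nonneg _ _))
  have e3 : (1/(1/2+((ρ.im:CC)-ρ'.im)*I) + 1/(1/2-((ρ.im:CC)-ρ'.im)*I)) = ((1/(1/4+(ρ.im-ρ'.im)^2) : RR) : CC) := by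
    have n1 : (1/2+((ρ.im:CC)-ρ'.im)*I) ≠ 0 := by intro h; have := congrArg Complex.re h; simp at this
    have n2 : (1/2-((ρ.im:CC)-ρ'.im)*I) ≠ 0 := by intro h; have := congrArg Complex.re h; simp at this
    have n3 : ((1/4+(ρ.im-ρ'.im)^2 : RR) : CC) = (1/2+((ρ.im:CC)-ρ'.im)*I) * (1/2-((ρ.im:CC)-ρ'.im)*I) := by
      push_cast; linear_combination (((ρ.im:CC)-ρ'.im)^2) * I_sq
    rw [ofReal_div, n3, ofReal_one, div_add_div _ _ n1 n2]
    congr 1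
    ring
  rw [e3, cN, rN bPq]

lemma low_zeros {q : ℕ} [NeZero q] {χ : DC q} (hχ : χ.IsPrimitive) {T : RR} (hT : 100 ≤ T)
    (F : Finset CC) (hF : ∀ ρ ∈ F, ρ.re = 1/2 ∧ |ρ.im| ≤ T) (d : RR) :
    ∑ ρ ∈ F, mz χ ρ * ‖Gk 1 (d*I) ρ‖ ≤ 2.06 * (Real.sqrt T * (LG (q*T) + 5.3)) := by
  have hq : (1:RR) ≤ q := by exact_mod_cast NeZero.one_le
  have hlog := Real.log_nonneg (show 1 ≤ q*T by nlinarith)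
  set L := LG (q*T) + 5.3 with hL
  have hL0 : 0 < L := by linarith
  set lam := Real.sqrt T * L with hlam
  have hl0 : 0 < lam := mul_pos (Real.sqrt_pos.2 bL) hL0
  have hl2 : lam^2 = T * L^2 := by rw [hlam, mul_pow, Real.sq_sqrt bL]
  obtain ⟨c, hc⟩ : ∃ c : CC → CC, ∀ ρ, ‖c ρ‖ ≤ 1 ∧ c ρ * Gk 1 (d*I) ρ = ‖Gk 1 (d*I) ρ‖ := by
    have : ∀ ρ, ∃ c : CC, ‖c‖ ≤ 1 ∧ c * Gk 1 (d*I) ρ = ‖Gk 1 (d*I) ρ‖ := by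
      intro ρ
      set z := Gk 1 (d*I) ρ
      by_cases hz : z = 0
      · exact ⟨0, by simp, by simp [hz]⟩
      · have hzn : (‖z‖:CC) ≠ 0 := by exact_mod_cast (norm_pos_iff.2 hz).ne'
        refine ⟨(starRingEnd CC) z / ‖z‖, ?_, ?_⟩
        · rw [norm_div, Complex.norm_conj, cN, norm_norm, div_self (norm_pos_iff.2 hz).ne']
        · rw [div_mul_eq_mul_div, mul_comm, Complex.mul_conj', sq, mul_div_cancel_right₀ _ hzn]
    exact ⟨fun ρ => (this ρ).choose, fun ρ => (this ρ).choose_spec⟩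
  set P : RR → CC := fun t => ∑ ρ ∈ F, (mz χ ρ * c ρ) * (t:CC)^((ρ.im:CC)*I) with hP
  have htot := sq_total hχ hT F hF c (fun ρ => (hc ρ).1)
  obtain ⟨i1, -⟩ := dsum_int F (fun ρ => mz χ ρ * c ρ) (-1/2) mC Ioc_subset_Ioi_self
    (fun u => by have := (sq_int01 u).1; push_cast; exact this)
  obtain ⟨i2, -⟩ := dsum_int F (fun ρ => mz χ ρ * c ρ) (-3/2) mI (Ioi_subset_Ioi zO)
    (fun u => by have := (sq_int1 u).1; push_cast; exact this)
  have hgi : ∀ ρ ∈ F, IntegrableOn (fun t : RR => (mz χ ρ * c ρ) * (gk 1 (d*I) t * (t:CC)^(ρ-1))) (Ioi 0) :=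
    fun ρ hρ => (gk_int (d*I) bS (by rw [(hF ρ hρ).1]; norm_num)).const_mul _
  have hX : ((∑ ρ ∈ F, mz χ ρ * ‖Gk 1 (d*I) ρ‖ : RR) : CC) = ∫ t in Ip, ∑ ρ ∈ F, (mz χ ρ * c ρ) * (gk 1 (d*I) t * (t:CC)^(ρ-1)) := by
    rw [integral_finsetSum _ hgi]
    push_cast
    refine Finset.sum_congr rfl fun ρ hρ => ?_
    rw [iC, ← (hc ρ).2, mul_assoc]; rfl
  have hpt : ∀ t : RR, 0 < t → ‖∑ ρ ∈ F, (mz χ ρ * c ρ) * (gk 1 (d*I) t * (t:CC)^(ρ-1))‖ = EX (-(t^2/2)) * t^(-1/2:RR) * ‖P t‖ := by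
    intro t ht
    have htc : (t:CC) ≠ 0 := by exact_mod_cast ht.ne'
    have : ∑ ρ ∈ F, (mz χ ρ * c ρ) * (gk 1 (d*I) t * (t:CC)^(ρ-1)) = gk 1 (d*I) t * (t:CC)^(-1/2:CC) * P t := by
      rw [hP]; simp only [Finset.mul_sum]
      refine Finset.sum_congr rfl fun ρ hρ => ?_
      have e : ρ - 1 = -1/2 + (ρ.im:CC)*I := by
        apply Complex.ext <;> simp [(hF ρ hρ).1]; norm_num
      rw [e, cpow_add _ _ htc]; ring
    rw [this, norm_mul, norm_mul, gk_norm, cR ht]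
    congr 2
    · congr 1; simp
    · norm_num
  have hX2 : ∑ ρ ∈ F, mz χ ρ * ‖Gk 1 (d*I) ρ‖ ≤ ∫ t in Ip, EX (-(t^2/2)) * t^(-1/2:RR) * ‖P t‖ := by
    rw [← setIntegral_congr_fun mI (fun t ht => hpt t ht)]
    refine le_trans ?_ (norm_integral_le_integral_norm _)
    rw [← hX, cN]; exact le_abs_self _
  have hint : IntegrableOn (fun t : RR => EX (-(t^2/2)) * t^(-1/2:RR) * ‖P t‖) (Ioi 0) := by
    refine Integrable.congr (integrable_finsetSum F hgi).norm ?_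
    filter_upwards [ae_restrict_mem mI] with t ht
    exact hpt t ht
  rw [← Ioc_union_Ioi_eq_Ioi (zero_le_one' RR), setIntegral_union (Ioc_disjoint_Ioi le_rfl) mI
    (hint.mono_set Ioc_subset_Ioi_self) (hint.mono_set (Ioi_subset_Ioi zO))] at hX2
  have j1 : IntegrableOn (fun t : RR => t^(-1/2:RR)) (Ioc 0 1) :=
    (iO zO).1 (intervalIntegral.intervalIntegrable_rpow' bN)
  have j1v : ∫ t in Ioc (0:RR) 1, t^(-1/2:RR) = 2 := by
    rw [← intervalIntegral.integral_of_le zO, integral_rpow (Or.inl bN)]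
    norm_num
  have j2 : IntegrableOn (fun t : RR => t * EX (-(1:RR) * t^2)) (Ioi 1) :=
    (integrable_mul_exp_neg_mul_sq one_pos).integrableOn
  have j2v : ∫ t in Ioi (1:RR), t * EX (-(1:RR) * t^2) ≤ 0.184 := by
    have hd : ∀ t ∈ Ici (1:RR), HD (fun t : RR => -(EX (-1*t^2))/2) (t * EX (-(1:RR) * t^2)) t := by
      intro t _
      refine ((((hasDerivAt_pow 2 t).const_mul (-1)).exp.neg).div_const 2).congr_deriv ?_
      simp; ring
    have ht : Tendsto (fun t : RR => -(EX (-1*t^2))/2) atTop (𝓝 (-0/2)) := by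
      apply Tendsto.div_const
      apply Tendsto.neg
      apply Real.tendsto_exp_atBot.comp
      apply Tendsto.const_mul_atTop_of_neg bN
      exact tendsto_pow_atTop bN
    rw [integral_Ioi_of_hasDerivAt_of_tendsto' hd j2 ht]
    have : EX (-1*1^2) ≤ 0.368 := by norm_num; have := Real.exp_neg_one_lt_d9; linarith
    linarith
  have b1 : ∫ t in Ioc (0:RR) 1, EX (-(t^2/2)) * t^(-1/2:RR) * ‖P t‖ ≤
      ∫ t in Ioc (0:RR) 1, ((lam/2) * t^(-1/2:RR) + (1/(2*lam)) * (‖P t‖^2 * t^(-1/2:RR))) := by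
    refine setIntegral_mono_on (hint.mono_set Ioc_subset_Ioi_self) ((j1.const_mul _).add (i1.const_mul _)) mC ?_
    intro t ht
    have hr : 0 < t^(-1/2:RR) := Real.rpow_pos_of_pos ht.1 _
    have he : EX (-(t^2/2)) ≤ 1 := Real.exp_le_one_iff.2 (by nlinarith [sq_nonneg t])
    have : ‖P t‖ ≤ lam/2 + (1/(2*lam)) * ‖P t‖^2 := by
      have : lam/2 + (1/(2*lam)) * ‖P t‖^2 - ‖P t‖ = (‖P t‖-lam)^2/(2*lam) := by field_simp; ring
      have : 0 ≤ (‖P t‖-lam)^2/(2*lam) := by positivity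
      linarith
    calc _ ≤ 1 * t^(-1/2:RR) * ‖P t‖ := by gcongr
      _ ≤ 1 * t^(-1/2:RR) * (lam/2 + (1/(2*lam)) * ‖P t‖^2) := by gcongr
      _ = _ := by ring
  have b2 : ∫ t in Ioi (1:RR), EX (-(t^2/2)) * t^(-1/2:RR) * ‖P t‖ ≤
      ∫ t in Ioi (1:RR), ((lam/2) * (t * EX (-(1:RR) * t^2)) + (1/(2*lam)) * (‖P t‖^2 * t^(-3/2:RR))) := by
    refine setIntegral_mono_on (hint.mono_set (Ioi_subset_Ioi zO)) ((j2.const_mul _).add (i2.const_mul _)) mI ?_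
    intro t ht
    have ht : 1 < t := ht
    have ht0 : 0 < t := by linarith
    set y := EX (-(t^2/2)) with hy
    have hy0 : 0 < y := eP _
    have hy2 : EX (-(1:RR) * t^2) = y^2 := by rw [hy, ← Real.exp_nat_mul]; congr 1; push_cast; ring
    rw [hy2]
    set z := t^(-3/2:RR) with hz
    have hz0 : 0 < z := Real.rpow_pos_of_pos ht0 _
    have hz1 : t^(-1/2:RR) = t * z := by
      rw [hz, ← Real.rpow_one_add' ht0.le bN]; norm_num
    have hz2 : t * z ≤ 1 := by
      rw [← hz1]; exact Real.rpow_le_one_of_one_le_of_nonpos ht.le bN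
    rw [hz1]
    have h1 : y * (t*z) * ‖P t‖ ≤ (lam/2) * (y^2 * (t^2 * z)) + 1/(2*lam) * (‖P t‖^2 * z) := by
      have : (lam/2) * (y^2 * (t^2 * z)) + 1/(2*lam) * (‖P t‖^2 * z) - y * (t*z) * ‖P t‖ = z * (‖P t‖-lam*y*t)^2/(2*lam) := by field_simp; ring
      have : 0 ≤ z * (‖P t‖-lam*y*t)^2/(2*lam) := by positivity
      linarith
    refine h1.trans (add_le_add_left (mLL ?_ bPq) _)
    calc y^2*(t^2*z) = t * y^2 * (t*z) := by ring
      _ ≤ t*y^2*1 := by gcongr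
      _ = _ := by ring
  rw [integral_add (j1.const_mul _) (i1.const_mul _), iC, iC, j1v] at b1
  rw [integral_add (j2.const_mul _) (i2.const_mul _), iC, iC] at b2
  have h5 : (1/(2*lam)) * ((∫ t in Ioc (0:RR) 1, ‖P t‖^2 * t^(-1/2:RR)) + ∫ t in Ioi (1:RR), ‖P t‖^2 * t^(-3/2:RR)) ≤ (1/(2*lam)) * (1.936 * lam^2) := by
    apply mLL _ bPq
    rw [hl2, ← mul_assoc]; exact htot
  have h6 : (1/(2*lam)) * (1.936 * lam^2) = 0.968 * lam := by field_simp; norm_num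
  have h7 : (lam/2) * (∫ t in Ioi (1:RR), t * EX (-(1:RR) * t^2)) ≤ lam/2 * 0.184 := by gcongr
  rw [h6, mul_add] at h5
  linarith

end

section
open Complex Filter Topology

lemma rot_re (φ : RR) : (cexp (2*φ*I)).re = CS (2*φ) := by
  rw [show (2*φ*I:CC) = ((2*φ:RR):CC)*I by push_cast; ring, Complex.exp_ofReal_mul_I_re]

lemma rot_b_re (d φ : RR) : (d*I*cexp (φ*I)).re = -(d * SN φ) := by
  rw [mul_assoc, Complex.re_ofReal_mul, Complex.I_mul_re, Complex.exp_ofReal_mul_I_im]; ring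

lemma Gk_rot_deriv (d : RR) {s : CC} (hs : 0 < s.re) {φ : RR} (hφ : |φ| < PI/4) :
    HD (fun φ : RR => Gk (cexp (2*φ*I)) (d*I*cexp (φ*I)) s)
      (-I*cexp (2*φ*I) * Gk (cexp (2*φ*I)) (d*I*cexp (φ*I)) (s+2) + I*(d*I*cexp (φ*I)) * Gk (cexp (2*φ*I)) (d*I*cexp (φ*I)) (s+1)) φ := by
  set φ1 := (|φ| + PI/4)/2 with hφ1
  have h1 : |φ| < φ1 := by rw [hφ1]; linarith
  have h2 : φ1 < PI/4 := by rw [hφ1]; linarith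
  have hp0 : 0 ≤ φ1 := (abs_nonneg φ).trans h1.le
  set κ := CS (2*φ1) with hκ
  have hκ0 : 0 < κ := Real.cos_pos_of_mem_Ioo ⟨by linarith, by linarith⟩
  have hcos : ∀ y : RR, |y| < φ1 → κ ≤ CS (2*y) := by
    intro y hy
    rw [← Real.cos_abs (2*y), abs_mul, abs_two]
    exact Real.cos_le_cos_of_nonneg_of_le_pi bPq bL bL
  have hnh : {y : RR | |y| < φ1} ∈ 𝓝 φ := (isOpen_lt continuous_abs continuous_const).mem_nhds h1
  have hc : 0 < (cexp (2*φ*I)).re := by rw [rot_re]; exact hκ0.trans_le (hcos _ h1)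
  have i1 := real_gauss_int (κ := κ) |d| hκ0 (σ := s.re + 2) bL
  have i2 := real_gauss_int (κ := κ) |d| hκ0 (σ := s.re + 1) bL
  have key := hasDerivAt_integral_of_dominated_loc_of_deriv_le (μ := volume.restrict (Ip))
    (F := fun (φ : RR) (t : RR) => gk (cexp (2*φ*I)) (d*I*cexp (φ*I)) t * (t:CC)^(s-1))
    (F' := fun (φ : RR) (t : RR) => (-I*cexp (2*φ*I)*t^2 + I*(d*I*cexp (φ*I))*t) * (gk (cexp (2*φ*I)) (d*I*cexp (φ*I)) t * (t:CC)^(s-1)))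
    (x₀ := φ) (s := {y : RR | |y| < φ1})
    (bound := fun t => EX (-(κ*t^2/2)+|d| *t)*t^(s.re+2-1) + |d| * (EX (-(κ*t^2/2)+|d| *t)*t^(s.re+1-1)))
    hnh (eF fun y => gk_aesm _ _ _) (gk_int _ hc hs) ?_ ?_ (i1.add (i2.const_mul _)) ?_
  · have := key.2
    refine this.congr_deriv ?_
    unfold Gk
    have hI2 := gk_int (d*I*cexp (φ*I)) hc (s := s+2) (by simp; linarith)
    have hI1 := gk_int (d*I*cexp (φ*I)) hc (s := s+1) (by simp; linarith)
    rw [← iC, ← iC, ← integral_add (hI2.const_mul _) (hI1.const_mul _)]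
    refine setIntegral_congr_fun mI fun t ht => ?_
    have ht : 0 < t := ht
    have htc : (t:CC) ≠ 0 := by exact_mod_cast ht.ne'
    have e2 : (t:CC)^(s+2-1) = (t:CC)^(s-1) * t^2 := by
      rw [show s+2-1 = (s-1)+(2:ℕ) by push_cast; ring, cpow_add _ _ htc, cpow_natCast]
    have e1 : (t:CC)^(s+1-1) = (t:CC)^(s-1) * t := by
      rw [show s+1-1 = (s-1)+1 by ring, cpow_add _ _ htc, cpow_one]
    simp only [e1, e2]
    ring
  · have h3 : AEStronglyMeasurable (fun t : RR => (-I*cexp (2*φ*I)*t^2 + I*(d*I*cexp (φ*I))*t)) (volume.restrict (Ip)) := by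
      apply Continuous.aestronglyMeasurable; fun_prop
    exact h3.mul (gk_aesm _ _ _)
  · filter_upwards [ae_restrict_mem mI] with t ht y hy
    have ht : 0 < t := ht
    rw [norm_mul, gk_term_norm _ _ _ ht, rot_re, rot_b_re]
    have n1 : ‖(-I*cexp (2*y*I)*t^2 + I*(d*I*cexp (y*I))*t)‖ ≤ t^2 + |d| * t := by
      refine (norm_add_le _ _).trans (le_of_eq ?_)
      have e1 : ‖cexp (2*y*I)‖ = 1 := by
        rw [show (2*y*I:CC) = ((2*y:RR):CC)*I by push_cast; ring, Complex.norm_exp_ofReal_mul_I]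
      have e2 : ‖cexp (y*I)‖ = 1 := Complex.norm_exp_ofReal_mul_I y
      simp only [norm_mul, norm_neg, norm_I, norm_pow, e1, e2, cN, Real.norm_eq_abs, abs_of_pos ht]
      ring
    have n2 : EX (-(CS (2*y)*t^2/2) + -(d*SN y)*t) ≤ EX (-(κ*t^2/2)+|d| *t) := by
      apply Real.exp_le_exp.2
      have : κ * t^2 ≤ CS (2*y) * t^2 := mLR (hcos y hy) bPq
      have h4 : -(d*SN y) ≤ |d| := by
        refine (neg_le_abs _).trans ?_
        rw [abs_mul]
        exact mO (abs_nonneg _) (Real.abs_sin_le_one y)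
      have := mLR h4 ht.le
      linarith
    have e2 : t^(s.re+2-1) = t^(s.re-1) * t^2 := by
      rw [show s.re+2-1 = (s.re-1)+(2:ℕ) by push_cast; ring, Real.rpow_add ht, Real.rpow_natCast]
    have e1 : t^(s.re+1-1) = t^(s.re-1) * t := by
      rw [show s.re+1-1 = (s.re-1)+1 by ring, Real.rpow_add ht, Real.rpow_one]
    rw [e1, e2]
    have hr : 0 < t^(s.re-1) := Real.rpow_pos_of_pos ht _
    calc _ ≤ (t^2+|d| *t) * (EX (-(κ*t^2/2)+|d| *t) * t^(s.re-1)) := by gcongr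
      _ = _ := by ring
  · filter_upwards with t y hy
    have hd1 : HD (fun y : RR => cexp (2*y*I)) (cexp (2*y*I) * (2*I)) y := by
      have h0 : HD (fun y : RR => (2*y*I:CC)) (2*I) y := by
        have := ((Complex.ofRealCLM.hasDerivAt (x := y)).const_mul 2).mul_const I
        simpa using this
      exact h0.cexp
    have hd2 : HD (fun y : RR => cexp (y*I)) (cexp (y*I) * I) y := by
      have h0 : HD (fun y : RR => (y*I:CC)) (I) y := by
        have := ((Complex.ofRealCLM.hasDerivAt (x := y))).mul_const I
        simpa using this
      exact h0.cexp
    have hd3 := ((((hd1.mul_const ((t:CC)^2)).div_const 2).neg.add ((hd2.const_mul (d*I)).mul_const (t:CC))).cexp).mul_const ((t:CC)^(s-1))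
    refine hd3.congr_deriv ?_
    unfold gk
    simp only [Pi.add_apply, Pi.neg_apply]
    ring

lemma Gk_rot (d : RR) {s : CC} (hs : 0 < s.re) {φ : RR} (hφ : |φ| < PI/4) :
    Gk 1 (d*I) s = cexp (φ*I*s) * Gk (cexp (2*φ*I)) (d*I*cexp (φ*I)) s := by
  have hW : ∀ y : RR, |y| < PI/4 → HD (fun φ : RR => cexp (φ*I*s) * Gk (cexp (2*φ*I)) (d*I*cexp (φ*I)) s) 0 y := by
    intro y hy
    have hd2 : HD (fun y : RR => cexp (y*I*s)) (cexp (y*I*s) * (I*s)) y := by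
      have h0 : HD (fun y : RR => (y*I*s:CC)) (I*s) y := by
        have := (((Complex.ofRealCLM.hasDerivAt (x := y))).mul_const I).mul_const s
        simpa using this
      exact h0.cexp
    refine (hd2.mul (Gk_rot_deriv d hs hy)).congr_deriv ?_
    have hc : 0 < (cexp (2*y*I)).re := by
      rw [rot_re]; have := abs_lt.1 hy; exact Real.cos_pos_of_mem_Ioo ⟨by linarith, by linarith⟩
    have := Gk_rec (d*I*cexp (y*I)) hc hs
    linear_combination (cexp (y*I*s) * I) * this
  have hconv : Convex RR {y : RR | |y| < PI/4} := by
    have : {y : RR | |y| < PI/4} = Ioo (-(PI/4)) (PI/4) := by ext y; simp [abs_lt]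
    rw [this]; exact convex_Ioo _ _
  have hpi := Real.pi_pos
  have := Convex.norm_image_sub_le_of_norm_hasDerivWithin_le (C := 0)
    (fun y hy => (hW y hy).hasDerivWithinAt) (fun y _ => by simp) hconv
    (show (0:RR) ∈ {y : RR | |y| < PI/4} by simp; positivity) (show φ ∈ {y : RR | |y| < PI/4} from hφ)
  rw [zero_mul] at this
  have h0 := norm_le_zero_iff.1 this
  rw [sub_eq_zero] at h0
  rw [h0]; simp

end

section
open Complex Filter Topology

lemma osc {q : ℕ} [NeZero q] (χ : DC q) {ε : RR} (hε : |ε| = 1) {φ : RR} (hφ : 0 < φ) (T A : RR) :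
    IntegrableOn (fun t : RR => EX (-(φ*(t-T))) * (2 * (logDeriv χ.LFunction (2+((ε*t:RR):CC)*I)).re)) (Ioi A) ∧
    ∫ t in Ioi A, EX (-(φ*(t-T))) * (2 * (logDeriv χ.LFunction (2+((ε*t:RR):CC)*I)).re) ≤ 1.3 * EX (φ*(T-A)) := by
  set f : ℕ → RR → CC := fun n t => (vM n : CC) * χ n * (n:CC)^(-(2+((ε*t:RR):CC)*I)) with hf
  set w : RR → RR := fun t => EX (-(φ*(t-T))) with hw
  have hfs : ∀ t, HasSum (fun n => f n t) (-logDeriv χ.LFunction (2+((ε*t:RR):CC)*I)) := fun t => L_hasSum χ bS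
  have hfn : ∀ n t, ‖f n t‖ ≤ vM n / (n:RR)^2 := fun n t => norm_term_le χ (ε*t) n
  have hfe : ∀ n : ℕ, 2 ≤ n → ∀ t, (w t : CC) * f n t = ((vM n : CC) * χ n * ((n:CC)^2)⁻¹ * cexp (φ*T)) * cexp (-(φ + (ε * LG n : RR)*I) * t) := by
    intro n hn t
    have hn0 : (n:CC) ≠ 0 := by exact_mod_cast (by omega : n ≠ 0)
    have : (n:CC)^(-(2+((ε*t:RR):CC)*I)) = ((n:CC)^2)⁻¹ * cexp (-((ε * LG n : RR)*I) * t) := by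
      rw [neg_add, cpow_add _ _ hn0, cpow_neg, cpow_ofNat]
      congr 1
      rw [cpow_def_of_ne_zero hn0, ← Complex.natCast_log]
      congr 1
      push_cast; ring
    simp only [hf, hw]
    rw [this, Complex.ofReal_exp]
    have e : cexp (((-(φ*(t-T)):RR)):CC) = cexp (φ*T) * cexp (-φ*t) := by
      rw [← Complex.exp_add]; congr 1; push_cast; ring
    have e2 : cexp (-(φ + (ε * LG n : RR)*I) * t) = cexp (-φ*t) * cexp (-((ε * LG n : RR)*I) * t) := by
      rw [← Complex.exp_add]; congr 1; ring
    rw [e, e2]; ring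
  have hf0 : ∀ n : ℕ, n < 2 → ∀ t, f n t = 0 := by
    intro n hn t
    simp only [hf]
    interval_cases n <;> simp
  have hcont : ∀ n, Continuous (f n) := by
    intro n
    rcases lt_or_ge n 2 with h | h
    · have : f n = fun _ => 0 := by ext t; exact hf0 n h t
      rw [this]; exact continuous_const
    · have hn0 : (n:CC) ≠ 0 := by exact_mod_cast (by omega : n ≠ 0)
      simp only [hf]
      refine continuous_const.mul ?_
      refine Continuous.const_cpow (by fun_prop) (Or.inl hn0)
  have hwi : IntegrableOn w (Ioi A) := by
    have := (integrableOn_exp_mul_Ioi (a := -φ) bL A).const_mul (EX (φ*T))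
    refine this.congr (eF fun t => ?_)
    simp only [hw]; rw [← eA]; congr 1; ring
  have hwc : Continuous w := by simp only [hw]; fun_prop
  have hLc : Continuous fun t : RR => logDeriv χ.LFunction (2+((ε*t:RR):CC)*I) := by
    have : (fun t : RR => logDeriv χ.LFunction (2+((ε*t:RR):CC)*I)) = fun t => -∑' n, f n t := by
      ext t; rw [(hfs t).tsum_eq, neg_neg]
    rw [this]
    exact (continuous_tsum hcont vm_summable hfn).neg
  have hLi : IntegrableOn (fun t : RR => EX (-(φ*(t-T))) * (2 * (logDeriv χ.LFunction (2+((ε*t:RR):CC)*I)).re)) (Ioi A) := by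
    refine Integrable.mono' (hwi.const_mul 4) (Continuous.aestronglyMeasurable (hwc.mul (continuous_const.mul (Complex.continuous_re.comp hLc)))) (eF fun t => ?_)
    have h1 := (Complex.abs_re_le_norm _).trans (norm_logDeriv_L_le χ (ε*t))
    rw [norm_mul, rN (eP _).le, Real.norm_eq_abs, abs_mul, abs_two]
    have h2 : 0 < w t := eP _
    have h3 : EX (-(φ*(t-T))) = w t := rfl
    rw [h3]
    nlinarith
  refine ⟨hLi, ?_⟩
  have hFi : ∀ n, Integrable (fun t => (w t:CC) * f n t) (volume.restrict (Ioi A)) := by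
    intro n
    refine Integrable.mono' (hwi.mul_const (vM n / (n:RR)^2)) ?_ (eF fun t => ?_)
    · exact Continuous.aestronglyMeasurable ((Complex.continuous_ofReal.comp hwc).mul (hcont n))
    · rw [norm_mul, cN, rN (eP _).le]
      exact mLL (hfn n t) (eP _).le
  have hFs : Summable fun n => ∫ t in Ioi A, ‖(w t:CC) * f n t‖ := by
    refine Summable.of_nonneg_of_le (fun n => integral_nonneg fun t => norm_nonneg _) (fun n => ?_) (vm_summable.mul_left (∫ t in Ioi A, w t))
    rw [← integral_mul_const]
    refine integral_mono (hFi n).norm (hwi.mul_const _) fun t => ?_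
    simp only
    rw [norm_mul, cN, rN (eP _).le]
    exact mLL (hfn n t) (eP _).le
  have hS := hasSum_integral_of_summable_integral_norm hFi hFs
  have hbd : ∀ n : ℕ, ‖∫ t in Ioi A, (w t:CC) * f n t‖ ≤ EX (φ*(T-A)) * (if n < 2 then 0 else 1/(n:RR)^2) := by
    intro n
    rcases lt_or_ge n 2 with h | h
    · simp [hf0 n h, h]
    · rw [if_neg (by omega)]
      simp only [hfe n h]
      set a : CC := -(φ + (ε * LG n : RR)*I) with ha
      obtain ⟨y, hy⟩ : ∃ y, y = ε * LG n := ⟨_, rfl⟩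
      have hare : a.re = -φ := by rw [ha, ← hy]; simp
      have haim : a.im = -(ε * LG n) := by rw [ha, ← hy]; simp
      have hn1 : (0:RR) < n := by exact_mod_cast (by omega : 0 < n)
      have hlog : 0 < LG n := Real.log_pos (by exact_mod_cast (by omega : 1 < n))
      rw [iC, integral_exp_mul_complex_Ioi (by rw [hare]; linarith), norm_mul, norm_div, norm_neg, Complex.norm_exp]
      have e1 : (a*A).re = -φ*A := by simp [hare]
      have e2 : ‖((vM n : CC) * χ n * ((n:CC)^2)⁻¹ * cexp (φ*T))‖ ≤ LG n * (1/(n:RR)^2) * EX (φ*T) := by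
        rw [norm_mul, norm_mul, norm_mul, Complex.norm_exp, norm_inv, norm_pow, Complex.norm_natCast, cN, rN vN]
        have e3 : ((φ:CC)*T).re = φ*T := by simp
        rw [e3, one_div]
        have := DirichletCharacter.norm_le_one χ (n : ZMod q)
        have h4 : vM n ≤ LG n := ArithmeticFunction.vonMangoldt_le_log
        have : vM n * ‖χ (n : ZMod q)‖ ≤ LG n :=
          (mO vN this).trans h4
        gcongr
      have e4 : LG n ≤ ‖a‖ := by
        refine le_trans ?_ (Complex.abs_im_le_norm a)
        rw [haim, abs_neg, abs_mul, hε, one_mul]; exact le_abs_self _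
      rw [e1]
      calc _ ≤ (LG n * (1/(n:RR)^2) * EX (φ*T)) * (EX (-φ*A) / LG n) := by
            gcongr
        _ = (1/(n:RR)^2) * (EX (φ*T) * EX (-φ*A)) := by field_simp
        _ = _ := by rw [← eA, mul_comm]; congr 2; ring
  have hz : HasSum (fun n : ℕ => if n < 2 then (0:RR) else 1/(n:RR)^2) (PI^2/6 - 1) := by
    have h1 := hasSum_zeta_two
    have h2 : HasSum (fun n : ℕ => if n = 1 then (1:RR) else 0) 1 := hasSum_ite_eq 1 1
    have h3 : (fun n : ℕ => if n < 2 then (0:RR) else 1/(n:RR)^2) = fun n : ℕ => 1/(n:RR)^2 - (if n = 1 then (1:RR) else 0) := by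
      funext n
      rcases lt_trichotomy n 1 with h | h | h
      · interval_cases n; simp
      · subst h; simp
      · rw [if_neg (by omega), if_neg (by omega), sub_zero]
    rw [h3]; exact h1.sub h2
  have hfin := tsum_of_norm_bounded (hz.mul_left (EX (φ*(T-A)))) hbd
  rw [hS.tsum_eq] at hfin
  have e1 : ∀ t : RR, w t * (2 * (logDeriv χ.LFunction (2+((ε*t:RR):CC)*I)).re) = (-2) * ((∑' n, (w t:CC) * f n t)).re := by
    intro t
    rw [tsum_mul_left, (hfs t).tsum_eq, Complex.re_ofReal_mul, Complex.neg_re]; ring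
  have e2 : ∫ t in Ioi A, w t * (2 * (logDeriv χ.LFunction (2+((ε*t:RR):CC)*I)).re) = (-2) * (∫ t in Ioi A, ∑' n, (w t:CC) * f n t).re := by
    simp only [e1]
    rw [iC]
    congr 1
    refine integral_re (f := fun t => ∑' n, (w t:CC) * f n t) (μ := volume.restrict (Ioi A)) ?_
    have : (fun t => ∑' n, (w t:CC) * f n t) = fun t => (w t:CC) * -(logDeriv χ.LFunction (2+((ε*t:RR):CC)*I)) := by
      ext t; rw [tsum_mul_left, (hfs t).tsum_eq]
    rw [this]
    refine Integrable.mono' (hwi.const_mul 2) (Continuous.aestronglyMeasurable ((Complex.continuous_ofReal.comp hwc).mul hLc.neg)) (eF fun t => ?_)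
    rw [norm_mul, norm_neg, cN, rN (eP _).le, mul_comm]
    exact mLR (norm_logDeriv_L_le χ (ε*t)) (eP _).le
  have e3 : ∫ t in Ioi A, EX (-(φ*(t-T))) * (2 * (logDeriv χ.LFunction (2+((ε*t:RR):CC)*I)).re) = ∫ t in Ioi A, w t * (2 * (logDeriv χ.LFunction (2+((ε*t:RR):CC)*I)).re) := rfl
  rw [e3, e2]
  have h5 := (neg_le_abs _).trans ((Complex.abs_re_le_norm _).trans hfin)
  have h6 : PI^2/6 - 1 ≤ 0.65 := by have := pow_le_pow_left₀ Real.pi_pos.le Real.pi_lt_d4.le 2; norm_num at this ⊢; linarith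
  have h7 : EX (φ*(T-A)) * (PI^2/6-1) ≤ EX (φ*(T-A)) * 0.65 := mLL h6 (eP _).le
  linarith


lemma Kf_lower {b : RR} (h0 : 0 < b) (h1 : b < 1) (u : RR) : 0.936 * (3/(9/4+u^2)) ≤ Kf b u := by
  unfold Kf
  have p1 : 0 < (2-b)^2+u^2 := by nlinarith [sq_nonneg u]
  have p2 : 0 < (1+b)^2+u^2 := by nlinarith [sq_nonneg u]
  rw [div_add_div _ _ p1.ne' p2.ne', ← mul_div_assoc, dD bPq bPq]
  obtain ⟨v, hv⟩ : ∃ v, v = u^2 := ⟨_, rfl⟩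
  obtain ⟨P, hP⟩ : ∃ P, P = 2+b-b^2 := ⟨_, rfl⟩
  have hP1 : 0 ≤ P - 2 := by nlinarith
  have hP2 : 0 ≤ 9/4 - P := by nlinarith [sq_nonneg (b-1/2)]
  have hv0 : 0 ≤ v := hv ▸ sq_nonneg u
  have e1 : ((2-b)^2+u^2)*((1+b)^2+u^2) = P^2+(9-2*P)*v+v^2 := by rw [hP, hv]; ring
  have e2 : (2-b)*((1+b)^2+u^2) + ((2-b)^2+u^2)*(1+b) = 3*(P+v) := by rw [hP, hv]; ring
  rw [e1, e2, ← hv]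
  nlinarith [mul_nonneg hP1 hP2, mul_nonneg hP1 (sq_nonneg (9/4+v)), mul_nonneg hP2 (sq_nonneg (v-3.36)), sq_nonneg (v-3.36)]

lemma Kf_window (φ : RR) : ∫ u in (-1.5:RR)..(1.5*√3), (1-φ*u)*(3/(9/4+u^2)) = 7*PI/6 - 1.5*φ*LG 2 := by
  have hd : ∀ u : RR, HD (fun u => 2*Real.arctan (u/1.5) - 1.5*φ*LG (9/4+u^2)) ((1-φ*u)*(3/(9/4+u^2))) u := by
    intro u
    have hp : 9/4+u^2 ≠ 0 := by positivity
    have h1 := (((hasDerivAt_id u).div_const 1.5).arctan).const_mul 2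
    have h2 := ((((hasDerivAt_id u).pow 2).const_add (9/4:RR)).log (by simpa using hp)).const_mul (1.5*φ)
    refine (h1.sub h2).congr_deriv ?_
    simp only [id, Pi.pow_apply]
    have : 1 + (u/1.5)^2 ≠ 0 := by positivity
    field_simp
    ring
  rw [intervalIntegral.integral_eq_sub_of_hasDerivAt (fun t _ => hd t)]
  · have e1 : (1.5*√3)/1.5 = √3 := by ring
    have e2 : (-1.5:RR)/1.5 = -1 := by norm_num
    have e3 : (9/4:RR)+(1.5*√3)^2 = 2*(9/4+(-1.5)^2) := by rw [mul_pow, Real.sq_sqrt bN]; norm_num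
    rw [e1, e2, e3, Real.arctan_sqrt_three, Real.arctan_neg, Real.arctan_one, Real.log_mul bN bN]
    ring
  · apply Continuous.intervalIntegrable
    exact (by fun_prop : Continuous fun u : RR => 1-φ*u).mul (continuous_const.div (by fun_prop) (fun t => by positivity))

lemma int_lin {φ T A : RR} (hφ : 0 < φ) :
    IntegrableOn (fun t => EX (-(φ*(t-T))) * (t-T)) (Ioi A) ∧
    ∫ t in Ioi A, EX (-(φ*(t-T))) * (t-T) = EX (φ*(T-A)) * ((A-T)/φ + 1/φ^2) := by
  have hd : ∀ t ∈ Ici A, HD (fun t => -(EX (-(φ*(t-T))) * ((t-T)/φ+1/φ^2))) (EX (-(φ*(t-T))) * (t-T)) t := by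
    intro t _
    have h1 := ((((hasDerivAt_id t).sub_const T).const_mul φ).neg).exp
    have h2 := (((hasDerivAt_id t).sub_const T).div_const φ).add_const (1/φ^2)
    refine (h1.mul h2).neg.congr_deriv ?_
    simp only [id, Pi.neg_apply]
    field_simp
    ring
  have hl : Tendsto (fun t => -(EX (-(φ*(t-T))) * ((t-T)/φ+1/φ^2))) atTop (𝓝 0) := by
    have h0 : Tendsto (fun t : RR => φ*(t-T)) atTop atTop := (tendsto_atTop_add_const_right _ (-T) tendsto_id).const_mul_atTop hφ
    have h1 := (Real.tendsto_pow_mul_exp_neg_atTop_nhds_zero 1).comp h0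
    have h2 := (Real.tendsto_pow_mul_exp_neg_atTop_nhds_zero 0).comp h0
    have := ((h1.add h2).const_mul (1/φ^2)).neg
    simp only [add_zero, mul_zero, neg_zero] at this
    refine this.congr fun t => ?_
    simp only [Function.comp]
    field_simp
  have hi : IntegrableOn (fun t => EX (-(φ*(t-T))) * (t-T)) (Ioi A) := by
    have h1 : IntegrableOn (fun t => EX (-(φ/2)*t)) (Ioi A) := integrableOn_exp_mul_Ioi bL A
    refine Integrable.mono' (h1.const_mul (EX (φ/2*T) * ((2/φ)*EX (φ*|A-T|)))) (by apply Continuous.aestronglyMeasurable; fun_prop) ?_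
    filter_upwards [ae_restrict_mem mI] with t ht
    have ht' : A < t := ht
    rw [norm_mul, rN (eP _).le, Real.norm_eq_abs]
    have e : EX (φ/2*T) * ((2/φ)*EX (φ*|A-T|)) * EX (-(φ/2)*t) = EX (-(φ*(t-T))) * ((2/φ) * EX (φ/2*(t-T)+φ*|A-T|)) := by
      rw [show EX (φ/2*T) * ((2/φ)*EX (φ*|A-T|)) * EX (-(φ/2)*t) = (2/φ) * (EX (φ/2*T)*EX (φ*|A-T|)*EX (-(φ/2)*t)) by ring,
       show EX (-(φ*(t-T))) * ((2/φ) * EX (φ/2*(t-T)+φ*|A-T|)) = (2/φ) * (EX (-(φ*(t-T))) * EX (φ/2*(t-T)+φ*|A-T|)) by ring, ← eA, ← eA, ← eA]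
      congr 2; ring
    rw [e]
    refine mLL ?_ (eP _).le
    have h2 := Real.add_one_le_exp (φ/2*(t-T)+φ*|A-T|)
    have h3 : φ/2*|t-T| ≤ φ/2*(t-T)+φ*|A-T| := by
      rcases abs_cases (t-T) with ⟨h, _⟩ | ⟨h, _⟩ <;> rw [h]
      · have := mul_nonneg hφ.le (abs_nonneg (A-T)); linarith
      · have := neg_le_abs (A-T); nlinarith
    have h4 : |t-T| = (2/φ)*(φ/2*|t-T|) := by field_simp
    rw [h4]
    exact mLL bL bPq
  refine ⟨hi, ?_⟩
  rw [integral_Ioi_of_hasDerivAt_of_tendsto' hd hi hl]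
  rw [show -(φ*(A-T)) = φ*(T-A) by ring]
  ring

end

section
open Complex Filter Topology

lemma Kf_even {ε : RR} (hε : |ε| = 1) (b u : RR) : Kf b (ε*u) = Kf b u := by
  unfold Kf
  have : (ε*u)^2 = u^2 := by rw [mul_pow, ← sq_abs ε, hε]; ring
  rw [this]

lemma zsum {q : ℕ} [NeZero q] {χ : DC q} (hχ : χ.IsPrimitive) {ε : RR} (hε : |ε| = 1) {φ T : RR}
    (hφ : 0 < φ) (hφ1 : φ ≤ 0.2824) (hT : 100 ≤ T) (F : Finset CC) (hF : ∀ ρ ∈ F, T < ε*ρ.im) :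
    (3.43-0.974*φ) * ∑ ρ ∈ F, mz χ ρ * EX (-(φ*(ε*ρ.im-T))) ≤
      EX (1.5*φ)/φ * (LG (q*T/(2*PI)) + 0.022 + 1/(φ*T) + 1.3*φ) := by
  have hq : (0:RR) < q := by exact_mod_cast NeZero.pos q
  have hp := Real.pi_pos
  have hε2 : ε*ε = 1 := by rw [← abs_mul_abs_self, hε]; norm_num
  set w : RR → RR := fun t => EX (-(φ*(t-T))) with hw
  have hw0 : ∀ t, 0 < w t := fun t => eP _
  have hwc : Continuous w := by simp only [hw]; fun_prop
  set l : RR := LG (q*T/(2*PI)) with hl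
  set A := T - 1.5 with hA
  obtain ⟨o1, o2⟩ := osc χ hε hφ T A
  obtain ⟨l1, l2⟩ := int_lin (T := T) (A := A) hφ
  have hwi : IntegrableOn w (Ioi A) := by
    have := (integrableOn_exp_mul_Ioi (a := -φ) bL A).const_mul (EX (φ*T))
    refine this.congr (eF fun t => ?_)
    simp only [hw]; rw [← eA]; congr 1; ring
  have hwI : ∫ t in Ioi A, w t = EX (1.5*φ)/φ := by
    have := integral_exp_mul_Ioi (a := -φ) bL A
    have e : ∀ t, w t = EX (φ*T) * EX (-φ*t) := by
      intro t; simp only [hw]; rw [← eA]; congr 1; ring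
    simp only [e]
    rw [iC, this, neg_div_neg_eq, ← mul_div_assoc, ← eA]
    congr 2; rw [hA]; ring
  set R : RR → RR := fun t => w t * (l+0.022) + (w t * (t-T)) * (1/T) + w t * (2 * (logDeriv χ.LFunction (2+((ε*t:RR):CC)*I)).re) with hR
  have hRi : IntegrableOn R (Ioi A) := ((hwi.mul_const _).add (l1.mul_const _)).add o1
  have hRI : ∫ t in Ioi A, R t ≤ EX (1.5*φ)/φ * (l + 0.022 + 1/(φ*T) + 1.3*φ) := by
    simp only [hR]
    have i1 : IntegrableOn (fun t => w t * (l+0.022)) (Ioi A) := hwi.mul_const _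
    have i2 : IntegrableOn (fun t => (w t * (t-T)) * (1/T)) (Ioi A) := l1.mul_const _
    have i12 : IntegrableOn (fun t => w t * (l+0.022) + (w t * (t-T)) * (1/T)) (Ioi A) := i1.add i2
    have i3 : IntegrableOn (fun t => w t * (2 * (logDeriv χ.LFunction (2+((ε*t:RR):CC)*I)).re)) (Ioi A) := o1
    rw [integral_add i12 i3, integral_add i1 i2, integral_mul_const, integral_mul_const, hwI]
    have e0 : φ*(T-A) = 1.5*φ := by rw [hA]; ring
    have l2' : ∫ t in Ioi A, w t * (t-T) = EX (φ*(T-A)) * ((A-T)/φ + 1/φ^2) := l2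
    have o2' : ∫ t in Ioi A, w t * (2 * (logDeriv χ.LFunction (2+((ε*t:RR):CC)*I)).re) ≤ 1.3 * EX (φ*(T-A)) := o2
    rw [e0] at l2' o2'
    rw [l2']
    have e1 : EX (1.5*φ) * ((A-T)/φ + 1/φ^2) * (1/T) ≤ EX (1.5*φ) * (1/φ^2) * (1/T) := by
      have : (A-T)/φ ≤ 0 := div_nonpos_of_nonpos_of_nonneg (by rw [hA]; linarith) hφ.le
      gcongr
      linarith
    have e2 : EX (1.5*φ)/φ * (l + 0.022 + 1/(φ*T) + 1.3*φ) = EX (1.5*φ)/φ * (l+0.022) + EX (1.5*φ) * (1/φ^2) * (1/T) + 1.3 * EX (1.5*φ) := by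
      field_simp
    rw [e2]
    linarith
  set g : CC → RR → RR := fun ρ t => w t * (mz χ ρ * Kf ρ.re (ε*t - ρ.im)) with hg
  have hg0 : ∀ ρ t, 0 ≤ g ρ t := by
    intro ρ t
    refine mul_nonneg (hw0 t).le ?_
    by_cases h : mz χ ρ = 0
    · simp [h]
    exact mul_nonneg (mz_nonneg _ _) (Kf_pos (mz_re hχ h).1 (mz_re hχ h).2).le
  have hgc : ∀ ρ, Continuous (g ρ) := by
    intro ρ
    by_cases h : mz χ ρ = 0
    · have : g ρ = fun _ => 0 := by ext t; simp [hg, h]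
      rw [this]; exact continuous_const
    obtain ⟨h0, h1⟩ := mz_re hχ h
    refine hwc.mul (continuous_const.mul ?_)
    unfold Kf
    refine Continuous.add (continuous_const.div (by fun_prop) fun t => ?_) (continuous_const.div (by fun_prop) fun t => ?_)
    · have : 0 < 2 - ρ.re := by linarith
      positivity
    · positivity
  have hle : ∀ F : Finset CC, ∀ t ∈ Ioi A, ∑ ρ ∈ F, g ρ t ≤ R t := by
    intro F t ht
    have ht' : T - 1.5 < t := ht
    have habs : |ε*t| = t := by rw [abs_mul, hε, one_mul, abs_of_pos bL]
    have h1 := (Kf_sum_le hχ F (ε*t)).trans (Dt_le_high hχ (t := ε*t) (by rw [habs]; linarith))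
    rw [habs] at h1
    have h2 : LG (q*t/(2*PI)) ≤ l + (t-T)*(1/T) := by
      have e : q*t/(2*PI) = (q*T/(2*PI)) * (t/T) := by field_simp
      have : 0 < t/T := div_pos bL bL
      rw [e, Real.log_mul bPq this.ne']
      have h3 := lO this
      have : t/T - 1 = (t-T)*(1/T) := by field_simp
      linarith
    have h3 : R t = w t * (l + (t-T)*(1/T) + 0.022 + 2 * (logDeriv χ.LFunction (2+((ε*t:RR):CC)*I)).re) := by
      simp only [hR]; ring
    rw [h3]
    simp only [hg]
    rw [← Finset.mul_sum]
    refine mLL ?_ (hw0 t).le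
    linarith
  have hgi : ∀ ρ, IntegrableOn (g ρ) (Ioi A) := by
    intro ρ
    refine Integrable.mono' hRi (hgc ρ).aestronglyMeasurable ?_
    filter_upwards [ae_restrict_mem mI] with t ht
    rw [rN (hg0 ρ t)]
    simpa using hle {ρ} t ht
  have hmain : ∑ ρ ∈ F, ∫ t in Ioi A, g ρ t ≤ ∫ t in Ioi A, R t := by
    rw [← integral_finsetSum _ (fun ρ _ => hgi ρ)]
    refine setIntegral_mono_on (integrable_finsetSum _ fun ρ _ => hgi ρ) hRi mI (hle F)
  refine le_trans ?_ (hmain.trans hRI)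
  rw [Finset.mul_sum]
  refine Finset.sum_le_sum fun ρ hρ => ?_
  by_cases h : mz χ ρ = 0
  · have : g ρ = fun _ => 0 := by ext t; simp [hg, h]
    simp [this, h]
  obtain ⟨h0, h1⟩ := mz_re hχ h
  set γ := ε*ρ.im with hγ
  have hs3 : √3 ≤ 1.7321 := by rw [Real.sqrt_le_left bN]; norm_num
  have hs30 : 0 ≤ √3 := sN 3
  have hγT := hF ρ hρ
  calc (3.43-0.974*φ) * (mz χ ρ * EX (-(φ*(γ-T)))) ≤ ∫ u in (-1.5:RR)..(1.5*√3), (mz χ ρ * EX (-(φ*(γ-T))) * 0.936) * ((1-φ*u)*(3/(9/4+u^2))) := by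
        rw [intervalIntegral.integral_const_mul, Kf_window]
        have : 3.43-0.974*φ ≤ 0.936*(7*PI/6 - 1.5*φ*LG 2) := by
          have := Real.pi_gt_d4
          have := Real.log_two_lt_d9
          nlinarith
        have h3 := mLL this (mul_nonneg (mz_nonneg χ ρ) (eP (-(φ*(γ-T)))).le)
        linarith
    _ ≤ ∫ u in (-1.5:RR)..(1.5*√3), g ρ (u+γ) := by
        refine intervalIntegral.integral_mono_on bL ?_ ?_ ?_
        · apply Continuous.intervalIntegrable
          exact continuous_const.mul ((by fun_prop : Continuous fun u : RR => 1-φ*u).mul (continuous_const.div (by fun_prop) (fun t => by positivity)))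
        · apply Continuous.intervalIntegrable
          exact (hgc ρ).comp (by fun_prop)
        · intro u hu
          simp only [hg]
          have e1 : ε*(u+γ) - ρ.im = ε*u := by rw [hγ, mul_add, ← mul_assoc, hε2]; ring
          have e2 : w (u+γ) = EX (-(φ*(γ-T))) * EX (-(φ*u)) := by
            simp only [hw]; rw [← eA]; congr 1; ring
          rw [e1, Kf_even hε, e2]
          have h3 := Kf_lower h0 h1 u
          have h4 := Real.add_one_le_exp (-(φ*u))
          have h5 : 0 ≤ 1-φ*u := by nlinarith [hu.2]
          have h6 : (1-φ*u)*(0.936*(3/(9/4+u^2))) ≤ EX (-(φ*u)) * Kf ρ.re u :=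
            mul_le_mul bL h3 bPq (eP _).le
          have h7 := mLL h6 (mul_nonneg (mz_nonneg χ ρ) (eP (-(φ*(γ-T)))).le)
          linarith
    _ = ∫ t in (-1.5+γ)..(1.5*√3+γ), g ρ t := intervalIntegral.integral_comp_add_right (g ρ) γ
    _ = ∫ t in Ioc (-1.5+γ) (1.5*√3+γ), g ρ t := intervalIntegral.integral_of_le bL
    _ ≤ ∫ t in Ioi A, g ρ t := by
        refine setIntegral_mono_set (hgi ρ) (eF fun t => hg0 ρ t) (LE.le.eventuallyLE fun t ht => ?_)
        have := ht.1
        simp only [mem_Ioi, hA]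
        linarith
end

section
open Complex Filter Topology

noncomputable def Jr (c a σ : RR) : RR := ∫ r in Ip, EX (-(c*r^2/2) + a*r) * r^(σ-1)

lemma Gk_rot_signed (d : RR) {s : CC} (hs : 0 < s.re) {ε φ : RR} (hε : |ε| = 1) (hφ0 : 0 ≤ φ) (hφ : φ < PI/4) :
    ‖Gk 1 (d*I) s‖ ≤ EX (-(φ*(ε*s.im))) * Jr (CS (2*φ)) (-(d*ε)*SN φ) s.re := by
  have hψ : |ε*φ| = φ := by rw [abs_mul, hε, one_mul, abs_of_nonneg hφ0]
  rw [Gk_rot d hs (φ := ε*φ) (by rw [hψ]; exact hφ), norm_mul]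
  have e1 : ‖cexp (((ε*φ:RR):CC)*I*s)‖ = EX (-(φ*(ε*s.im))) := by
    rw [Complex.norm_exp]; congr 1; simp; ring
  rw [e1]
  have hcos : CS (2*(ε*φ)) = CS (2*φ) := by
    rw [← Real.cos_abs (2*(ε*φ)), abs_mul, abs_two, hψ]
  have hsin : SN (ε*φ) = ε*SN φ := by
    rcases eq_or_eq_neg_of_abs_eq hε with h | h <;> rw [h] <;> simp
  refine mLL ((Gk_norm_le).trans (le_of_eq ?_)) (eP _).le
  rw [rot_re, rot_b_re, hcos, hsin, Jr]
  congr 1; ext r; congr 3; ring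

lemma Jr_mono {c a b σ : RR} (hc : 0 < c) (hσ : 0 < σ) (h : a ≤ b) : Jr c a σ ≤ Jr c b σ := by
  refine setIntegral_mono_on (real_gauss_int _ hc hσ) (real_gauss_int _ hc hσ) mI fun r hr => ?_
  have hr : 0 < r := hr
  have : 0 < r^(σ-1) := Real.rpow_pos_of_pos hr _
  gcongr

lemma gshift {κ : RR} (hκ : 0 < κ) (μ : RR) : Integrable (fun r : RR => EX (-κ*(r-μ)^2)) ∧
    ∫ r : RR, EX (-κ*(r-μ)^2) = √(PI/κ) :=
  ⟨(integrable_exp_neg_mul_sq hκ).comp_sub_right μ, by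
    rw [integral_sub_right_eq_self (fun r : RR => EX (-κ*r^2)), integral_gaussian]⟩

lemma gexp {c : RR} (hc : 0 < c) (a r : RR) : EX (-(c*r^2/2) + a*r) = EX (a^2/(2*c)) * EX (-(c/2)*(r-a/c)^2) := by
  rw [← eA]; congr 1; field_simp; ring

lemma gexp_int {c : RR} (hc : 0 < c) (a : RR) : Integrable (fun r : RR => EX (-(c*r^2/2) + a*r)) ∧
    ∫ r : RR, EX (-(c*r^2/2) + a*r) = √(2*PI/c) * EX (a^2/(2*c)) := by
  obtain ⟨h1, h2⟩ := gshift (show 0 < c/2 by positivity) (a/c)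
  simp only [gexp hc]
  refine ⟨h1.const_mul _, ?_⟩
  rw [iC, h2, mul_comm]; congr 2; field_simp

lemma Jr_bound1 {c a σ : RR} (hc : 0 < c) (h1 : 1/2 ≤ σ) (h2 : σ ≤ 1) :
    Jr c a σ ≤ 2 * EX (max a 0) + √(2*PI/c) * EX (a^2/(2*c)) := by
  obtain ⟨i1, i2⟩ := gexp_int hc a
  have hp : IntervalIntegrable (fun r : RR => r^(-(1/2):RR)) volume 0 1 := intervalIntegral.intervalIntegrable_rpow' bN
  have hp2 : IntegrableOn (fun r : RR => EX (max a 0) * r^(-(1/2):RR)) (Ioc 0 1) :=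
    ((iO zO).1 hp).const_mul _
  have hp3 : ∫ r in Ioc (0:RR) 1, EX (max a 0) * r^(-(1/2):RR) = 2 * EX (max a 0) := by
    rw [iC, ← intervalIntegral.integral_of_le zO, integral_rpow (Or.inl bN)]
    norm_num; ring
  have hi3 : IntegrableOn (fun r => (Ioc (0:RR) 1).indicator (fun r : RR => EX (max a 0) * r^(-(1/2):RR)) r) (Ioi 0) :=
    ((integrable_indicator_iff mC).2 hp2).integrableOn
  have hsub : ∫ r in Ip, (Ioc (0:RR) 1).indicator (fun r : RR => EX (max a 0) * r^(-(1/2):RR)) r = 2 * EX (max a 0) := by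
    rw [setIntegral_indicator mC, inter_eq_right.2 (fun r hr => hr.1), hp3]
  have hJ : Jr c a σ ≤ ∫ r in Ip, ((Ioc (0:RR) 1).indicator (fun r : RR => EX (max a 0) * r^(-(1/2):RR)) r + EX (-(c*r^2/2) + a*r)) := by
    refine setIntegral_mono_on (real_gauss_int _ hc bL) (hi3.add i1.integrableOn) mI fun r hr => ?_
    have hr : 0 < r := hr
    rcases le_or_gt r 1 with h | h
    · have hm : r ∈ Ioc (0:RR) 1 := ⟨hr, h⟩
      rw [indicator_of_mem hm]
      have e1 : EX (-(c*r^2/2) + a*r) ≤ EX (max a 0) := by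
        apply Real.exp_le_exp.2
        have : a*r ≤ max a 0 := by
          have h5 : a*r ≤ max a 0 * r := mLR (le_max_left _ _) hr.le
          have h6 : max a 0 * r ≤ max a 0 * 1 := mLL h (le_max_right _ _)
          linarith
        have : 0 ≤ c*r^2/2 := by positivity
        linarith
      have e2 : r^(σ-1) ≤ r^(-(1/2):RR) := Real.rpow_le_rpow_of_exponent_ge hr h bL
      have := mul_le_mul e1 e2 (Real.rpow_pos_of_pos hr _).le (eP _).le
      have := eP (-(c*r^2/2) + a*r)
      linarith
    · rw [indicator_of_notMem (fun h' => absurd h'.2 (not_le.2 h)), zero_add]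
      refine mO (eP _).le ?_
      exact Real.rpow_le_one_of_one_le_of_nonpos h.le bL
  rw [integral_add hi3 i1.integrableOn, hsub] at hJ
  have : ∫ r in Ip, EX (-(c*r^2/2) + a*r) ≤ ∫ r, EX (-(c*r^2/2) + a*r) :=
    setIntegral_le_integral i1 (eF fun r => (eP _).le)
  linarith

lemma Jr_bound2 {c a σ D : RR} (hc : 0 < c) (ha : 0 ≤ a) (hD : 0 ≤ D) (h1 : 0 < σ) (h2 : σ ≤ 1) :
    Jr c a (σ+2) + D * Jr c a (σ+1) ≤ √(2*PI/c) * EX (a^2/(2*c)) *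
      (1 + 2*(a/c)^2 + D*(1.5+a/c) + (2+D/2)*(4/c)*√2) := by
  set μ := a/c with hμ
  have hμ0 : 0 ≤ μ := by positivity
  obtain ⟨i1, e1⟩ := gshift (show 0 < c/2 by positivity) μ
  obtain ⟨i2, e2⟩ := gshift (show 0 < c/4 by positivity) μ
  have s1 : √(PI/(c/2)) = √(2*PI/c) := by congr 1; field_simp
  have s2 : √(PI/(c/4)) = √(2*PI/c) * √2 := by
    rw [← Real.sqrt_mul bPq]; congr 1; field_simp; norm_num
  rw [s1] at e1; rw [s2] at e2
  set K := 1 + 2*μ^2 + D*(1.5+μ) with hK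
  have hK0 : 0 ≤ K := by positivity
  have j2 := real_gauss_int a hc (σ := σ+2) bL
  have j1 := real_gauss_int a hc (σ := σ+1) bL
  set W : RR → RR := fun r => EX (a^2/(2*c)) * (K * EX (-(c/2)*(r-μ)^2) + ((2+D/2)*(4/c)) * EX (-(c/4)*(r-μ)^2)) with hW
  have iW : Integrable W := ((i1.const_mul K).add (i2.const_mul _)).const_mul _
  have eW : ∫ r, W r = √(2*PI/c) * EX (a^2/(2*c)) * (K + (2+D/2)*(4/c)*√2) := by
    simp only [hW]
    rw [iC, integral_add (i1.const_mul K) (i2.const_mul _), iC, iC, e1, e2]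
    ring
  rw [← eW]
  have h3 : ∫ r in Ip, W r ≤ ∫ r, W r :=
    setIntegral_le_integral iW (eF fun r => by simp only [hW, Pi.zero_apply]; positivity)
  refine le_trans ?_ h3
  rw [Jr, Jr, ← iC, ← integral_add j2 (j1.const_mul D)]
  refine setIntegral_mono_on (j2.add (j1.const_mul D)) iW.integrableOn mI fun r hr => ?_
  have hr : 0 < r := hr
  simp only [hW]
  rw [gexp hc, ← hμ]
  set v := r - μ with hv
  have p1 : r^(σ+1-1) ≤ 1 + r := by
    rw [show σ+1-1 = σ by ring]
    rcases le_total r 1 with h | h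
    · have := Real.rpow_le_one hr.le h h1.le; linarith
    · have := rE h h2; rw [Real.rpow_one] at this; linarith
  have p2 : r^(σ+2-1) ≤ 1 + r^2 := by
    rw [show σ+2-1 = σ+1 by ring]
    rcases le_total r 1 with h | h
    · have := Real.rpow_le_one hr.le h (show 0 ≤ σ+1 by linarith); nlinarith
    · have := rE h (show σ+1 ≤ 2 by linarith); rw [Real.rpow_two] at this; linarith
  have hrv : r = μ + v := by rw [hv]; ring
  have p3 : r^(σ+2-1) + D * r^(σ+1-1) ≤ K + (2+D/2)*v^2 := by
    have q1 : 1 + r^2 ≤ 1 + 2*μ^2 + 2*v^2 := by rw [hrv]; nlinarith [sq_nonneg (μ-v)]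
    have q2 : 1 + r ≤ 1.5 + μ + v^2/2 := by rw [hrv]; nlinarith [sq_nonneg (v-1)]
    have := mLL (p1.trans q2) hD
    rw [hK]; linarith
  have p4 : v^2 * EX (-(c/2)*v^2) ≤ (4/c) * EX (-(c/4)*v^2) := by
    have := Real.add_one_le_exp (c/4*v^2)
    have h5 : v^2 ≤ (4/c) * EX (c/4*v^2) := by
      have : v^2 = (4/c)*(c/4*v^2) := by field_simp
      rw [this]; refine mLL ?_ bPq
      rw [← this]; linarith
    have h6 : EX (-(c/4)*v^2) = EX (c/4*v^2) * EX (-(c/2)*v^2) := by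
      rw [← eA]; congr 1; ring
    rw [h6, ← mul_assoc]
    exact mLR h5 (eP _).le
  have E1 := eP (a^2/(2*c))
  have E2 := eP (-(c/2)*v^2)
  have q3 := mLL p3 E2.le
  have q4 := mLL p4 (show 0 ≤ 2+D/2 by positivity)
  have q5 : EX (-(c/2)*v^2) * (r^(σ+2-1) + D * r^(σ+1-1)) ≤ K * EX (-(c/2)*v^2) + ((2+D/2)*(4/c)) * EX (-(c/4)*v^2) := by
    linarith
  have q6 := mLL q5 E1.le
  linarith

end

section
open Complex Filter Topology ComplexConjugate

lemma half_sum {q : ℕ} [NeZero q] {χ : DC q} (hχ : χ.IsPrimitive) {ε φ T Z : RR}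
    (hZ : ∀ F : Finset CC, (∀ ρ ∈ F, T < ε*ρ.im) → ∑ ρ ∈ F, mz χ ρ * EX (-(φ*(ε*ρ.im-T))) ≤ Z)
    (F : Finset CC) (hF : ∀ ρ ∈ F, T < ε*ρ.im) (hF2 : ∀ ρ ∈ F, 1/2 < ρ.re) :
    ∑ ρ ∈ F, mz χ ρ * EX (-(φ*(ε*ρ.im-T))) ≤ 1/2*Z := by
  classical
  set s : CC → CC := fun ρ => 1 - conj ρ with hs
  have hinj : Function.Injective s := by
    intro a b h
    simp only [hs, sub_right_inj] at h
    exact (starRingEnd CC).injective h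
  have him : ∀ ρ, (s ρ).im = ρ.im := by intro ρ; simp [hs]
  have hdis : Disjoint F (F.image s) := by
    rw [Finset.disjoint_left]
    intro a ha hb
    obtain ⟨b, hb', rfl⟩ := Finset.mem_image.1 hb
    have h1 := hF2 _ ha
    have h2 := hF2 _ hb'
    simp [hs] at h1
    linarith
  have h := hZ (F ∪ F.image s) (by
    intro ρ hρ
    rcases Finset.mem_union.1 hρ with h | h
    · exact hF ρ h
    · obtain ⟨b, hb, rfl⟩ := Finset.mem_image.1 h
      rw [him]; exact hF b hb)
  rw [Finset.sum_union hdis, Finset.sum_image (fun a _ b _ h => hinj h)] at h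
  have e : ∑ ρ ∈ F, mz χ (s ρ) * EX (-(φ*(ε*(s ρ).im-T))) = ∑ ρ ∈ F, mz χ ρ * EX (-(φ*(ε*ρ.im-T))) := by
    refine Finset.sum_congr rfl fun ρ _ => ?_
    rw [him, mz_sym hχ]
  rw [e] at h
  linarith

lemma high_sign {q : ℕ} [NeZero q] {χ : DC q} (hχ : χ.IsPrimitive) {ε φ T Z B x d : RR} (hε : |ε| = 1)
    (hZ : ∀ F : Finset CC, (∀ ρ ∈ F, T < ε*ρ.im) → ∑ ρ ∈ F, mz χ ρ * EX (-(φ*(ε*ρ.im-T))) ≤ Z)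
    (hφ : 0 < φ) (hφ1 : φ ≤ 0.2824) (hT : 100 ≤ T) (hd : 6.28 * |d| ≤ T) (hdφ : d^2*φ ≤ 0.753*T) (hx : 1 ≤ x) (hc84 : 0.84 ≤ CS (2*φ))
    (hB0 : 0 ≤ B) (hB : ∀ σ : RR, 1/2 ≤ σ → σ ≤ 1 → Jr (CS (2*φ)) (-(d*ε)*SN φ) σ ≤ B)
    (F : Finset CC) (hF : ∀ ρ ∈ F, T < ε*ρ.im) :
    ∑ ρ ∈ F, mz χ ρ * (x^ρ.re * ‖Gk 1 (d*I) ρ‖) ≤ EX (-(φ*T)) * (x*(1/2*Z*B) +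
      √x*(Z*(3*(√(2*PI/CS (2*φ)) * EX ((|d| * SN φ)^2/(2*CS (2*φ))))))) := by
  set c := CS (2*φ) with hc
  set a := |d| * SN φ with ha
  set N := √(2*PI/c) * EX (a^2/(2*c)) with hN
  have hc0 : 0 < c := by linarith
  have hpi := Real.pi_gt_d2
  have hN0 : 0 < N := by positivity
  have hsin0 : 0 ≤ SN φ := Real.sin_nonneg_of_nonneg_of_le_pi hφ.le bL
  have hsin1 : SN φ ≤ φ := Real.sin_le hφ.le
  have ha0 : 0 ≤ a := by positivity
  set D := |d| with hD
  have hD0 : 0 ≤ D := abs_nonneg d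
  have hDd : D^2 = d^2 := sq_abs d
  set μ := a/c with hμ
  have hμ0 : 0 ≤ μ := by positivity
  have hμφ : μ ≤ 1.191*(D*φ) := by
    rw [hμ, ha, dI hc0]
    have h1 := mLL hsin1 hD0
    have h2 := mLL hc84 (show 0 ≤ 1.191*(D*φ) by positivity)
    have h3 : 0 ≤ D*φ := by positivity
    linarith
  have hDμ : D*μ ≤ 0.897*T := by
    have := mLL hμφ hD0
    have e : D*(1.191*(D*φ)) = 1.191*(d^2*φ) := by rw [← hDd]; ring
    linarith
  have hμD : μ ≤ 0.3364*D := by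
    have := mLL hφ1 hD0
    linarith
  have hB2 : ∀ σ : RR, 0 < σ → σ ≤ 1 → Jr c a (σ+2) + D * Jr c a (σ+1) ≤ N*(3*T) := by
    intro σ h1 h2
    refine (Jr_bound2 hc0 ha0 hD0 h1 h2).trans ?_
    rw [← hN, ← hμ]
    refine mLL ?_ hN0.le
    have hs2 : √2 ≤ 1.4143 := by rw [Real.sqrt_le_left bN]; norm_num
    have h4 : (4/c)*√2 ≤ 6.735 := by
      have : 4/c ≤ 4/0.84 := by gcongr
      have := mul_le_mul this hs2 (sN 2) bN
      norm_num at this ⊢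
      linarith
    have h5 := mLL h4 (show 0 ≤ 2+D/2 by positivity)
    have h6 : μ^2 ≤ 0.3364*(D*μ) := by nlinarith
    linarith
  have hpt : ∀ ρ ∈ F, mz χ ρ * (x^ρ.re * ‖Gk 1 (d*I) ρ‖) ≤ EX (-(φ*T)) * (x*B*(if 1/2 < ρ.re then mz χ ρ * EX (-(φ*(ε*ρ.im-T))) else 0) + √x*(3*N)*(mz χ ρ * EX (-(φ*(ε*ρ.im-T))))) := by
    intro ρ hρ
    by_cases h : mz χ ρ = 0
    · simp [h]
    obtain ⟨h0, h1⟩ := mz_re hχ h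
    have hm := mz_nonneg χ ρ
    set w := EX (-(φ*(ε*ρ.im-T))) with hw
    have hw0 : 0 < w := eP _
    have hew : EX (-(φ*(ε*ρ.im))) = EX (-(φ*T)) * w := by
      rw [hw, ← eA]; congr 1; ring
    have hφ4 : φ < PI/4 := by linarith
    split_ifs with h2
    · have h3 := Gk_rot_signed d h0 hε hφ.le hφ4
      rw [hew] at h3
      have h4 : x^ρ.re ≤ x := by
        have := rE hx h1.le; rwa [Real.rpow_one] at this
      have h5 : ‖Gk 1 (d*I) ρ‖ ≤ EX (-(φ*T)) * w * B :=
        h3.trans (mLL (hB _ h2.le h1.le) bPq)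
      have h6 := mul_le_mul h4 h5 (norm_nonneg _) bL
      have h7 := mLL h6 hm
      have h8 : 0 ≤ EX (-(φ*T)) * (√x*(3*N)*(mz χ ρ * w)) := by positivity
      linarith
    · have h4 : x^ρ.re ≤ √x := by
        rw [Real.sqrt_eq_rpow]; exact rE hx (not_lt.1 h2)
      have hrec := Gk_rec (c := 1) (d*I) bS h0
      have g2 := Gk_rot_signed d (s := ρ+2) (by simp; linarith) hε hφ.le hφ4
      have g1 := Gk_rot_signed d (s := ρ+1) (by simp; linarith) hε hφ.le hφ4
      simp only [add_re, add_im, re_ofNat, im_ofNat, one_re, one_im, add_zero] at g1 g2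
      rw [hew] at g1 g2
      have hle : -(d*ε)*SN φ ≤ a := by
        rw [ha]; refine mLR ?_ hsin0
        refine (neg_le_abs _).trans ?_
        rw [abs_mul, hε, mul_one]
      have g2' := g2.trans (mLL (Jr_mono (σ := ρ.re+2) hc0 bL hle) bPq)
      have g1' := g1.trans (mLL (Jr_mono (σ := ρ.re+1) hc0 bL hle) bPq)
      have hTn : T ≤ ‖ρ‖ := by
        refine le_trans ?_ (abs_im_le_norm ρ)
        refine (hF ρ hρ).le.trans ((le_abs_self _).trans ?_)
        rw [abs_mul, hε, one_mul]
      have hn : ‖ρ‖ * ‖Gk 1 (d*I) ρ‖ ≤ ‖Gk 1 (d*I) (ρ+2)‖ + D * ‖Gk 1 (d*I) (ρ+1)‖ := by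
        rw [← norm_mul, hrec]
        refine (norm_sub_le _ _).trans (le_of_eq ?_)
        rw [norm_mul, norm_mul, norm_mul, norm_one, norm_I, cN, Real.norm_eq_abs]
        ring
      have h5 : T * ‖Gk 1 (d*I) ρ‖ ≤ EX (-(φ*T)) * w * (N*(3*T)) := by
        calc T * ‖Gk 1 (d*I) ρ‖ ≤ ‖ρ‖ * ‖Gk 1 (d*I) ρ‖ := by gcongr
          _ ≤ _ := hn
          _ ≤ EX (-(φ*T)) * w * (Jr c a (ρ.re+2) + D * Jr c a (ρ.re+1)) := by
              have := mLL g1' hD0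
              linarith
          _ ≤ _ := mLL (hB2 _ h0 h1.le) bPq
      have h6 : ‖Gk 1 (d*I) ρ‖ ≤ EX (-(φ*T)) * w * (N*3) := by
        refine le_of_mul_le_mul_left ?_ (show 0 < T by linarith)
        linarith
      have h7 := mul_le_mul h4 h6 (norm_nonneg _) (sN x)
      have h8 := mLL h7 hm
      linarith
  refine (Finset.sum_le_sum hpt).trans ?_
  rw [← Finset.mul_sum, Finset.sum_add_distrib, ← Finset.mul_sum, ← Finset.mul_sum]
  refine mLL ?_ (eP _).le
  have t1 : ∑ ρ ∈ F, (if 1/2 < ρ.re then mz χ ρ * EX (-(φ*(ε*ρ.im-T))) else 0) ≤ 1/2*Z := by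
    rw [← Finset.sum_filter]
    exact half_sum hχ hZ _ (fun ρ h => hF ρ (Finset.mem_filter.1 h).1) (fun ρ h => (Finset.mem_filter.1 h).2)
  have t2 := hZ F hF
  have t3 := mLL t1 (show 0 ≤ x*B by positivity)
  have t4 := mLL t2 (show 0 ≤ √x*(3*N) by positivity)
  linarith

lemma high_zeros {q : ℕ} [NeZero q] {χ : DC q} (hχ : χ.IsPrimitive) {φ T Z x d : RR}
    (hZ : ∀ ε : RR, |ε| = 1 → ∀ F : Finset CC, (∀ ρ ∈ F, T < ε*ρ.im) → ∑ ρ ∈ F, mz χ ρ * EX (-(φ*(ε*ρ.im-T))) ≤ Z)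
    (hφ : 0 < φ) (hφ1 : φ ≤ 0.2824) (hT : 100 ≤ T) (hd : 6.28 * |d| ≤ T) (hdφ : d^2*φ ≤ 0.753*T) (hx : 1 ≤ x) (hc84 : 0.84 ≤ CS (2*φ))
    (F : Finset CC) (hF : ∀ ρ ∈ F, T < |ρ.im|) {N : RR}
    (hN : N = √(2*PI/CS (2*φ)) * EX ((|d| * SN φ)^2/(2*CS (2*φ)))) :
    ∑ ρ ∈ F, mz χ ρ * (x^ρ.re * ‖Gk 1 (d*I) ρ‖) ≤ EX (-(φ*T)) * Z * (x*(1/2*(N + 2*EX (|d| * SN φ) + 5)) + √x*(6*N)) := by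
  classical
  have hc0 : 0 < CS (2*φ) := by linarith
  have hpi := Real.pi_gt_d2
  have hpi2 := Real.pi_lt_d2
  have hsin0 : 0 ≤ SN φ := Real.sin_nonneg_of_nonneg_of_le_pi hφ.le bL
  have hN0 : 0 ≤ N := by rw [hN]; positivity
  have big : ∀ ε : RR, |ε| = 1 → ∀ σ : RR, 1/2 ≤ σ → σ ≤ 1 → Jr (CS (2*φ)) (-(d*ε)*SN φ) σ ≤ 2*EX (|d| * SN φ) + N := by
    intro ε hε σ h1 h2
    have hle : -(d*ε)*SN φ ≤ |d| * SN φ := by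
      refine mLR ?_ hsin0
      refine (neg_le_abs _).trans ?_
      rw [abs_mul, hε, mul_one]
    refine (Jr_mono hc0 bL hle).trans ((Jr_bound1 hc0 h1 h2).trans ?_)
    rw [max_eq_left bPq, hN]
  have small : ∀ ε : RR, 0 ≤ d*ε → ∀ σ : RR, 1/2 ≤ σ → σ ≤ 1 → Jr (CS (2*φ)) (-(d*ε)*SN φ) σ ≤ 5 := by
    intro ε hε σ h1 h2
    have hle : -(d*ε)*SN φ ≤ 0 := mul_nonpos_of_nonpos_of_nonneg bL hsin0
    refine (Jr_mono hc0 bL hle).trans ((Jr_bound1 hc0 h1 h2).trans ?_)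
    have : √(2*PI/CS (2*φ)) ≤ 3 := by
      rw [Real.sqrt_le_left bN, dI hc0]
      linarith
    norm_num
    linarith
  set b := 2*EX (|d| * SN φ) + N with hb
  have hb0 : 0 ≤ b := by positivity
  have hsplit : ∑ ρ ∈ F, mz χ ρ * (x^ρ.re * ‖Gk 1 (d*I) ρ‖) =
      ∑ ρ ∈ F.filter (fun ρ => 0 < ρ.im), mz χ ρ * (x^ρ.re * ‖Gk 1 (d*I) ρ‖) + ∑ ρ ∈ F.filter (fun ρ => ¬ 0 < ρ.im), mz χ ρ * (x^ρ.re * ‖Gk 1 (d*I) ρ‖) :=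
    (Finset.sum_filter_add_sum_filter_not F _ _).symm
  rw [hsplit]
  have hp : ∀ ρ ∈ F.filter (fun ρ => 0 < ρ.im), T < 1*ρ.im := by
    intro ρ h
    have h := Finset.mem_filter.1 h
    have := hF ρ h.1
    rw [abs_of_pos h.2] at this; linarith
  have hm : ∀ ρ ∈ F.filter (fun ρ => ¬ 0 < ρ.im), T < (-1)*ρ.im := by
    intro ρ h
    have h := Finset.mem_filter.1 h
    have := hF ρ h.1
    rw [abs_of_nonpos (not_lt.1 h.2)] at this; linarith
  have o1 : |(1:RR)| = 1 := by norm_num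
  have o2 : |(-1:RR)| = 1 := by norm_num
  rcases le_total 0 d with h | h
  · have s1 := high_sign hχ (B := 5) o1 (hZ 1 o1) hφ hφ1 hT hd hdφ hx hc84 bN (small 1 bL) _ hp
    have s2 := high_sign hχ (B := b) o2 (hZ (-1) o2) hφ hφ1 hT hd hdφ hx hc84 hb0 (big (-1) o2) _ hm
    rw [← hN] at s1 s2
    refine (add_le_add s1 s2).trans (le_of_eq ?_)
    rw [hb]; ring
  · have s1 := high_sign hχ (B := b) o1 (hZ 1 o1) hφ hφ1 hT hd hdφ hx hc84 hb0 (big 1 o1) _ hp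
    have s2 := high_sign hχ (B := 5) o2 (hZ (-1) o2) hφ hφ1 hT hd hdφ hx hc84 bN (small (-1) bL) _ hm
    rw [← hN] at s1 s2
    refine (add_le_add s1 s2).trans (le_of_eq ?_)
    rw [hb]; ring
end

section
open Filter Topology

lemma nonneg_of_deriv {f f' : RR → RR} (hd : ∀ y, HD f (f' y) y) (h0 : f 0 = 0) (hp : ∀ y, 0 ≤ y → 0 ≤ f' y) {y : RR} (hy : 0 ≤ y) : 0 ≤ f y := by
  have hm : MonotoneOn f (Ici 0) := by
    refine monotoneOn_of_deriv_nonneg (convex_Ici 0) (fun z _ => (hd z).continuousAt.continuousWithinAt) (fun z _ => (hd z).differentiableAt.differentiableWithinAt) ?_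
    intro z hz
    rw [interior_Ici] at hz
    rw [(hd z).deriv]; exact hp z (le_of_lt hz)
  rw [← h0]
  exact hm (mem_Ici.2 le_rfl) (mem_Ici.2 hy) hy

lemma cos_lower6 {y : RR} (hy : 0 ≤ y) : 1 - y^2/2 + y^4/24 - y^6/720 ≤ CS y := by
  have hpw : ∀ (n : ℕ) (c y : RR), HD (fun y : RR => c*y^n) (c*(n*y^(n-1))) y := fun n c y => (hasDerivAt_pow n y).const_mul c
  have s3 : ∀ y : RR, 0 ≤ y → y - y^3/6 ≤ SN y := by
    intro y hy
    have := nonneg_of_deriv (f := fun y => SN y - (1*y^1 - 1/6*y^3)) (f' := fun y => CS y - (1*((1:ℕ)*y^(1-1)) - 1/6*((3:ℕ)*y^(3-1))))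
      (fun y => (Real.hasDerivAt_sin y).sub ((hpw 1 1 y).sub (hpw 3 (1/6) y))) bS (fun y _ => by
        have := Real.one_sub_sq_div_two_le_cos (x := y); norm_num; linarith) hy
    linarith
  have c4 : ∀ y : RR, 0 ≤ y → CS y ≤ 1 - y^2/2 + y^4/24 := by
    intro y hy
    have := nonneg_of_deriv (f := fun y => ((1 - 1/2*y^2) + 1/24*y^4) - CS y) (f' := fun y => ((0 - 1/2*((2:ℕ)*y^(2-1))) + 1/24*((4:ℕ)*y^(4-1))) - (-SN y))
      (fun y => ((((hasDerivAt_const y 1).sub (hpw 2 (1/2) y)).add (hpw 4 (1/24) y))).sub (Real.hasDerivAt_cos y)) bS (fun y h => by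
        have := s3 y h; norm_num; linarith) hy
    linarith
  have s5 : ∀ y : RR, 0 ≤ y → SN y ≤ y - y^3/6 + y^5/120 := by
    intro y hy
    have := nonneg_of_deriv (f := fun y => ((1*y^1 - 1/6*y^3) + 1/120*y^5) - SN y) (f' := fun y => ((1*((1:ℕ)*y^(1-1)) - 1/6*((3:ℕ)*y^(3-1))) + 1/120*((5:ℕ)*y^(5-1))) - CS y)
      (fun y => ((((hpw 1 1 y).sub (hpw 3 (1/6) y)).add (hpw 5 (1/120) y))).sub (Real.hasDerivAt_sin y)) bS (fun y h => by
        have := c4 y h; norm_num; linarith) hy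
    linarith
  have := nonneg_of_deriv (f := fun y => CS y - (((1 - 1/2*y^2) + 1/24*y^4) - 1/720*y^6)) (f' := fun y => -SN y - (((0 - 1/2*((2:ℕ)*y^(2-1))) + 1/24*((4:ℕ)*y^(4-1))) - 1/720*((6:ℕ)*y^(6-1))))
      (fun y => (Real.hasDerivAt_cos y).sub ((((hasDerivAt_const y 1).sub (hpw 2 (1/2) y)).add (hpw 4 (1/24) y)).sub (hpw 6 (1/720) y))) bS (fun y h => by
        have := s5 y h; norm_num; linarith) hy
  linarith

lemma cos_facts {φ : RR} (h0 : 0 ≤ φ) (h1 : φ ≤ 0.2824) :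
    0.8445 ≤ CS (2*φ) ∧ 1 ≤ CS (2*φ) * (1+2*φ^2*(1+1.916*φ^2)) := by
  have h := cos_lower6 (y := 2*φ) bL
  obtain ⟨p, hp⟩ : ∃ p, p = φ^2 := ⟨_, rfl⟩
  have hp0 : 0 ≤ p := hp ▸ sq_nonneg φ
  have hp1 : p ≤ 0.07975 := by rw [hp]; nlinarith
  have e : 1 - (2*φ)^2/2 + (2*φ)^4/24 - (2*φ)^6/720 = 1-2*p+2/3*p^2-4/45*p^3 := by rw [hp]; ring
  rw [e] at h
  rw [← hp]
  have hp2 : p^2 ≤ 0.07975*p := by nlinarith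
  have hp3 : 0 ≤ p^2 := sq_nonneg p
  have hp4 : p^3 ≤ 0.07975*p^2 := by nlinarith
  constructor
  · refine le_trans ?_ h
    nlinarith
  · have : 1 ≤ (1-2*p+2/3*p^2-4/45*p^3)*(1+2*p*(1+1.916*p)) := by
      have : 0 ≤ p^2*(0.4986 - 6.42*p+2.37*p^2-0.341*p^3) := by
        refine mul_nonneg hp3 ?_
        nlinarith
      have hp5 : 0 ≤ p^3 := by positivity
      have hp6 : 0 ≤ p^4 := by positivity
      have hp7 : 0 ≤ p^5 := by positivity
      nlinarith
    refine this.trans (mLR h bPq)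

lemma gauss_exp_le {φ D : RR} (h0 : 0 ≤ φ) (h1 : φ ≤ 0.2824) :
    (D * SN φ)^2/(2*CS (2*φ)) ≤ D^2*(φ^2*(1+1.916*φ^2)/2) := by
  obtain ⟨hc, h2⟩ := cos_facts h0 h1
  rw [dI bL, mul_pow, mul_assoc]
  refine mLL ?_ (sq_nonneg D)
  have e : CS (2*φ) = 1 - 2*SN φ^2 := by rw [Real.cos_two_mul, Real.cos_sq']; ring
  nlinarith

lemma exp_ub {x : RR} (h0 : 0 ≤ x) (h1 : x ≤ 1) : EX x ≤ 1+x+x^2/2+x^3/6+x^4/24+x^5/100 := by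
  have := Real.exp_bound' h0 h1 (n := 5) bN
  simp [Finset.sum_range_succ, Nat.factorial] at this
  linarith

lemma sqrt_c {φ : RR} (h0 : 0 ≤ φ) (h1 : φ ≤ 0.2824) : √(2*PI/CS (2*φ)) ≤ 2.73 := by
  obtain ⟨hc, _⟩ := cos_facts h0 h1
  rw [Real.sqrt_le_left bN, dI bL]
  have := Real.pi_lt_d2
  have := Real.pi_lt_d4
  nlinarith

lemma log_ge {y v u : RR} (hy : 0 < y) (h0 : 0 ≤ u) (h1 : u ≤ 1) (hv : v = 4*u) (h : (1+u+u^2/2+u^3/6+u^4/24+u^5/100)^4 ≤ y) : v ≤ LG y := by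
  rw [Real.le_log_iff_exp_le hy, hv, show EX (4*u) = EX u^4 by rw [← Real.exp_nat_mul]; norm_num]
  exact (pow_le_pow_left₀ (eP _).le (exp_ub h0 h1) 4).trans h
end

section
open Filter Topology

noncomputable def Zf (l φ T : RR) : RR := EX (1.5*φ)/φ * (l + 0.022 + 1/(φ*T) + 1.3*φ) / (3.43-0.974*φ)

lemma Zf_le {l φ T C : RR} (hφ : 0 < φ) (h1 : φ ≤ 0.282375) (hl : l + 0.022 + 1/(φ*T) + 1.3*φ ≤ C) (hC : 0 ≤ C) :
    Zf l φ T ≤ 0.4843*C/φ := by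
  unfold Zf
  have e1 : EX (1.5*φ) ≤ 1.5278 := by
    refine (Real.exp_le_exp.2 (show 1.5*φ ≤ 0.4236 by linarith)).trans ?_
    refine (exp_ub bN bN).trans ?_
    norm_num
  rw [dI bL]
  have h2 : EX (1.5*φ)/φ * (l + 0.022 + 1/(φ*T) + 1.3*φ) ≤ 1.5278/φ*C :=
    (mLL hl bPq).trans (mLR (by gcongr) hC)
  refine h2.trans ?_
  have e : 0.4843*C/φ*(3.43-0.974*φ) - 1.5278/φ*C = C/φ*(0.4843*(3.43-0.974*φ)-1.5278) := by ring
  have : 0 ≤ C/φ*(0.4843*(3.43-0.974*φ)-1.5278) := mul_nonneg bPq bL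
  linarith

lemma numA {l T D : RR} (hT : 100 ≤ T) (hD : 0 ≤ D) (hDT : 6.28*D ≤ T) (hl : 2.76 ≤ l) (hA : D^2 ≤ 8/3*T) :
    EX (-(0.282375*T)) * Zf l 0.282375 T * (1/2*(√(2*PI/CS (2*0.282375)) * EX ((D * SN 0.282375)^2/(2*CS (2*0.282375))) + 2*EX (D*SN 0.282375) + 5))
      ≤ 0.998 * (l*(4.329*EX (-0.1598*T))) := by
  obtain ⟨φ, hφ⟩ : ∃ φ : RR, φ = 0.282375 := ⟨_, rfl⟩
  rw [← hφ]
  have hφ0 : 0 ≤ φ := by rw [hφ]; norm_num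
  have hφ1 : φ ≤ 0.2824 := by rw [hφ]; norm_num
  have z := Zf_le (l := l) (φ := φ) (T := T) (C := l+0.43) (by rw [hφ]; norm_num) (by rw [hφ]) (by
    have : 1/(φ*T) ≤ 1/28 := by gcongr; rw [hφ]; linarith
    rw [hφ] at this ⊢; norm_num at this ⊢; linarith) bL
  have z2 : Zf l φ T ≤ 2*l := by
    refine z.trans ?_
    rw [hφ, dI bN]
    linarith
  have g := gauss_exp_le (D := D) hφ0 hφ1
  have g2 : D^2*(φ^2*(1+1.916*φ^2)/2) ≤ (8/3*T)*(φ^2*(1+1.916*φ^2)/2) := mLR hA bPq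
  have g3 : -(φ*T) + (8/3*T)*(φ^2*(1+1.916*φ^2)/2) ≤ -0.1598*T := by rw [hφ]; norm_num; linarith
  set M := EX (-0.1598*T) with hM
  have f1 : EX (-(φ*T)) * (√(2*PI/CS (2*φ)) * EX ((D * SN φ)^2/(2*CS (2*φ)))) ≤ 2.73*M := by
    have : EX (-(φ*T)) * EX ((D * SN φ)^2/(2*CS (2*φ))) ≤ M := by
      rw [← eA]; apply Real.exp_le_exp.2; linarith
    have := mul_le_mul (sqrt_c hφ0 hφ1) this bPq bN
    linarith
  have hs : D*SN φ ≤ D*φ := mLL (Real.sin_le hφ0) hD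
  have f2 : EX (-(φ*T)) * (2*EX (D*SN φ) + 5) ≤ M := by
    have h5 : 2*EX (D*SN φ) + 5 ≤ EX 2 * EX (D*φ) := by
      have a1 := Real.exp_le_exp.2 hs
      have a2 : 1 ≤ EX (D*φ) := Real.one_le_exp bPq
      have a3 : 7 ≤ EX 2 := by
        rw [show (2:RR) = 1+1 by norm_num, eA]; have := Real.exp_one_gt_d9; nlinarith
      nlinarith
    refine (mLL h5 (eP _).le).trans ?_
    rw [← eA, ← eA]; apply Real.exp_le_exp.2
    rw [hφ]; linarith
  have hM0 : 0 < M := eP _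
  set n := √(2*PI/CS (2*φ)) * EX ((D * SN φ)^2/(2*CS (2*φ))) with hn
  set m := 2*EX (D*SN φ) + 5 with hm
  have hm0 : 0 < m := by positivity
  have hn0 : 0 ≤ n := by positivity
  have f3 : EX (-(φ*T)) * (1/2*(n+m)) ≤ 1.87*M := by linarith
  calc _ = Zf l φ T * (EX (-(φ*T)) * (1/2*(n+m))) := by rw [hm]; ring
    _ ≤ 2*l * (1.87*M) := mul_le_mul z2 f3 bPq bL
    _ ≤ _ := by nlinarith [mul_pos (show 0 < l by linarith) hM0]

lemma numB_key {T s t X : RR} (ht : 6.283 ≤ t) (hs : s = t^2) (hT : 0 < T) {φ : RR} (hφ : φ = 0.753*s/T) (hφ1 : φ ≤ 0.282375) (hX : X = s*(-0.0434955+0.543195*φ^2)) :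
    (T/s)*EX (-0.426*s)*(1.012*EX X+0.0015) ≤ 0.998*(4.329*EX (-0.1598*T) + 0.1276*t*(T/s)*EX (-0.426*s)) := by
  have hs0 : 39.47 ≤ s := by rw [hs]; nlinarith only [ht]
  have hφ0 : 0 ≤ φ := by rw [hφ]; positivity
  set M := EX (-0.426*s) with hM
  have hM0 : 0 < M := eP _
  set k := T/s with hk
  have hk0 : 0 < k := by positivity
  have hkM : 0 < k*M := by positivity
  have hφ2 : φ^2 ≤ 0.282375^2 := by gcongr
  have hX0 : X ≤ 0 := by
    rw [hX]; refine mul_nonpos_of_nonneg_of_nonpos bL ?_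
    norm_num at hφ2 ⊢; linarith
  have eX : EX X ≤ 1 := Real.exp_le_one_iff.2 hX0
  have hE := eP (-0.1598*T)
  by_cases h8 : 8 ≤ t
  · have : 1.012*EX X+0.0015 ≤ 0.998*(0.1276*t) := by linarith
    have := mLL this hkM.le
    linarith
  push Not at h8
  have hs1 : s ≤ 64 := by rw [hs]; nlinarith only [ht, h8]
  by_cases h3 : T ≤ 8/3*s+32/3
  · have hk1 : k ≤ 2.938 := by
      rw [hk, dI bL]; linarith
    have e1 : 0.17*M ≤ EX (-0.1598*T) := by
      have e2 : EX (-0.1598*T) = EX (-0.1598*T+0.426*s) * M := by rw [hM, ← eA]; congr 1; ring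
      rw [e2]
      refine mLR ?_ hM0.le
      refine le_trans ?_ (Real.exp_le_exp.2 (show -1.72 ≤ -0.1598*T+0.426*s by linarith))
      rw [show (-1.72:RR) = -(2*0.86) by norm_num, Real.exp_neg, le_inv_comm₀ bN (eP _), show EX (2*0.86) = EX 0.86^2 by rw [← Real.exp_nat_mul]; norm_num]
      refine (pow_le_pow_left₀ (eP _).le (exp_ub bN bN) 2).trans ?_
      norm_num
    have e3 : k*M*0.25 ≤ 4.329*EX (-0.1598*T) := by
      have := mLR hk1 hM0.le
      linarith
    have : 1.012*EX X+0.0015 ≤ 0.998*(0.1276*t+0.25) := by linarith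
    have := mLL this hkM.le
    linarith
  · push Not at h3
    have hφ3 : φ*(s+4) ≤ 0.282375*s := by
      rw [hφ, div_mul_eq_mul_div, dI hT]
      nlinarith only [h3, hs0]
    have hX1 : X ≤ -0.25 := by
      have h4 : φ ≤ 0.282375*s/(s+4) := by rw [lI bL]; exact hφ3
      have h5 : φ^2 ≤ (0.282375*s/(s+4))^2 := by gcongr
      have h6 : s*(-0.0434955+0.543195*(0.282375*s/(s+4))^2) ≤ -0.25 := by
        rw [div_pow, ← mul_div_assoc, ← sub_nonneg]
        have e : -0.25 - s*(-0.0434955+0.543195*(0.282375*s)^2/(s+4)^2) = ((-0.25+0.0434955*s)*(s+4)^2 - 0.543195*0.282375^2*s^3)/(s+4)^2 := by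
          have : s+4 ≠ 0 := by linarith
          field_simp
          ring
        rw [e]
        refine div_nonneg ?_ bPq
        have : 0 ≤ (s-39.47)*(64-s) := mul_nonneg bL bL
        norm_num
        nlinarith only [this, hs0, hs1]
      rw [hX]
      refine le_trans ?_ h6
      refine mLL ?_ bL
      linarith
    have e1 : EX X ≤ 0.781 := by
      refine (Real.exp_le_exp.2 hX1).trans ?_
      rw [Real.exp_neg, inv_le_comm₀ (eP _) bN]
      refine le_trans ?_ (Real.quadratic_le_exp_of_nonneg bN)
      norm_num
    have : 1.012*EX X+0.0015 ≤ 0.998*(0.1276*t) := by linarith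
    have := mLL this hkM.le
    linarith

set_option maxHeartbeats 1000000 in
lemma numB {l T D φ : RR} (hT : 100 ≤ T) (hD : 0 < D) (hDT : 2*PI*D ≤ T) (hl : 2.8 ≤ l) (hB : 8/3*T ≤ D^2) (hφ : φ = 0.753*T/D^2) :
    EX (-(φ*T)) * Zf l φ T * (1/2*(√(2*PI/CS (2*φ)) * EX ((D * SN φ)^2/(2*CS (2*φ))) + 2*EX (D*SN φ) + 5))
      ≤ 0.998 * (l*(4.329*EX (-0.1598*T) + 0.802*(D/(2*PI))*EX (-0.1065*(2*T/D)^2))) := by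
  have hpi := Real.pi_gt_d4
  have hpi2 := Real.pi_lt_d4
  have hT0 : 0 < T := by linarith
  set t := T/D with ht
  have ht1 : 6.283 ≤ t := by rw [ht, lI hD]; exact (mLR (by linarith only [hpi]) hD.le).trans hDT
  set s := t^2 with hs
  have hs0 : 39.47 ≤ s := by rw [hs]; nlinarith only [ht1]
  have hDt : D = T/t := by rw [ht]; field_simp
  have hφs : φ = 0.753*s/T := by rw [hφ, hs, ht]; field_simp
  have hφ0 : 0 < φ := by rw [hφs]; positivity
  have hφ1 : φ ≤ 0.282375 := by rw [hφ, dI bPq]; linarith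
  have hφ2 : φ ≤ 0.2824 := by linarith
  have hφT : φ*T = 0.753*s := by rw [hφs]; field_simp
  set X := s*(-0.0434955+0.543195*φ^2) with hX
  have key := numB_key ht1 hs hT0 hφs hφ1 hX
  have e1 : EX (-0.1065*(2*T/D)^2) = EX (-0.426*s) := by
    congr 1; rw [hs, ht]; ring
  rw [e1]
  set M := EX (-0.426*s) with hM
  have hM0 : 0 < M := eP _
  have z := Zf_le (l := l) (φ := φ) (T := T) (C := 1.1512*l) hφ0 hφ1 (by
    have : 1/(φ*T) ≤ 1/29.7 := by gcongr; rw [hφT]; linarith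
    norm_num at this ⊢; linarith) bL
  have z2 : Zf l φ T ≤ 0.7405*l*(T/s) := by
    refine z.trans ?_
    rw [hφs]
    have : 0.4843*(1.1512*l)/(0.753*s/T) = (0.4843*1.1512/0.753)*l*(T/s) := by field_simp
    rw [this]
    refine mLR ?_ bPq
    refine mLR ?_ bL
    norm_num
  have g := gauss_exp_le (D := D) hφ0.le hφ2
  have g2 : D^2*(φ^2*(1+1.916*φ^2)/2) = 0.753^2*s*(1+1.916*φ^2)/2 := by
    have : D^2*φ^2 = 0.753^2*s := by rw [hφs, hDt, hs]; field_simp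
    linear_combination ((1+1.916*φ^2)/2)*this
  have f1 : EX (-(φ*T)) * (√(2*PI/CS (2*φ)) * EX ((D * SN φ)^2/(2*CS (2*φ)))) ≤ 2.73*(M*EX X) := by
    have : EX (-(φ*T)) * EX ((D * SN φ)^2/(2*CS (2*φ))) ≤ M*EX X := by
      rw [← eA, hM, ← eA]; apply Real.exp_le_exp.2
      rw [hφT, hX]
      have : 0 ≤ s*φ^2 := by positivity
      norm_num at g2 ⊢
      linarith
    have := mul_le_mul (sqrt_c hφ0.le hφ2) this bPq bN
    linarith
  have hs' : D*SN φ ≤ D*φ := mLL (Real.sin_le hφ0.le) hD.le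
  have hDφ : D*φ = 0.753*t := by rw [hφs, hDt, hs]; field_simp
  have f2 : EX (-(φ*T)) * (2*EX (D*SN φ) + 5) ≤ 0.004*M := by
    have h5 : 2*EX (D*SN φ) + 5 ≤ 7 * EX (D*φ) := by
      have a1 := Real.exp_le_exp.2 hs'
      have a2 : 1 ≤ EX (D*φ) := Real.one_le_exp bPq
      linarith
    refine (mLL h5 (eP _).le).trans ?_
    have h6 : EX (-(φ*T)) * EX (D*φ) ≤ EX (-8) * M := by
      rw [hM, ← eA, ← eA]; apply Real.exp_le_exp.2
      rw [hφT, hDφ, hs]; nlinarith only [ht1]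
    have h7 : EX (-8) ≤ 0.00057 := by
      rw [Real.exp_neg, inv_le_comm₀ (eP _) bN, show EX 8 = EX 1^8 by rw [← Real.exp_nat_mul]; norm_num]
      refine le_trans ?_ (pow_le_pow_left₀ bN Real.exp_one_gt_d9.le 8)
      norm_num
    have := mLR h7 hM0.le
    linarith
  set n := √(2*PI/CS (2*φ)) * EX ((D * SN φ)^2/(2*CS (2*φ))) with hn
  set m := 2*EX (D*SN φ) + 5 with hm
  have hm0 : 0 < m := by positivity
  have hn0 : 0 ≤ n := by positivity
  have f3 : EX (-(φ*T)) * (1/2*(n+m)) ≤ M*(1.365*EX X+0.002) := by linarith only [f1, f2]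
  have hk : 0 < T/s := by positivity
  have hl0 : 0 < l := by linarith
  have hEX := eP X
  have h9 : 0.1276*t*(T/s)*M ≤ 0.802*(D/(2*PI))*M := by
    refine mLR ?_ hM0.le
    have : t*(T/s) = D := by rw [hDt, hs]; field_simp
    rw [mul_assoc, this, ← mul_div_assoc, lI bPq]
    nlinarith only [hD, hpi2]
  calc _ = Zf l φ T * (EX (-(φ*T)) * (1/2*(n+m))) := by rw [hm]; ring
    _ ≤ 0.7405*l*(T/s) * (M*(1.365*EX X+0.002)) := mul_le_mul z2 f3 bPq bPq
    _ ≤ l*((T/s)*M*(1.012*EX X+0.0015)) := by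
      have a1 : 0 ≤ l*(T/s)*M*EX X := by positivity
      have a2 : 0 ≤ l*(T/s)*M := by positivity
      linarith only [a1, a2]
    _ ≤ l*(0.998*(4.329*EX (-0.1598*T) + 0.1276*t*(T/s)*M)) := mLL key hl0.le
    _ ≤ _ := by
      have := mLL h9 hl0.le
      linarith only [this]
end

section
open Filter Topology
variable {q : ℕ} [NeZero q] {χ : DC q}

lemma high_total (hχ : χ.IsPrimitive) {T d x : RR} (hT : 100 ≤ T) (hx : 1 ≤ x) (hd : 2*PI*|d| ≤ T) (F : Finset CC)
    (hF : ∀ ρ ∈ F, T < |ρ.im|) {R : RR}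
    (hR : R = LG (q*T/(2*PI))*(4.329*EX (-0.1598*T) + 0.802*(|d|/(2*PI))*EX (-0.1065*(2*T/|d|)^2))) :
    ∑ ρ ∈ F, mz χ ρ*(x^ρ.re*‖Gk 1 (d*Complex.I) ρ‖) ≤ 0.998*R*x + 12*R*√x := by
  have hpi := Real.pi_gt_d4
  have hpi2 := Real.pi_lt_d4
  have hq : (1:RR) ≤ q := by exact_mod_cast NeZero.one_le
  have hy : T/6.2832 ≤ q*T/(2*PI) := by
    gcongr
    · nlinarith
    · linarith
  set l := LG (q*T/(2*PI)) with hl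
  have hl1 : 2.76 ≤ l := log_ge (u := 0.69) bPq bN bN bN (by
    refine le_trans ?_ hy
    rw [lI bN]
    norm_num; linarith)
  have hd0 := abs_nonneg d
  obtain ⟨φ, h0, h1, h2, hmain⟩ : ∃ φ : RR, 0 < φ ∧ φ ≤ 0.2824 ∧ d^2*φ ≤ 0.753*T ∧
      EX (-(φ*T)) * Zf l φ T * (1/2*(√(2*PI/CS (2*φ)) * EX ((|d| * SN φ)^2/(2*CS (2*φ))) + 2*EX (|d| * SN φ) + 5)) ≤ 0.998*R := by
    by_cases hA : |d|^2 ≤ 8/3*T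
    · refine ⟨0.282375, by norm_num, by norm_num, ?_, (numA hT hd0 (by nlinarith) hl1 hA).trans ?_⟩
      · rw [sq_abs] at hA; linarith
      · rw [hR]
        have : 0 ≤ l*(0.802*(|d|/(2*PI))*EX (-0.1065*(2*T/|d|)^2)) := by positivity
        linarith
    · push Not at hA
      have hdp : 0 < |d| := by
        rcases hd0.eq_or_lt with h | h
        · rw [← h] at hA; linarith
        · exact h
      have hT5 : 105 ≤ T := by nlinarith
      have hl2 : 2.8 ≤ l := log_ge (u := 0.7) bPq bN bN bN (by
        refine le_trans ?_ hy
        rw [lI bN]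
        norm_num; linarith)
      refine ⟨0.753*T/|d|^2, by positivity, ?_, ?_, (numB hT hdp hd hl2 hA.le rfl).trans_eq (by rw [hR])⟩
      · rw [dI bPq]; linarith
      · rw [← sq_abs]; apply le_of_eq; field_simp
  have hc := cos_facts h0.le h1
  have hZ : ∀ ε:RR, |ε|=1 → ∀ F : Finset CC, (∀ρ∈F, T<ε*ρ.im) → ∑ ρ ∈ F, mz χ ρ*EX (-(φ*(ε*ρ.im-T))) ≤ Zf l φ T := by
    intro ε hε F hF
    have := zsum hχ hε h0 h1 hT F hF
    rw [Zf, lI bL, mul_comm]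
    exact this
  obtain ⟨N, hN⟩ : ∃ N, N = √(2*PI/CS (2*φ))*EX ((|d| * SN φ)^2/(2*CS (2*φ))) := ⟨_, rfl⟩
  have := high_zeros hχ hZ h0 h1 hT (by nlinarith) h2 hx (by linarith [hc.1]) F hF hN
  refine this.trans ?_
  rw [← hN] at hmain
  have hN0 : 0 ≤ N := by rw [hN]; positivity
  have hZ0 : 0 ≤ Zf l φ T := by
    have := hZ 1 bS ∅ bS
    simpa using this
  have hW : 0 ≤ EX (-(φ*T)) * Zf l φ T := by positivity
  set W := EX (-(φ*T)) * Zf l φ T with hWd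
  set m := EX (|d| * SN φ) with hm
  have hm0 : 0 < m := eP _
  have h3 : W*(6*N) ≤ 12*R := by
    have a1 : 0 ≤ W*N := by positivity
    have a2 : 0 ≤ W*m := by positivity
    nlinarith
  have hs : 0 ≤ √x := sN x
  have b1 := mLR h3 hs
  have b2 := mLR hmain (show 0 ≤ x by linarith)
  linarith
end

section
open Filter Topology

lemma gtail (a : RR) : IntegrableOn (fun t : RR => t*EX (-t^2/2)) (Ioi a) ∧ ∫ t in Ioi a, t*EX (-t^2/2) = EX (-a^2/2) := by
  have hd : ∀ t : RR, HD (fun t : RR => -EX (-t^2/2)) (t*EX (-t^2/2)) t := fun t => by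
    have := ((((hasDerivAt_id t).pow 2).neg.div_const 2).exp).neg
    refine this.congr_deriv ?_
    simp; ring
  have hi : Integrable (fun t : RR => t*EX (-t^2/2)) := by
    have := integrable_mul_exp_neg_mul_sq (show (0:RR) < 1/2 by norm_num)
    refine this.congr (eF fun t => ?_)
    simp only; congr 2; ring
  refine ⟨hi.integrableOn, ?_⟩
  have ht : Tendsto (fun t : RR => -EX (-t^2/2)) atTop (𝓝 (-0)) := by
    refine (Real.tendsto_exp_atBot.comp ?_).neg
    have : Tendsto (fun t : RR => t^2*(-(1/2))) atTop atBot :=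
      (tendsto_pow_atTop bN).atTop_mul_const_of_neg bN
    refine this.congr fun t => by ring
  rw [integral_Ioi_of_hasDerivAt_of_tendsto' (fun t _ => hd t) hi.integrableOn ht]
  simp

lemma gsq : IntegrableOn (fun t : RR => t^2*EX (-t^2/2)) (Ioi 0) ∧ ∫ t in Ip, t^2*EX (-t^2/2) ≤ 1.25332 := by
  have e : ∀ t ∈ Ip, t^(2:RR)*EX (-(1/2)*t^(2:RR)) = t^2*EX (-t^2/2) := fun t _ => by
    rw [show (2:RR) = ((2:ℕ):RR) by norm_num, Real.rpow_natCast]; congr 2; push_cast; ring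
  constructor
  · refine (integrableOn_rpow_mul_exp_neg_mul_rpow (p := 2) (s := 2) (b := 1/2) bN bN bN).congr_fun e mI
  · rw [← setIntegral_congr_fun mI e, integral_rpow_mul_exp_neg_mul_rpow bN bN bN]
    rw [show ((2:RR)+1)/2 = 1/2+1 by norm_num, Real.Gamma_add_one bN, Real.Gamma_one_half_eq, show (-(2+1)/2 : RR) = -(1+1/2) by norm_num, Real.rpow_neg bN, Real.rpow_add bN, Real.rpow_one, ← Real.sqrt_eq_rpow]
    have : √PI = √(PI/2)*√2 := by rw [← Real.sqrt_mul bPq]; congr 1; ring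
    have h2 : √(1/2:RR)⁻¹ = √2 := by norm_num
    have h3 : (1/2*√(1/2))⁻¹*(1/2)*(1/2*√PI) = √(PI/2) := by
      rw [mul_inv, ← Real.sqrt_inv, h2, this]
      have := Real.mul_self_sqrt (show (0:RR) ≤ 2 by norm_num)
      linear_combination (1/2)*√(PI/2)*this
    rw [h3]
    refine Real.sqrt_le_iff.2 ⟨by norm_num, ?_⟩
    have := Real.pi_lt_d6
    norm_num at this ⊢; linarith

lemma triv_sum {x : RR} (hx : 1 ≤ x) (s : Finset ℕ) :
    ∑ n ∈ s, vM n * EX (-(n/x)^2/2) ≤ 6.751*x := by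
  have hx0 : 0 < x := by linarith
  set g : RR → RR := fun t => t*EX (-t^2/2) with hg
  have h1 : ∀ n : ℕ, EX (-(n/x)^2/2) = ∫ t, (Ioi (n/x:RR)).indicator g t := fun n => by
    rw [integral_indicator mI, (gtail _).2]
  have hi : ∀ n : ℕ, Integrable ((Ioi (n/x:RR)).indicator g) := fun n =>
    (integrable_indicator_iff mI).2 (gtail _).1
  simp_rw [h1, ← iC]
  rw [← integral_finsetSum _ fun n _ => (hi n).const_mul _]
  have hI : Integrable ((Ip).indicator fun t => (5.3863*x)*(t^2*EX (-t^2/2))) :=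
    (integrable_indicator_iff mI).2 (gsq.1.const_mul _)
  refine (integral_mono (integrable_finsetSum _ fun n _ => (hi n).const_mul _) hI ?_).trans ?_
  · intro t
    simp only
    by_cases ht : 0 < t
    · rw [indicator_of_mem (show t ∈ Ioi 0 from ht)]
      have hp : ∑ n ∈ s, vM n * (Ioi (n/x:RR)).indicator g t ≤ Chebyshev.psi (x*t) * g t := by
        rw [Chebyshev.psi_eq_sum_Icc, Finset.sum_mul]
        have hg0 : 0 ≤ g t := by rw [hg]; positivity
        have : ∑ n ∈ s, vM n * (Ioi (n/x:RR)).indicator g t = ∑ n ∈ s.filter (fun n : ℕ => (n/x:RR) < t), vM n * g t := by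
          rw [Finset.sum_filter]
          refine Finset.sum_congr rfl fun n _ => ?_
          simp [indicator]
        rw [this]
        refine Finset.sum_le_sum_of_subset_of_nonneg ?_ fun n _ _ => mul_nonneg vN hg0
        intro n hn
        rw [Finset.mem_filter, div_lt_iff₀ hx0] at hn
        rw [Finset.mem_Icc]
        exact ⟨Nat.zero_le _, Nat.le_floor (by linarith [hn.2])⟩
      refine hp.trans ?_
      have h4 : LG 4 + 4 ≤ 5.3863 := by
        have := Real.log_two_lt_d9
        rw [show (4:RR) = 2^2 by norm_num, Real.log_pow]; norm_num at this ⊢; linarith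
      have h5 := (Chebyshev.psi_le_const_mul_self (x := x*t) bPq).trans (mLR h4 bPq)
      have := mLR h5 (show 0 ≤ g t by rw [hg]; positivity)
      refine this.trans_eq ?_
      rw [hg]; ring
    · rw [indicator_of_notMem (by simpa using ht)]
      refine Finset.sum_nonpos fun n _ => ?_
      rw [indicator_of_notMem, mul_zero]
      simp only [mem_Ioi, not_lt] at ht ⊢
      exact ht.trans bPq
  · rw [integral_indicator mI, iC]
    have := mLL gsq.2 (show 0 ≤ 5.3863*x by positivity)
    linarith
end

section
open Filter Topology

lemma fin_num {T D r lq L l R : RR} (hT : 100 ≤ T) (hD : 0 ≤ D) (hDT : 2*PI*D ≤ T) (hr : 16*T ≤ r^2) (hr0 : 40 ≤ r) (hlq : 0 ≤ lq) (hl : 0 ≤ l) (hL : l ≤ L)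
    (hR : R = l*(4.329*EX (-0.1598*T) + 0.802*(D/(2*PI))*EX (-0.1065*(2*T/D)^2))) :
    r*(2.06*(√T*(L+5.3))) + (0.998*R*r^2 + 12*R*r) + 17*(lq+10) + 3.26*r + 7.5
      ≤ R*r^2 + (2.337*√T*L + 21.817*√T + 2.85*lq + 74.38)*r := by
  have hpi := Real.pi_gt_d4
  have hs0 : 0 ≤ √T := sN T
  have hsT : √T*√T = T := Real.mul_self_sqrt bL
  have hR0 : 0 ≤ R := by rw [hR]; positivity
  have h8 : EX (-8) ≤ 0.00057 := by
    rw [Real.exp_neg, inv_le_comm₀ (eP _) bN, show EX 8 = EX 1^8 by rw [← Real.exp_nat_mul]; norm_num]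
    refine le_trans ?_ (pow_le_pow_left₀ bN Real.exp_one_gt_d9.le 8)
    norm_num
  have key : 12*R ≤ 0.002*R*r + 0.277*(√T*L) := by
    by_cases h6 : 6000 ≤ r
    · have : 0 ≤ R*(r-6000) := mul_nonneg hR0 bL
      have : 0 ≤ √T*L := mul_nonneg hs0 bL
      linarith
    push Not at h6
    have hT2 : T ≤ 2250000 := by nlinarith
    have hs1 : √T ≤ 1500 := Real.sqrt_le_iff.2 ⟨by norm_num, by linarith⟩
    have hs2 : 10 ≤ √T := Real.le_sqrt_of_sq_le bL
    have e1 : EX (-0.1598*T) ≤ 0.00057 := (Real.exp_le_exp.2 bL).trans h8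
    have e2 : D/(2*PI)*EX (-0.1065*(2*T/D)^2) ≤ T/39*0.00057 := by
      rcases hD.eq_or_lt with h | h
      · rw [← h]; simp; positivity
      · have h1 : D/(2*PI) ≤ T/39 := by
          rw [dD bPq bN]; nlinarith
        refine mul_le_mul h1 ((Real.exp_le_exp.2 ?_).trans h8) (eP _).le bPq
        have : 9 ≤ 2*T/D := by rw [lI h]; nlinarith
        nlinarith
    have e3 : 4.329*EX (-0.1598*T) + 0.802*(D/(2*PI))*EX (-0.1065*(2*T/D)^2) ≤ 0.0185*√T := by
      have : T ≤ 1500*√T := by nlinarith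
      linarith
    have e4 : R ≤ L*(0.0185*√T) := by
      rw [hR]; exact mul_le_mul hL e3 bPq bL
    have : 0 ≤ R*r := by positivity
    have : 0 ≤ √T*L := mul_nonneg hs0 bL
    linarith
  have a1 := mLR key (show 0 ≤ r by linarith)
  have a2 : 0 ≤ lq*(r-40) := mul_nonneg hlq bL
  have a3 : 0 ≤ √T*r := by positivity
  linarith

variable {q : ℕ} [NeZero q] {χ : DC q}

lemma big_x (hχ : χ.IsPrimitive) {T d x : RR} (hT : 100 ≤ T) (hd : 2*PI*|d| ≤ T) (hx : 16*T ≤ x)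
    (hGRH : ∀ ρ : CC, χ.LFunction ρ = 0 → 0 < ρ.re → ρ.re < 1 → |ρ.im| ≤ T → ρ.re = 1/2) {R : RR}
    (hR : R = LG (q*T/(2*PI))*(4.329*EX (-0.1598*T) + 0.802*(|d|/(2*PI))*EX (-0.1065*(2*T/|d|)^2))) :
    ∃ S, HasSum (fun n:ℕ => (vM n:CC)*χ n*fw (1/x^2) (d/x) n) S ∧
      ‖S - Xie q*(x*Gk 1 (d*Complex.I) 1)‖ ≤ R*x + (2.337*√T*LG (q*T) + 21.817*√T + 2.85*LG q + 74.38)*√x := by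
  have hpi := Real.pi_gt_d4
  have hq : (1:RR) ≤ q := by exact_mod_cast NeZero.one_le
  have hG : ∀ ρ, mz χ ρ ≠ 0 → |ρ.im| ≤ T → ρ.re = 1/2 := fun ρ h1 h2 => by
    obtain ⟨a, b, c⟩ := Xi_zero hχ (mz_zero hχ h1)
    exact hGRH ρ a b c h2
  have hx0 : 0 ≤ x := by linarith
  have hd0 := abs_nonneg d
  obtain ⟨S, h1, h2⟩ := explicit_bound hχ (x := x) (d := d) (B := √x*(2.06*(√T*(LG (q*T)+5.3))) + (0.998*R*x + 12*R*√x)) bL (by nlinarith) (fun ρ hρ => by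
      rw [Complex.sq_norm, Complex.normSq_apply]
      by_cases h : |ρ.im| ≤ T
      · rw [hG ρ hρ h]; nlinarith [sq_nonneg ρ.im]
      · push Not at h
        have : 100^2 ≤ ρ.im^2 := by rw [← sq_abs ρ.im]; gcongr; linarith
        nlinarith [sq_nonneg ρ.re]) (fun F => by
      rw [← Finset.sum_filter_add_sum_filter_not F (fun ρ => |ρ.im| ≤ T)]
      refine add_le_add ?_ (high_total hχ hT bL hd _ (fun ρ hρ => by simpa using (Finset.mem_filter.1 hρ).2) hR)
      rw [← Finset.sum_filter_add_sum_filter_not _ (fun ρ => mz χ ρ ≠ 0)]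
      rw [Finset.sum_eq_zero (s := Finset.filter (fun ρ => ¬ mz χ ρ ≠ 0) _) (fun ρ hρ => by
        have := (Finset.mem_filter.1 hρ).2
        push Not at this
        rw [this, zero_mul]), add_zero]
      have hF : ∀ ρ ∈ (F.filter (fun ρ => |ρ.im| ≤ T)).filter (fun ρ => mz χ ρ ≠ 0), ρ.re = 1/2 ∧ |ρ.im| ≤ T := fun ρ hρ => by
        rw [Finset.mem_filter, Finset.mem_filter] at hρ
        exact ⟨hG ρ hρ.2 hρ.1.2, hρ.1.2⟩
      refine le_trans (le_of_eq ?_) (mLL (low_zeros hχ hT _ hF d) (sN x))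
      rw [Finset.mul_sum]
      refine Finset.sum_congr rfl fun ρ hρ => ?_
      rw [(hF ρ hρ).1, ← Real.sqrt_eq_rpow]; ring)
  refine ⟨S, h1, h2.trans ?_⟩
  have hr : √x^2 = x := Real.sq_sqrt hx0
  have := fin_num (T := T) (D := |d|) (r := √x) (lq := LG q) (L := LG (q*T)) hT hd0 hd (by rw [hr]; exact hx) (Real.le_sqrt_of_sq_le bL) (Real.log_nonneg hq)
    (Real.log_nonneg (by rw [lI bPq]; nlinarith [Real.pi_lt_d4])) (Real.log_le_log bPq (div_le_self bPq bL)) hR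
  rw [hr] at this
  exact this
end

section
lemma e2pi_norm (t : RR) : ‖e2pi t‖ = 1 := by
  rw [e2pi, show (2*PI*Complex.I*t : CC) = ((2*PI*t : RR):CC)*Complex.I by push_cast; ring, Complex.norm_exp_ofReal_mul_I]

lemma main_norm (δ : RR) : ‖∫ t in Ip, e2pi (δ * t) * (EX (-t^2 / 2) : CC)‖ ≤ 1.2534 := by
  refine (norm_integral_le_integral_norm _).trans ?_
  have : ∀ t : RR, ‖e2pi (δ * t) * (EX (-t^2 / 2) : CC)‖ = EX (-(1/2)*t^2) := fun t => by
    rw [norm_mul, e2pi_norm, one_mul, cN, rN (eP _).le]; congr 1; ring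
  simp_rw [this]
  rw [integral_gaussian_Ioi, dI bN]
  refine Real.sqrt_le_iff.2 ⟨by norm_num, ?_⟩
  have := Real.pi_lt_d6
  norm_num at this ⊢; linarith

lemma triv_bound {q : ℕ} [NeZero q] (χ : DC q) {x : RR} (hx : 1 ≤ x) (δ : RR) :
    ‖∑' n : ℕ, (vM n : CC) * χ (n : ZMod q) * e2pi (δ * n / x) * (EX (-(n / x)^2 / 2) : CC)‖ ≤ 6.751*x := by
  have h0 : ∀ n : ℕ, 0 ≤ vM n * EX (-(n/x)^2/2) := fun n => mul_nonneg vN (eP _).le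
  have hs := summable_of_sum_le h0 (triv_sum hx)
  refine (tsum_of_norm_bounded hs.hasSum fun n => ?_).trans (hs.tsum_le_of_sum_le (triv_sum hx))
  rw [norm_mul, norm_mul, norm_mul, e2pi_norm, cN, cN, mul_one, rN (eP _).le, rN vN]
  refine mLR ?_ (eP _).le
  exact mO vN (DirichletCharacter.norm_le_one χ _)

lemma small_num {T x L : RR} (hT : 100 ≤ T) (hx : 1 ≤ x) (hxT : x ≤ 16*T) (hL : 4.4 ≤ L) :
    8.0045 ≤ (2.337*√T*L + 21.817*√T)*x^(-(1:RR)/2) := by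
  have e : x^(-(1:RR)/2) = (√x)⁻¹ := by rw [show (-(1:RR)/2) = -(1/2) by norm_num, Real.rpow_neg bL, Real.sqrt_eq_rpow]
  rw [e, ← div_eq_mul_inv, lI (Real.sqrt_pos.2 bL)]
  have h1 : √x ≤ 4*√T := by
    refine Real.sqrt_le_iff.2 ⟨by positivity, ?_⟩
    rw [mul_pow, Real.sq_sqrt bL]; linarith
  nlinarith [sN T]
end

theorem gaussian_major_arc_conditional
    (x : ℝ) (hx : 1 ≤ x) (δ : ℝ)
    (q : ℕ) [NeZero q] (χ : DirichletCharacter ℂ q) (hχ : χ.IsPrimitive)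
    (T₀ : ℝ) (hT₀ : max (4 * Real.pi^2 * |δ|) 100 ≤ T₀)
    (hGRH : ∀ ρ : ℂ, χ.LFunction ρ = 0 → 0 < ρ.re → ρ.re < 1 → |ρ.im| ≤ T₀ →
      ρ.re = 1/2) :
    ∃ E : ℂ,
      (∑' n : ℕ, (ArithmeticFunction.vonMangoldt n : ℂ) * χ (n : ZMod q)
          * e2pi (δ * n / x) * (Real.exp (-(n / x)^2 / 2) : ℂ))
        = (if q = 1 then
            (∫ t in Set.Ioi (0:ℝ), e2pi (δ * t) * (Real.exp (-t^2 / 2) : ℂ)) * x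
          else 0) + E * x ∧
      ‖E‖ ≤ Real.log (q * T₀ / (2 * Real.pi))
              * (4.329 * Real.exp (-0.1598 * T₀)
                + 0.802 * |δ| * Real.exp (-0.1065 * (T₀ / (Real.pi * |δ|))^2))
            + (2.337 * Real.sqrt T₀ * Real.log (q * T₀) + 21.817 * Real.sqrt T₀
                + 2.85 * Real.log q + 74.38) * x ^ (-(1:ℝ)/2)
            + (3 * Real.log q + 14 * |δ| + 17) * x⁻¹
            + (Real.log q + 6) * (1 + 5 * |δ|) * x ^ (-(3:ℝ)/2) := by
  obtain ⟨hT1, hT⟩ := max_le_iff.1 hT₀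
  have hpi := Real.pi_gt_d4
  have hpi2 := Real.pi_lt_d4
  have hx0 : 0 < x := by linarith
  have hxc : (x:CC) ≠ 0 := by exact_mod_cast hx0.ne'
  have hq : (1:RR) ≤ q := by exact_mod_cast NeZero.one_le
  have hlq : 0 ≤ LG q := Real.log_nonneg hq
  have hδ := abs_nonneg δ
  have hl : 0 ≤ LG (q*T₀/(2*PI)) := Real.log_nonneg (by rw [lI bPq]; nlinarith)
  have hL : 4.4 ≤ LG (q*T₀) := by
    rw [Real.le_log_iff_exp_le bPq, show EX 4.4 = EX 0.88^5 by rw [← Real.exp_nat_mul]; norm_num]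
    refine (pow_le_pow_left₀ (eP _).le (exp_ub bN bN) 5).trans (le_trans ?_ (show 100 ≤ q*T₀ by nlinarith))
    norm_num
  set Sm := ∑' n : ℕ, (vM n : CC) * χ (n : ZMod q)
          * e2pi (δ * n / x) * (EX (-(n / x)^2 / 2) : CC) with hSm
  set Mn : CC := if q = 1 then
            (∫ t in Ip, e2pi (δ * t) * (EX (-t^2 / 2) : CC)) * x
          else 0 with hMn
  refine ⟨(Sm-Mn)/x, by field_simp; ring, ?_⟩
  have p2 : 0 ≤ (3 * LG q + 14 * |δ| + 17) * x⁻¹ := by positivity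
  have p3 : 0 ≤ (LG q + 6) * (1 + 5 * |δ|) * x ^ (-(3:RR)/2) := by positivity
  obtain ⟨R, hR⟩ : ∃ R, R = LG (q * T₀ / (2 * PI))
              * (4.329 * EX (-0.1598 * T₀)
                + 0.802 * |δ| * EX (-0.1065 * (T₀ / (PI * |δ|))^2)) := ⟨_, rfl⟩
  have hR0 : 0 ≤ R := by rw [hR]; positivity
  rw [← hR]
  have hp : 0 < x ^ (-(1:RR)/2) := by positivity
  rw [norm_div, cN, rN hx0.le]
  rcases le_total x (16*T₀) with hxT | hxT
  · have h1 : ‖Sm-Mn‖ ≤ 8.0045*x := by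
      have a1 := triv_bound χ hx δ
      have a2 : ‖Mn‖ ≤ 1.2534*x := by
        rw [hMn]
        split_ifs
        · rw [norm_mul, cN, rN hx0.le]
          exact mLR (main_norm δ) hx0.le
        · simp; positivity
      refine (norm_sub_le _ _).trans ?_
      rw [← hSm] at a1
      linarith
    have h2 := small_num hT hx hxT hL
    have h3 : ‖Sm-Mn‖/x ≤ 8.0045 := by rwa [dI hx0]
    have h4 : 0 ≤ (2.85 * LG q + 74.38) * x ^ (-(1:RR)/2) := by positivity
    linarith
  · have hdd : |2*PI*δ| = 2*PI*|δ| := by rw [abs_mul, abs_of_pos bPq]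
    obtain ⟨S, h1, h2⟩ := big_x hχ (T := T₀) (d := 2*PI*δ) (R := R) hT (by rw [hdd]; linarith) hxT hGRH (by
      rw [hR, hdd, mul_div_cancel_left₀ _ bPq, show 2*T₀/(2*PI*|δ|) = T₀/(PI*|δ|) by rw [mul_assoc, mul_div_mul_left _ _ bN]])
    have hS : S = Sm := by
      rw [← h1.tsum_eq, hSm]
      refine tsum_congr fun n => ?_
      rw [mul_assoc (_ * _)]
      congr 1
      rw [fw, gk, e2pi, Complex.ofReal_exp, ← Complex.exp_add]
      congr 1
      push_cast
      field_simp
      ring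
    have hM : Xie q*(x*Gk 1 ((2*PI*δ:RR)*Complex.I) 1) = Mn := by
      rw [hMn, Xie]
      split_ifs
      · rw [Complex.ofReal_one, one_mul, mul_comm, Gk]
        congr 1
        refine integral_congr_ae (Filter.Eventually.of_forall fun t => ?_)
        simp only [sub_self, Complex.cpow_zero, mul_one]
        rw [gk, e2pi, Complex.ofReal_exp, ← Complex.exp_add]
        congr 1
        push_cast
        ring
      · simp
    rw [hS, hM] at h2
    have e1 : x^(-(1:RR)/2) = √x/x := by
      rw [show (-(1:RR)/2) = 1/2-1 by norm_num, Real.rpow_sub hx0, Real.rpow_one, Real.sqrt_eq_rpow]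
    have h3 : ‖Sm-Mn‖/x ≤ R + (2.337*√T₀*LG (q*T₀) + 21.817*√T₀ + 2.85*LG q + 74.38)*x^(-(1:RR)/2) := by
      rw [dI hx0, e1]
      refine h2.trans_eq ?_
      field_simp
    linarith
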